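/- Fix a real number u. As x → ∞, (1/x)·#{n : 1 < n ≤ x and ω(s(n)) − log log x ≤ u·√(log log x)} tends to (1/√(2π)) ∫_{−∞}^{u} e^{−t²/2} dt. That is, ω(s(n)) is asymptotically normally distributed with mean and variance log log x. -/

import Mathlib

open Filter

namespace ErdosKac

/-- The primes in the interval `(M, P]`. -/
def primesIoc (M P : ℕ) : Finset ℕ := (Finset.Ioc M P).filter Nat.Prime

lemma mem_primesIoc {M P p : ℕ} : p ∈ primesIoc M P ↔ (M < p ∧ p ≤ P) ∧ p.Prime := by
  simp [primesIoc]

lemma log_factorial_eq_sum (N : ℕ) :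
    Real.log (N.factorial) =
      ∑ p ∈ primesIoc 0 N, (N.factorial.factorization p : ℝ) * Real.log p := by
  rw [Real.log_nat_eq_sum_factorization, Finsupp.sum]
  apply Finset.sum_subset
  · intro p hp
    rw [Nat.support_factorization, Nat.mem_primeFactors] at hp
    exact mem_primesIoc.2 ⟨⟨hp.1.pos, (hp.1.dvd_factorial).1 hp.2.1⟩, hp.1⟩
  · intro p _ hp
    rw [Finsupp.notMem_support_iff] at hp
    simp [hp]

lemma div_le_factorization_factorial {p : ℕ} (hp : p.Prime) (N : ℕ) :
    N / p ≤ N.factorial.factorization p := by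
  rw [← Nat.Prime.pow_dvd_iff_le_factorization hp (Nat.factorial_ne_zero N),
    Nat.Prime.pow_dvd_factorial_iff hp (Nat.lt_succ_self _)]
  by_cases h : p ≤ N
  · have h1 : 1 ∈ Finset.Ico 1 (Nat.log p N).succ := by
      have := Nat.log_pos hp.one_lt h
      exact Finset.mem_Ico.2 ⟨le_rfl, by omega⟩
    simpa using Finset.single_le_sum (f := fun i => N / p ^ i) (fun _ _ => Nat.zero_le _) h1
  · rw [Nat.div_eq_of_lt (not_le.1 h)]; exact Nat.zero_le _

lemma log_le_two_mul_sqrt {t : ℝ} (ht : 0 < t) : Real.log t ≤ 2 * √t := by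
  have h1 := Real.log_le_sub_one_of_pos (Real.sqrt_pos.2 ht)
  rw [Real.log_sqrt ht.le] at h1
  linarith

lemma exists_sum_log_div_mul_le :
    ∃ C : ℝ, 0 ≤ C ∧ ∀ s : Finset ℕ, (∀ p ∈ s, 2 ≤ p) →
      ∑ p ∈ s, Real.log p / (p * (p - 1 : ℝ)) ≤ C := by
  have hs : Summable (fun n : ℕ => 4 * ((n : ℝ) ^ (3 / 2 : ℝ))⁻¹) :=
    (Real.summable_nat_rpow_inv.2 (by norm_num)).mul_left 4
  refine ⟨∑' n : ℕ, 4 * ((n : ℝ) ^ (3 / 2 : ℝ))⁻¹, tsum_nonneg fun n => by positivity,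
    fun s h => le_trans (Finset.sum_le_sum fun p hp => ?_) (hs.sum_le_tsum s fun n _ => by positivity)⟩
  have hp2 : (2 : ℝ) ≤ p := by exact_mod_cast h p hp
  have hp0 : (0 : ℝ) < p := by linarith
  have h1 := log_le_two_mul_sqrt hp0
  have h2 : (p : ℝ) ^ (3 / 2 : ℝ) = p * √p := by
    rw [Real.sqrt_eq_rpow, ← Real.rpow_one_add' hp0.le (by norm_num)]; norm_num
  rw [h2, div_le_iff₀ (by nlinarith)]
  have h3 : (p : ℝ) = √p * √p := (Real.mul_self_sqrt hp0.le).symm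
  have h4 : 0 < √(p : ℝ) := Real.sqrt_pos.2 hp0
  have : 4 * (p * √(p : ℝ))⁻¹ * (p * (p - 1)) = 4 * ((p - 1) / √p) := by
    field_simp
  rw [this]
  refine h1.trans ?_
  rw [← mul_div_assoc, le_div_iff₀ h4]
  nlinarith

/-- Mertens' first theorem. -/
lemma exists_abs_sum_log_div_sub_log_le :
    ∃ C : ℝ, 0 ≤ C ∧ ∀ N : ℕ, 1 ≤ N →
      |∑ p ∈ primesIoc 0 N, Real.log p / p - Real.log N| ≤ C := by
  obtain ⟨C, hC0, hC⟩ := exists_sum_log_div_mul_le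
  refine ⟨max (Real.log 4) (1 + C), le_max_of_le_right (by linarith), fun N hN => ?_⟩
  have hN0 : (0 : ℝ) < N := by exact_mod_cast hN
  have hfac := log_factorial_eq_sum N
  have hpr : ∀ p ∈ primesIoc 0 N, (2 : ℝ) ≤ p := fun p hp => by
    exact_mod_cast (mem_primesIoc.1 hp).2.two_le
  rw [abs_sub_le_iff]
  constructor
  · refine le_trans ?_ (le_max_left _ _)
    have h1 : ∑ p ∈ primesIoc 0 N, ((N : ℝ) / p - 1) * Real.log p ≤ Real.log N.factorial := by
      rw [hfac]
      refine Finset.sum_le_sum fun p hp => mul_le_mul_of_nonneg_right ?_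
        (Real.log_nonneg (by linarith [hpr p hp]))
      have : (N : ℝ) / p < (N / p : ℕ) + 1 := by
        rw [← Nat.floor_div_eq_div (K := ℝ)]
        exact Nat.lt_floor_add_one _
      have h2 : ((N / p : ℕ) : ℝ) ≤ N.factorial.factorization p := by
        exact_mod_cast div_le_factorization_factorial (mem_primesIoc.1 hp).2 N
      linarith
    have h2 : ∑ p ∈ primesIoc 0 N, Real.log p ≤ Real.log 4 * N := by
      have := Chebyshev.theta_le_log4_mul_x hN0.le
      rwa [Chebyshev.theta, Nat.floor_natCast] at this
    have h3 : Real.log N.factorial ≤ N * Real.log N := by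
      rw [← Real.log_pow]
      refine Real.log_le_log (by exact_mod_cast Nat.factorial_pos N) ?_
      exact_mod_cast Nat.factorial_le_pow N
    have h4 : ∑ p ∈ primesIoc 0 N, ((N : ℝ) / p - 1) * Real.log p =
        N * ∑ p ∈ primesIoc 0 N, Real.log p / p - ∑ p ∈ primesIoc 0 N, Real.log p := by
      rw [Finset.mul_sum, ← Finset.sum_sub_distrib]
      exact Finset.sum_congr rfl fun p _ => by ring
    have : N * (∑ p ∈ primesIoc 0 N, Real.log p / p) ≤ N * (Real.log N + Real.log 4) := by
      nlinarith
    have := le_of_mul_le_mul_left this hN0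
    linarith
  · refine le_trans ?_ (le_max_right _ _)
    have h1 : Real.log N.factorial ≤
        ∑ p ∈ primesIoc 0 N, (N * (Real.log p / p) + N * (Real.log p / (p * (p - 1 : ℝ)))) := by
      rw [hfac]
      refine Finset.sum_le_sum fun p hp => ?_
      have hp2 := hpr p hp
      have hpp := (mem_primesIoc.1 hp).2
      have h2 : N.factorial.factorization p ≤ N / (p - 1) :=
        Nat.factorization_factorial_le_div_pred hpp N
      have h3 : (N.factorial.factorization p : ℝ) ≤ N / (p - 1 : ℝ) := by
        calc (N.factorial.factorization p : ℝ) ≤ ((N / (p - 1) : ℕ) : ℝ) := by exact_mod_cast h2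
          _ ≤ (N : ℝ) / ((p - 1 : ℕ) : ℝ) := Nat.cast_div_le
          _ = _ := by rw [Nat.cast_pred hpp.pos]
      calc _ ≤ N / (p - 1 : ℝ) * Real.log p :=
            mul_le_mul_of_nonneg_right h3 (Real.log_nonneg (by linarith))
        _ = _ := by
          have : (p : ℝ) - 1 ≠ 0 := by linarith
          have : (p : ℝ) ≠ 0 := by linarith
          field_simp
          ring
    rw [Finset.sum_add_distrib, ← Finset.mul_sum, ← Finset.mul_sum] at h1
    have h2 := hC (primesIoc 0 N) fun p hp => (mem_primesIoc.1 hp).2.two_le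
    have h3 := Stirling.le_log_factorial_stirling (n := N) (by omega)
    have h4 : 0 ≤ Real.log N := Real.log_nonneg (by exact_mod_cast hN)
    have h5 : 0 ≤ Real.log (2 * Real.pi) := Real.log_nonneg (by linarith [Real.pi_gt_three])
    have : N * (Real.log N - (1 + C)) ≤ N * (∑ p ∈ primesIoc 0 N, Real.log p / p) := by
      nlinarith
    have := le_of_mul_le_mul_left this hN0
    linarith

lemma sum_inv_primes_succ (N : ℕ) (f : ℕ → ℝ) :
    ∑ p ∈ primesIoc 0 (N + 1), f p =
      ∑ p ∈ primesIoc 0 N, f p + if (N + 1).Prime then f (N + 1) else 0 := by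
  simp only [primesIoc, Finset.sum_filter]
  rw [← Finset.insert_Ioc_right_eq_Ioc_add_one (Nat.zero_le N), Finset.sum_insert (by simp), add_comm]

/-- Mertens' second theorem, up to a bounded error. -/
lemma exists_abs_sum_inv_sub_log_log_le :
    ∃ C : ℝ, 0 ≤ C ∧ ∀ N : ℕ, 2 ≤ N →
      |∑ p ∈ primesIoc 0 N, (1 : ℝ) / p - Real.log (Real.log N)| ≤ C := by
  obtain ⟨C, hC0, hC⟩ := exists_abs_sum_log_div_sub_log_le
  set A : ℕ → ℝ := fun N => ∑ p ∈ primesIoc 0 N, Real.log p / p with hA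
  set S : ℕ → ℝ := fun N => ∑ p ∈ primesIoc 0 N, (1 : ℝ) / p with hS
  have hlog2 : 0 < Real.log 2 := Real.log_pos (by norm_num)
  set B : ℕ → ℝ := fun N => S N - A N / Real.log N with hB
  have hlog : ∀ N : ℕ, 2 ≤ N → Real.log 2 ≤ Real.log N := fun N hN =>
    Real.log_le_log (by norm_num) (by exact_mod_cast hN)
  have step : ∀ N : ℕ, 2 ≤ N →
      B (N + 1) - B N = A N * (1 / Real.log N - 1 / Real.log (N + 1 : ℕ)) := by
    intro N hN
    have h1 := hlog N hN
    have h2 := hlog (N + 1) (by omega)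
    have h3 : Real.log N ≠ 0 := by linarith
    have h4 : Real.log (N + 1 : ℕ) ≠ 0 := by linarith
    simp only [hB, hS, hA, sum_inv_primes_succ N]
    have h5 : ((N + 1 : ℕ) : ℝ) ≠ 0 := by positivity
    split_ifs <;> field_simp <;> ring
  have upper : ∀ N : ℕ, 2 ≤ N → B N ≤ Real.log (Real.log N) - C / Real.log N +
      (B 2 - Real.log (Real.log 2) + C / Real.log 2) := by
    intro N hN
    induction N, hN using Nat.le_induction with
    | base => norm_num
    | succ N hN ih =>
      have h1 := hlog N hN
      have h2 := hlog (N + 1) (by omega)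
      have h12 : Real.log N ≤ Real.log (N + 1 : ℕ) :=
        Real.log_le_log (by positivity) (by push_cast; linarith)
      set a := Real.log N
      set b := Real.log (N + 1 : ℕ)
      have ha : 0 < a := by linarith
      have hb : 0 < b := by linarith
      have h3 : A N ≤ a + C := by
        have := (abs_sub_le_iff.1 (hC N (by omega))).1
        simp only [hA]; linarith
      have h4 : 0 ≤ 1 / a - 1 / b := sub_nonneg.2 (one_div_le_one_div_of_le ha h12)
      have h5 : 1 - a / b ≤ Real.log b - Real.log a := by
        have := Real.one_sub_inv_le_log_of_pos (div_pos hb ha)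
        rwa [inv_div, Real.log_div hb.ne' ha.ne'] at this
      have h6 := step N hN
      have h7 : A N * (1 / a - 1 / b) ≤ (a + C) * (1 / a - 1 / b) :=
        mul_le_mul_of_nonneg_right h3 h4
      have h8 : (a + C) * (1 / a - 1 / b) = 1 - a / b + C / a - C / b := by
        field_simp
        ring
      linarith
  have lower : ∀ N : ℕ, 2 ≤ N → Real.log (Real.log N) + C / Real.log N
      + (B 2 - Real.log (Real.log 2) - C / Real.log 2)
      - (1 / (Real.log 2) ^ 2) * (1 - 1 / (N - 1 : ℝ)) ≤ B N := by
    intro N hN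
    induction N, hN using Nat.le_induction with
    | base => norm_num
    | succ N hN ih =>
      have h1 := hlog N hN
      have h2 := hlog (N + 1) (by omega)
      have hN2 : (2 : ℝ) ≤ N := by exact_mod_cast hN
      have h12 : Real.log N ≤ Real.log (N + 1 : ℕ) :=
        Real.log_le_log (by positivity) (by push_cast; linarith)
      have hd : Real.log (N + 1 : ℕ) - Real.log N ≤ 1 / N := by
        rw [← Real.log_div (by positivity) (by positivity)]
        refine (Real.log_le_sub_one_of_pos (by positivity)).trans (le_of_eq ?_)
        push_cast
        field_simp
        ring
      set a := Real.log N
      set b := Real.log (N + 1 : ℕ)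
      have ha : 0 < a := by linarith
      have hb : 0 < b := by linarith
      have h3 : a - C ≤ A N := by
        have := (abs_sub_le_iff.1 (hC N (by omega))).2
        simp only [hA]; linarith
      have h4 : 0 ≤ 1 / a - 1 / b := sub_nonneg.2 (one_div_le_one_div_of_le ha h12)
      have h5 : Real.log b - Real.log a ≤ b / a - 1 := by
        have := Real.log_le_sub_one_of_pos (div_pos hb ha)
        rwa [Real.log_div hb.ne' ha.ne'] at this
      have h5' : b / a - 1 - (1 - a / b) ≤ (1 / (Real.log 2) ^ 2) * (1 / N ^ 2) := by
        have e : b / a - 1 - (1 - a / b) = (b - a) ^ 2 / (a * b) := by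
          field_simp
        rw [e]
        calc (b - a) ^ 2 / (a * b) ≤ (1 / N) ^ 2 / (Real.log 2 ^ 2) := by
              have : 0 ≤ b - a := by linarith
              gcongr
              rw [pow_two]
              gcongr
          _ = _ := by field_simp
      have h6 := step N hN
      have h7 : (a - C) * (1 / a - 1 / b) ≤ A N * (1 / a - 1 / b) :=
        mul_le_mul_of_nonneg_right h3 h4
      have h8 : (a - C) * (1 / a - 1 / b) = 1 - a / b - C / a + C / b := by
        field_simp
        ring
      have h9 : (1 : ℝ) / N ^ 2 ≤ 1 / (N - 1 : ℝ) - 1 / N := by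
        rw [div_sub_div _ _ (by linarith) (by linarith), div_le_div_iff₀ (by positivity) (by nlinarith)]
        nlinarith
      have h10 : (1 / (Real.log 2) ^ 2) * (1 / (N : ℝ) ^ 2) ≤
          (1 / (Real.log 2) ^ 2) * (1 / (N - 1 : ℝ) - 1 / N) :=
        mul_le_mul_of_nonneg_left h9 (by positivity)
      have h11 : ((N + 1 : ℕ) : ℝ) - 1 = N := by push_cast; ring
      rw [h11]
      linarith
  have hBA : ∀ N : ℕ, 2 ≤ N → |S N - B N| ≤ 1 + C / Real.log 2 := by
    intro N hN
    have h1 := hlog N hN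
    have ha : 0 < Real.log N := by linarith
    have h2 : S N - B N = A N / Real.log N := by simp only [hB]; ring
    have h3 := abs_sub_le_iff.1 (hC N (by omega))
    rw [h2, abs_div, abs_of_pos ha, div_le_iff₀ ha, abs_le]
    have h4 : C ≤ C / Real.log 2 * Real.log N := by
      rw [div_mul_eq_mul_div, le_div_iff₀ hlog2]
      nlinarith
    constructor <;> simp only [hA] <;> nlinarith
  refine ⟨1 + C / Real.log 2 + |B 2 - Real.log (Real.log 2)| + C / Real.log 2 + 1 / Real.log 2 ^ 2,
    by positivity, fun N hN => ?_⟩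
  have h1 := upper N hN
  have h2 := lower N hN
  have h3 := abs_sub_le_iff.1 (hBA N hN)
  have h4 : 0 ≤ C / Real.log N := div_nonneg hC0 (by linarith [hlog N hN])
  have h5 : 1 / Real.log 2 ^ 2 * (1 - 1 / (N - 1 : ℝ)) ≤ 1 / Real.log 2 ^ 2 := by
    have hN2 : (2 : ℝ) ≤ N := by exact_mod_cast hN
    have : 0 ≤ 1 / (N - 1 : ℝ) := div_nonneg zero_le_one (by linarith)
    have h6 : 0 ≤ 1 / Real.log 2 ^ 2 := by positivity
    nlinarith
  have h6 := neg_abs_le (B 2 - Real.log (Real.log 2))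
  have h7 := le_abs_self (B 2 - Real.log (Real.log 2))
  have h8 : 0 ≤ 1 / Real.log 2 ^ 2 := by positivity
  have h9 : 0 ≤ C / Real.log 2 := by positivity
  change |S N - Real.log (Real.log N)| ≤ _
  rw [abs_le]
  constructor <;> linarith

/-- `r` has a prime factor in `(M, P]` that divides it exactly once. -/
def HasExactPrimeFactor (M P r : ℕ) : Prop := ∃ p ∈ primesIoc M P, ∃ m, r = p * m ∧ ¬ p ∣ m

open Classical in
/-- Pairs `(p, r)` with `p * r ≤ N`, `p` a prime in `(M, P]`, and `r` having an exact prime factor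
in `(M, P]`. -/
noncomputable def primePairs (N M P : ℕ) : Finset (ℕ × ℕ) :=
  ((primesIoc M P) ×ˢ (Finset.Ioc 0 N)).filter
    fun x => x.1 * x.2 ≤ N ∧ HasExactPrimeFactor M P x.2

/-- The sum of the reciprocals of the primes in `(M, P]`. -/
noncomputable def recipSum (M P : ℕ) : ℝ := ∑ p ∈ primesIoc M P, (1 : ℝ) / p

lemma mem_primePairs {N M P : ℕ} {x : ℕ × ℕ} : x ∈ primePairs N M P ↔
    x.1 ∈ primesIoc M P ∧ 0 < x.2 ∧ x.1 * x.2 ≤ N ∧ HasExactPrimeFactor M P x.2 := by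
  simp only [primePairs, Finset.mem_filter, Finset.mem_product, Finset.mem_Ioc]
  constructor
  · rintro ⟨⟨h1, h2, -⟩, h3, h4⟩
    exact ⟨h1, h2, h3, h4⟩
  · rintro ⟨h1, h2, h3, h4⟩
    refine ⟨⟨h1, h2, le_trans ?_ h3⟩, h3, h4⟩
    exact Nat.le_mul_of_pos_left _ (mem_primesIoc.1 h1).2.pos

lemma recipSum_nonneg (M P : ℕ) : 0 ≤ recipSum M P :=
  Finset.sum_nonneg fun _ _ => by positivity

lemma card_primesIoc_le (M P : ℕ) : (primesIoc M P).card ≤ P :=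
  (Finset.card_filter_le _ _).trans (by simp)

lemma card_dvd_le (N d : ℕ) :
    (((Finset.Ioc 0 N).filter fun n => d ∣ n).card : ℝ) ≤ N / d := by
  rw [Nat.Ioc_filter_dvd_card_eq_div]
  exact Nat.cast_div_le

lemma div_sub_one_le_card_dvd (N : ℕ) (d : ℕ) :
    (N : ℝ) / d - 1 ≤ ((Finset.Ioc 0 N).filter fun n => d ∣ n).card := by
  rw [Nat.Ioc_filter_dvd_card_eq_div, ← Nat.floor_div_eq_div (K := ℝ)]
  exact (Nat.sub_one_lt_floor _).le

/-- The number of primes in `(M, P]` dividing `n`. -/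
def primeDivCount (M P n : ℕ) : ℕ := ((primesIoc M P).filter fun p => p ∣ n).card

lemma primeDivCount_eq_sum (M P n : ℕ) :
    (primeDivCount M P n : ℝ) = ∑ p ∈ primesIoc M P, if p ∣ n then (1 : ℝ) else 0 := by
  simp [primeDivCount]

lemma sum_primeDivCount_ge (N M P : ℕ) :
    N * recipSum M P - P ≤ ∑ n ∈ Finset.Ioc 0 N, (primeDivCount M P n : ℝ) := by
  simp only [primeDivCount_eq_sum]
  rw [Finset.sum_comm]
  calc N * recipSum M P - P ≤ ∑ p ∈ primesIoc M P, ((N : ℝ) / p - 1) := by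
        rw [Finset.sum_sub_distrib, recipSum, Finset.mul_sum]
        have : ((primesIoc M P).card : ℝ) ≤ P := by exact_mod_cast card_primesIoc_le M P
        simp only [mul_one_div, Finset.sum_const, nsmul_eq_mul, mul_one]
        linarith
    _ ≤ _ := Finset.sum_le_sum fun p _ => by
        simpa using div_sub_one_le_card_dvd N p

lemma sum_primeDivCount_le (N M P : ℕ) :
    ∑ n ∈ Finset.Ioc 0 N, (primeDivCount M P n : ℝ) ≤ N * recipSum M P := by
  simp only [primeDivCount_eq_sum]
  rw [Finset.sum_comm, recipSum, Finset.mul_sum]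
  refine Finset.sum_le_sum fun p _ => ?_
  simpa [div_eq_mul_inv] using card_dvd_le N p

lemma sum_primeDivCount_sq_le (N M P : ℕ) :
    ∑ n ∈ Finset.Ioc 0 N, (primeDivCount M P n : ℝ) ^ 2 ≤
      N * recipSum M P ^ 2 + N * recipSum M P := by
  have h1 : ∀ n, (primeDivCount M P n : ℝ) ^ 2 = ∑ p ∈ primesIoc M P, ∑ q ∈ primesIoc M P,
      if p ∣ n ∧ q ∣ n then (1 : ℝ) else 0 := by
    intro n
    rw [pow_two, primeDivCount_eq_sum, Finset.sum_mul_sum]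
    refine Finset.sum_congr rfl fun p _ => Finset.sum_congr rfl fun q _ => ?_
    split_ifs <;> simp_all
  simp only [h1]
  rw [Finset.sum_comm]
  have h2 : ∀ p ∈ primesIoc M P, ∑ n ∈ Finset.Ioc 0 N, ∑ q ∈ primesIoc M P,
      (if p ∣ n ∧ q ∣ n then (1 : ℝ) else 0) ≤
        ∑ q ∈ primesIoc M P, (N : ℝ) / p * (1 / q) + N / p := by
    intro p hp
    have hpp := (mem_primesIoc.1 hp).2
    rw [Finset.sum_comm, ← Finset.add_sum_erase _ _ hp, add_comm]
    refine add_le_add ?_ ?_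
    · refine le_trans (Finset.sum_le_sum fun q hq => ?_)
        (Finset.sum_le_sum_of_subset_of_nonneg (Finset.erase_subset p _)
          fun _ _ _ => by positivity)
      rw [Finset.mem_erase] at hq
      have hqq := (mem_primesIoc.1 hq.2).2
      have h3 : ∀ n, (p ∣ n ∧ q ∣ n) ↔ p * q ∣ n := fun n =>
        ⟨fun h => Nat.Coprime.mul_dvd_of_dvd_of_dvd
          ((Nat.coprime_primes hpp hqq).2 (Ne.symm hq.1)) h.1 h.2,
        fun h => ⟨(dvd_mul_right _ _).trans h, (dvd_mul_left _ _).trans h⟩⟩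
      simp only [h3]
      have := card_dvd_le N (p * q)
      simp only [Finset.sum_boole]
      refine this.trans (le_of_eq ?_)
      push_cast
      rw [div_mul_div_comm, mul_one]
    · simpa using card_dvd_le N p
  refine (Finset.sum_le_sum h2).trans (le_of_eq ?_)
  rw [Finset.sum_add_distrib, pow_two]
  simp only [← Finset.mul_sum]
  change ∑ p ∈ primesIoc M P, (N : ℝ) / p * recipSum M P + _ = _
  rw [← Finset.sum_mul]
  have : ∑ p ∈ primesIoc M P, (N : ℝ) / p = N * recipSum M P := by
    rw [recipSum, Finset.mul_sum]
    exact Finset.sum_congr rfl fun p _ => by ring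
  rw [this]
  ring

lemma sum_abs_recipSum_sub_primeDivCount_le {N M P : ℕ} (hP : 2 * P ≤ N) :
    ∑ n ∈ Finset.Ioc 0 N, |recipSum M P - primeDivCount M P n| ≤ N * √(2 * recipSum M P) := by
  set l := recipSum M P with hl
  have hl0 : 0 ≤ l := recipSum_nonneg M P
  have hP' : (2 : ℝ) * P ≤ N := by exact_mod_cast hP
  have hsq : ∑ n ∈ Finset.Ioc 0 N, (l - primeDivCount M P n) ^ 2 ≤ N * (2 * l) := by
    have h1 := sum_primeDivCount_sq_le N M P
    have h2 := sum_primeDivCount_ge N M P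
    have h3 : ∑ n ∈ Finset.Ioc 0 N, (l - primeDivCount M P n) ^ 2 =
        N * l ^ 2 - 2 * l * ∑ n ∈ Finset.Ioc 0 N, (primeDivCount M P n : ℝ) +
          ∑ n ∈ Finset.Ioc 0 N, (primeDivCount M P n : ℝ) ^ 2 := by
      simp only [sub_sq, Finset.sum_add_distrib, Finset.sum_sub_distrib, ← Finset.mul_sum]
      simp
    rw [h3]
    nlinarith
  have hcs := sq_sum_le_card_mul_sum_sq (s := Finset.Ioc 0 N)
    (f := fun n => |l - primeDivCount M P n|)
  simp only [sq_abs, Nat.card_Ioc, Nat.sub_zero] at hcs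
  refine (Real.le_sqrt_of_sq_le
    (hcs.trans (mul_le_mul_of_nonneg_left hsq (by positivity)))).trans (le_of_eq ?_)
  rw [← mul_assoc, Real.sqrt_mul (by positivity), Real.sqrt_mul_self (by positivity)]

open Classical in
/-- The number of pairs in `primePairs N M P` with product `n`. -/
noncomputable def pairCount (M P n : ℕ) : ℕ :=
  ((primesIoc M P).filter fun p => p ∣ n ∧ HasExactPrimeFactor M P (n / p)).card

open Classical in
lemma pairCount_le (M P n : ℕ) : pairCount M P n ≤ primeDivCount M P n :=
  Finset.card_le_card fun p hp => by
    rw [Finset.mem_filter] at hp ⊢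
    exact ⟨hp.1, hp.2.1⟩

open Classical in
lemma pairCount_eq {M P n : ℕ} (h : 2 ≤ primeDivCount M P n)
    (hsq : ∀ p ∈ primesIoc M P, ¬ p ^ 2 ∣ n) : pairCount M P n = primeDivCount M P n := by
  rw [pairCount, primeDivCount]
  refine congrArg Finset.card (Finset.filter_congr fun p hp => ⟨fun h => h.1, fun hpn => ⟨hpn, ?_⟩⟩)
  obtain ⟨q, hq, hqp⟩ := Finset.exists_mem_ne (s := (primesIoc M P).filter fun p => p ∣ n) h p
  rw [Finset.mem_filter] at hq
  obtain ⟨k, rfl⟩ := hpn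
  have hpp := (mem_primesIoc.1 hp).2
  have hqq := (mem_primesIoc.1 hq.1).2
  rw [Nat.mul_div_cancel_left _ hpp.pos]
  obtain ⟨m, rfl⟩ : q ∣ k := (Nat.Coprime.dvd_mul_left
    ((Nat.coprime_primes hqq hpp).2 hqp)).1 hq.2
  refine ⟨q, hq.1, m, rfl, fun hqm => hsq q hq.1 ?_⟩
  rw [pow_two, ← mul_assoc, mul_comm p q, mul_assoc]
  exact mul_dvd_mul_left q (hqm.mul_left p)

lemma sum_primePairs {E : Type*} [NormedAddCommGroup E] [NormedSpace ℝ E] (N M P : ℕ) (g : ℕ → E) :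
    ∑ x ∈ primePairs N M P, g (x.1 * x.2) =
      ∑ n ∈ Finset.Ioc 0 N, (pairCount M P n : ℝ) • g n := by
  classical
  simp only [pairCount, Nat.cast_smul_eq_nsmul, ← Finset.sum_const]
  rw [Finset.sum_sigma']
  refine Finset.sum_nbij' (fun x => ⟨x.1 * x.2, x.1⟩) (fun y => (y.2, y.1 / y.2)) ?_ ?_ ?_ ?_ ?_
  · rintro ⟨p, r⟩ hx
    obtain ⟨h1, h2, h3, h4⟩ := mem_primePairs.1 hx
    have hp := (mem_primesIoc.1 h1).2.pos
    simp only [Finset.mem_sigma, Finset.mem_Ioc, Finset.mem_filter]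
    refine ⟨⟨Nat.mul_pos hp h2, h3⟩, h1, dvd_mul_right _ _, ?_⟩
    rwa [Nat.mul_div_cancel_left _ hp]
  · rintro ⟨n, p⟩ hx
    simp only [Finset.mem_sigma, Finset.mem_Ioc, Finset.mem_filter] at hx
    obtain ⟨⟨h1, h2⟩, h3, ⟨k, rfl⟩, h5⟩ := hx
    have hp := (mem_primesIoc.1 h3).2.pos
    rw [Nat.mul_div_cancel_left _ hp] at h5
    refine mem_primePairs.2 ?_
    simp only [Nat.mul_div_cancel_left _ hp]
    exact ⟨h3, Nat.pos_of_mul_pos_left h1, h2, h5⟩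
  · rintro ⟨p, r⟩ hx
    have hp := (mem_primesIoc.1 (mem_primePairs.1 hx).1).2.pos
    simp [Nat.mul_div_cancel_left _ hp]
  · rintro ⟨n, p⟩ hx
    simp only [Finset.mem_sigma, Finset.mem_Ioc, Finset.mem_filter] at hx
    simp [Nat.mul_div_cancel' hx.2.2.1]
  · intro x _
    rfl

lemma sum_inv_sq_Ioc_le {M P : ℕ} (hM : 0 < M) :
    ∑ p ∈ Finset.Ioc M P, (1 : ℝ) / (p : ℝ) ^ 2 ≤ 1 / M := by
  rcases le_or_gt M P with h | h
  · have h1 : ∑ p ∈ Finset.Ioc M P, (1 : ℝ) / (p : ℝ) ^ 2 ≤ 1 / M - 1 / P := by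
      induction P, h using Nat.le_induction with
      | base => simp
      | succ P hP ih =>
        rw [← Finset.insert_Ioc_right_eq_Ioc_add_one hP, Finset.sum_insert (by simp)]
        have hP0 : (0 : ℝ) < P := by exact_mod_cast lt_of_lt_of_le hM hP
        have : (1 : ℝ) / ((P + 1 : ℕ) : ℝ) ^ 2 ≤ 1 / P - 1 / (P + 1 : ℕ) := by
          push_cast
          rw [div_sub_div _ _ (by positivity) (by positivity),
            div_le_div_iff₀ (by positivity) (by positivity)]
          nlinarith
        linarith
    have : (0 : ℝ) ≤ 1 / P := by positivity
    linarith
  · rw [Finset.Ioc_eq_empty (by omega)]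
    simp

lemma card_sq_dvd_le {N M P : ℕ} (hM : 0 < M) :
    (((Finset.Ioc 0 N).filter fun n => ∃ p ∈ primesIoc M P, p ^ 2 ∣ n).card : ℝ) ≤ N / M := by
  have h1 : ((Finset.Ioc 0 N).filter fun n => ∃ p ∈ primesIoc M P, p ^ 2 ∣ n) ⊆
      (primesIoc M P).biUnion fun p => (Finset.Ioc 0 N).filter fun n => p ^ 2 ∣ n := by
    intro n hn
    simp only [Finset.mem_filter, Finset.mem_biUnion] at hn ⊢
    obtain ⟨h1, p, h2, h3⟩ := hn
    exact ⟨p, h2, h1, h3⟩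
  calc _ ≤ ((∑ p ∈ primesIoc M P, ((Finset.Ioc 0 N).filter fun n => p ^ 2 ∣ n).card : ℕ) : ℝ) := by
        exact_mod_cast (Finset.card_le_card h1).trans Finset.card_biUnion_le
    _ ≤ ∑ p ∈ primesIoc M P, N * (1 / (p : ℝ) ^ 2) := by
        push_cast
        refine Finset.sum_le_sum fun p _ => ?_
        have := card_dvd_le N (p ^ 2)
        push_cast at this
        rwa [mul_one_div]
    _ ≤ N * (1 / M) := by
        rw [← Finset.mul_sum]
        refine mul_le_mul_of_nonneg_left (le_trans ?_ (sum_inv_sq_Ioc_le (P := P) hM))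
          (by positivity)
        exact Finset.sum_le_sum_of_subset_of_nonneg (Finset.filter_subset _ _)
          fun _ _ _ => by positivity
    _ = _ := by ring

lemma sum_abs_recipSum_sub_pairCount_le {N M P : ℕ} (hM : 0 < M) (hP : 2 * P ≤ N) :
    ∑ n ∈ Finset.Ioc 0 N, |recipSum M P - pairCount M P n| ≤
      N * (2 * √(2 * recipSum M P) + 1 + recipSum M P / M) := by
  classical
  set l := recipSum M P with hl
  have hl0 : 0 ≤ l := recipSum_nonneg M P
  have key : ∀ n, |l - pairCount M P n| ≤ 2 * |l - primeDivCount M P n| + 1 +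
      l * if (∃ p ∈ primesIoc M P, p ^ 2 ∣ n) then 1 else 0 := by
    intro n
    have h1 : (pairCount M P n : ℝ) ≤ primeDivCount M P n := by exact_mod_cast pairCount_le M P n
    have h0 : (0 : ℝ) ≤ pairCount M P n := by positivity
    have h2 : |l - pairCount M P n| ≤ |l - primeDivCount M P n| +
        (primeDivCount M P n - pairCount M P n) := by
      refine (abs_sub_le l (primeDivCount M P n) _).trans ?_
      rw [abs_of_nonneg (sub_nonneg.2 h1)]
    have h3 := abs_nonneg (l - primeDivCount M P n)
    split_ifs with hs
    · have := neg_abs_le (l - primeDivCount M P n)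
      linarith
    · rcases le_or_gt 2 (primeDivCount M P n) with h | h
      · rw [pairCount_eq h (by push Not at hs; exact hs)] at h2 ⊢
        linarith
      · have : (primeDivCount M P n : ℝ) ≤ 1 := by exact_mod_cast Nat.lt_succ_iff.1 h
        linarith
  refine (Finset.sum_le_sum fun n _ => key n).trans ?_
  rw [Finset.sum_add_distrib, Finset.sum_add_distrib, ← Finset.mul_sum, ← Finset.mul_sum]
  have h1 := sum_abs_recipSum_sub_primeDivCount_le (M := M) hP
  have h2 := mul_le_mul_of_nonneg_left (card_sq_dvd_le (N := N) (P := P) hM) hl0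
  simp only [Finset.sum_boole, Finset.sum_const, Nat.card_Ioc, Nat.sub_zero, nsmul_eq_mul, mul_one]
  calc _ ≤ 2 * (N * √(2 * l)) + N + l * (N / M) := by gcongr
    _ = _ := by ring

/-- Averages over `n ≤ N` can be replaced by averages over `primePairs`. -/
lemma norm_recipSum_smul_sum_sub_le {E : Type*} [NormedAddCommGroup E] [NormedSpace ℝ E]
    {N M P : ℕ} (hM : 0 < M) (hP : 2 * P ≤ N)
    {g : ℕ → E} (hg : ∀ n, ‖g n‖ ≤ 1) :
    ‖recipSum M P • ∑ n ∈ Finset.Ioc 0 N, g n - ∑ x ∈ primePairs N M P, g (x.1 * x.2)‖ ≤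
      N * (2 * √(2 * recipSum M P) + 1 + recipSum M P / M) := by
  rw [sum_primePairs, Finset.smul_sum, ← Finset.sum_sub_distrib]
  refine le_trans (norm_sum_le _ _) (le_trans (Finset.sum_le_sum fun n _ => ?_)
    (sum_abs_recipSum_sub_pairCount_le hM hP))
  rw [← sub_smul, norm_smul, Real.norm_eq_abs]
  exact mul_le_of_le_one_right (abs_nonneg _) (hg n)

lemma card_primePairs_le (N M P : ℕ) : ((primePairs N M P).card : ℝ) ≤ N * recipSum M P := by
  have h := sum_primePairs N M P (fun _ => (1 : ℝ))
  simp only [Finset.sum_const, nsmul_eq_mul, mul_one, smul_eq_mul] at h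
  rw [h]
  refine le_trans (Finset.sum_le_sum fun n _ => ?_) (sum_primeDivCount_le N M P)
  exact_mod_cast pairCount_le M P n

lemma card_primePairs_dvd_le {N M P : ℕ} (hM : 0 < M) :
    (((primePairs N M P).filter fun x => x.1 ∣ x.2).card : ℝ) ≤ N / M := by
  classical
  have h1 : ((primePairs N M P).filter fun x => x.1 ∣ x.2) ⊆
      (primesIoc M P).biUnion fun p =>
        ((Finset.Ioc 0 N).filter fun n => p ^ 2 ∣ n).image fun n => (p, n / p) := by
    rintro ⟨p, r⟩ hx
    simp only [Finset.mem_filter, Finset.mem_biUnion, Finset.mem_image] at hx ⊢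
    obtain ⟨hx, k, rfl⟩ := hx
    obtain ⟨h1, h2, h3, -⟩ := mem_primePairs.1 hx
    have hp := (mem_primesIoc.1 h1).2.pos
    refine ⟨p, h1, p * (p * k), ⟨Finset.mem_Ioc.2 ⟨Nat.mul_pos hp h2, h3⟩, ⟨k, by ring⟩⟩, ?_⟩
    rw [Nat.mul_div_cancel_left _ hp]
  calc _ ≤ ((∑ p ∈ primesIoc M P, ((Finset.Ioc 0 N).filter fun n => p ^ 2 ∣ n).card : ℕ) : ℝ) := by
        exact_mod_cast (Finset.card_le_card h1).trans (Finset.card_biUnion_le.trans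
          (Finset.sum_le_sum fun p _ => Finset.card_image_le))
    _ ≤ ∑ p ∈ primesIoc M P, N * (1 / (p : ℝ) ^ 2) := by
        push_cast
        refine Finset.sum_le_sum fun p _ => ?_
        have := card_dvd_le N (p ^ 2)
        push_cast at this
        rwa [mul_one_div]
    _ ≤ N * (1 / M) := by
        rw [← Finset.mul_sum]
        refine mul_le_mul_of_nonneg_left (le_trans ?_ (sum_inv_sq_Ioc_le (P := P) hM))
          (by positivity)
        exact Finset.sum_le_sum_of_subset_of_nonneg (Finset.filter_subset _ _)
          fun _ _ _ => by positivity
    _ = _ := by ring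

/-- The sum of the divisors of `n`. -/
def sumDiv (n : ℕ) : ℕ := ∑ d ∈ n.divisors, d

/-- The sum of the proper divisors of `n`. -/
def sumProper (n : ℕ) : ℕ := ∑ d ∈ n.properDivisors, d

lemma sumDiv_eq (n : ℕ) : sumDiv n = sumProper n + n :=
  Nat.sum_divisors_eq_sum_properDivisors_add_self

lemma sumDiv_eq_sigma (n : ℕ) : sumDiv n = ArithmeticFunction.sigma 1 n :=
  (ArithmeticFunction.sigma_one_apply n).symm

lemma sumDiv_mul {m n : ℕ} (h : m.Coprime n) : sumDiv (m * n) = sumDiv m * sumDiv n := by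
  simp only [sumDiv_eq_sigma]
  exact ArithmeticFunction.isMultiplicative_sigma.map_mul_of_coprime h

lemma sumDiv_prime {p : ℕ} (hp : p.Prime) : sumDiv p = p + 1 := by
  rw [sumDiv, hp.sum_divisors]

lemma sumDiv_prime_mul {p m : ℕ} (hp : p.Prime) (h : ¬ p ∣ m) :
    sumDiv (p * m) = (p + 1) * sumDiv m := by
  rw [sumDiv_mul ((Nat.Prime.coprime_iff_not_dvd hp).2 h), sumDiv_prime hp]

lemma sumProper_prime_mul {p m : ℕ} (hp : p.Prime) (h : ¬ p ∣ m) :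
    sumProper (p * m) = p * sumProper m + sumDiv m := by
  have h1 := sumDiv_eq (p * m)
  rw [sumDiv_prime_mul hp h] at h1
  have h2 := sumDiv_eq m
  nlinarith

/-- `d` is coprime to `r`, `σ(r)` and `s(r)`. -/
def IsGood (d r : ℕ) : Prop :=
  d.Coprime r ∧ d.Coprime (sumDiv r) ∧ d.Coprime (sumProper r)

lemma IsGood.of_dvd {d g r : ℕ} (h : IsGood d r) (hg : g ∣ d) : IsGood g r :=
  ⟨h.1.coprime_dvd_left hg, h.2.1.coprime_dvd_left hg, h.2.2.coprime_dvd_left hg⟩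

lemma abs_card_modEq_sub_le {d : ℕ} (hd : 0 < d) {a b : ℕ} (hab : a ≤ b) (v : ℕ) :
    |(((Finset.Ioc a b).filter fun n => n ≡ v [MOD d]).card : ℝ) - ((b : ℝ) - a) / d| ≤ 1 := by
  have h := Nat.Ioc_filter_modEq_card a b hd v
  have hd' : (0 : ℝ) < d := by exact_mod_cast hd
  have hdq : (0 : ℚ) < d := by exact_mod_cast hd
  have hm : ⌊((a : ℚ) - v) / d⌋ ≤ ⌊((b : ℚ) - v) / d⌋ := by
    apply Int.floor_le_floor
    have : (a : ℚ) ≤ b := by exact_mod_cast hab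
    gcongr
  rw [max_eq_left (by omega)] at h
  have h1 : (((Finset.Ioc a b).filter fun n => n ≡ v [MOD d]).card : ℚ) =
      ⌊((b : ℚ) - v) / d⌋ - ⌊((a : ℚ) - v) / d⌋ := by exact_mod_cast h
  have h2 : |(((Finset.Ioc a b).filter fun n => n ≡ v [MOD d]).card : ℚ) - ((b : ℚ) - a) / d|
      ≤ 1 := by
    rw [h1, abs_le]
    have e : ((b : ℚ) - a) / d = (b - v) / d - (a - v) / d := by ring
    have f1 := Int.floor_le (((b : ℚ) - v) / d)
    have f2 := Int.lt_floor_add_one (((b : ℚ) - v) / d)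
    have f3 := Int.floor_le (((a : ℚ) - v) / d)
    have f4 := Int.lt_floor_add_one (((a : ℚ) - v) / d)
    rw [e]
    constructor <;> linarith
  have h3 := (Rat.cast_le (K := ℝ)).2 h2
  simpa only [Rat.cast_abs, Rat.cast_sub, Rat.cast_div, Rat.cast_natCast, Rat.cast_one] using h3

lemma card_pairwise_modEq_le {d : ℕ} (hd : 0 < d) {a b : ℕ} (hab : a ≤ b) {S : Finset ℕ}
    (hS : S ⊆ Finset.Ioc a b) (h : ∀ m ∈ S, ∀ n ∈ S, m ≡ n [MOD d]) :
    (S.card : ℝ) ≤ ((b : ℝ) - a) / d + 1 := by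
  rcases S.eq_empty_or_nonempty with rfl | ⟨v, hv⟩
  · have : (a : ℝ) ≤ b := by exact_mod_cast hab
    have : 0 ≤ ((b : ℝ) - a) / d := div_nonneg (by linarith) (by positivity)
    simp only [Finset.card_empty, Nat.cast_zero]
    linarith
  · have h1 := (abs_le.1 (abs_card_modEq_sub_le hd hab v)).2
    have h2 : (S.card : ℝ) ≤ ((Finset.Ioc a b).filter fun n => n ≡ v [MOD d]).card := by
      exact_mod_cast Finset.card_le_card fun n hn =>
        Finset.mem_filter.2 ⟨hS hn, h n hn v hv⟩
    linarith

lemma exists_dvd_iff_modEq {d A : ℕ} (hd : 0 < d) (h : d.Coprime A) (B : ℕ) :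
    ∃ v, ∀ n, d ∣ n * A + B ↔ n ≡ v [MOD d] := by
  have : NeZero d := ⟨hd.ne'⟩
  let u : (ZMod d)ˣ := ZMod.unitOfCoprime A h.symm
  have hu : ((u : ZMod d)) = A := ZMod.coe_unitOfCoprime A h.symm
  refine ⟨(-(B : ZMod d) * (u⁻¹ : (ZMod d)ˣ)).val, fun n => ?_⟩
  rw [← ZMod.natCast_eq_natCast_iff, ZMod.natCast_zmod_val, ← ZMod.natCast_eq_zero_iff]
  push_cast
  rw [← hu, Units.eq_mul_inv_iff_mul_eq, eq_neg_iff_add_eq_zero]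

lemma sum_inv_Icc_le (P : ℕ) : ∑ n ∈ Finset.Icc 1 P, (1 : ℝ) / n ≤ 1 + Real.log P := by
  have := harmonic_le_one_add_log P
  rw [harmonic_eq_sum_Icc] at this
  push_cast at this
  simpa only [one_div] using this

/-- Integers `r = p * m ≤ R` where `p ∈ (M, P]` and `p` is determined modulo `g` by `m`. -/
lemma card_le_of_modEq_class {R M P g : ℕ} (hM : 0 < M) (hg : 0 < g) {S : Finset ℕ}
    (hS : S ⊆ Finset.Ioc 0 R) {Q : ℕ → ℕ → Prop}
    (h : ∀ r ∈ S, ∃ p ∈ Finset.Ioc M P, ∃ m, r = p * m ∧ Q p m)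
    (hQ : ∀ m p p', Q p m → Q p' m → p ≡ p' [MOD g]) :
    (S.card : ℝ) ≤ R * ((1 + Real.log P) / g + 1 / M) := by
  classical
  let f : ℕ → Finset ℕ := fun m => (Finset.Ioc 0 (min P (R / m))).filter fun p => Q p m
  have h1 : S ⊆ (Finset.Ioc 0 (R / M)).biUnion fun m => (f m).image fun p => p * m := by
    intro r hr
    obtain ⟨p, hp, m, rfl, hq⟩ := h r hr
    obtain ⟨hr0, hrR⟩ := Finset.mem_Ioc.1 (hS hr)
    obtain ⟨hp1, hp2⟩ := Finset.mem_Ioc.1 hp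
    have hm : 0 < m := Nat.pos_of_mul_pos_left hr0
    simp only [Finset.mem_biUnion, Finset.mem_image, Finset.mem_Ioc]
    refine ⟨m, ⟨hm, ?_⟩, p, Finset.mem_filter.2 ⟨Finset.mem_Ioc.2 ⟨by omega, le_min hp2 ?_⟩, hq⟩, rfl⟩
    · rw [Nat.le_div_iff_mul_le hM]
      nlinarith
    · rw [Nat.le_div_iff_mul_le hm]
      exact hrR
  have h2 : ∀ m, ((f m).card : ℝ) ≤ (min P (R / m) : ℕ) / g + 1 := by
    intro m
    have := card_pairwise_modEq_le (S := f m) hg (Nat.zero_le (min P (R / m)))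
      (Finset.filter_subset _ _) (fun a ha b hb => hQ m a b (Finset.mem_filter.1 ha).2
        (Finset.mem_filter.1 hb).2)
    simpa using this
  have h3 : ∑ m ∈ Finset.Ioc 0 (R / M), ((min P (R / m) : ℕ) : ℝ) ≤ R * (1 + Real.log P) := by
    have e : ∀ m ∈ Finset.Ioc 0 (R / M), ((min P (R / m) : ℕ) : ℝ) =
        ∑ n ∈ Finset.Icc 1 P, if n * m ≤ R then (1 : ℝ) else 0 := by
      intro m hm
      have hm0 := (Finset.mem_Ioc.1 hm).1
      rw [Finset.sum_boole]
      have : ((Finset.Icc 1 P).filter fun n => n * m ≤ R) = Finset.Ioc 0 (min P (R / m)) := by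
        ext n
        simp only [Finset.mem_filter, Finset.mem_Icc, Finset.mem_Ioc, le_min_iff,
          Nat.le_div_iff_mul_le hm0]
        constructor
        · rintro ⟨⟨a, b⟩, c⟩
          exact ⟨a, b, c⟩
        · rintro ⟨a, b, c⟩
          exact ⟨⟨a, b⟩, c⟩
      rw [this]
      simp
    rw [Finset.sum_congr rfl e, Finset.sum_comm]
    calc _ ≤ ∑ n ∈ Finset.Icc 1 P, (R : ℝ) * (1 / n) := by
          refine Finset.sum_le_sum fun n hn => ?_
          have hn0 : 0 < n := (Finset.mem_Icc.1 hn).1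
          rw [Finset.sum_boole, mul_one_div]
          refine le_trans ?_ (Nat.cast_div_le (m := R) (n := n))
          have : ((Finset.Ioc 0 (R / M)).filter fun m => n * m ≤ R) ⊆ Finset.Ioc 0 (R / n) := by
            intro m hm
            simp only [Finset.mem_filter, Finset.mem_Ioc] at hm ⊢
            refine ⟨hm.1.1, (Nat.le_div_iff_mul_le hn0).2 ?_⟩
            rw [mul_comm]
            exact hm.2
          have := Finset.card_le_card this
          simp only [Nat.card_Ioc, Nat.sub_zero] at this
          exact_mod_cast this
      _ ≤ _ := by
          rw [← Finset.mul_sum]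
          exact mul_le_mul_of_nonneg_left (sum_inv_Icc_le P) (by positivity)
  calc (S.card : ℝ) ≤ ∑ m ∈ Finset.Ioc 0 (R / M), ((f m).card : ℝ) := by
        exact_mod_cast (Finset.card_le_card h1).trans (Finset.card_biUnion_le.trans
          (Finset.sum_le_sum fun p _ => Finset.card_image_le))
    _ ≤ ∑ m ∈ Finset.Ioc 0 (R / M), (((min P (R / m) : ℕ) : ℝ) / g + 1) :=
        Finset.sum_le_sum fun m _ => h2 m
    _ = (∑ m ∈ Finset.Ioc 0 (R / M), ((min P (R / m) : ℕ) : ℝ)) / g + (R / M : ℕ) := by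
        rw [Finset.sum_add_distrib, Finset.sum_div]
        simp
    _ ≤ R * (1 + Real.log P) / g + R / M := by
        gcongr
        exact Nat.cast_div_le
    _ = _ := by ring

/-- Two linear conditions `d ∣ n s(r) + σ(r)` and `d' ∣ n s(r') + σ(r')` can only be compatible
if `s(r) σ(r') ≡ s(r') σ(r)` modulo `gcd(d, d')`. This bounds how often it happens. -/
lemma card_collision_le {R M P g r' : ℕ} (hM : 0 < M) (hg : 0 < g) (hr' : IsGood g r')
    {S : Finset ℕ} (hS : S ⊆ Finset.Ioc 0 R)
    (h : ∀ r ∈ S, HasExactPrimeFactor M P r ∧ IsGood g r ∧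
      sumProper r * sumDiv r' ≡ sumProper r' * sumDiv r [MOD g]) :
    (S.card : ℝ) ≤ R * ((1 + Real.log P) / g + 1 / M) := by
  refine card_le_of_modEq_class hM hg hS (Q := fun p m => g.Coprime (sumDiv m) ∧
    (p * sumProper m + sumDiv m) * sumDiv r' ≡ sumProper r' * ((p + 1) * sumDiv m) [MOD g]) ?_ ?_
  · intro r hr
    obtain ⟨⟨p, hp, m, rfl, hpm⟩, hgood, hcol⟩ := h r hr
    rw [mem_primesIoc] at hp
    refine ⟨p, Finset.mem_Ioc.2 hp.1, m, rfl, ?_, ?_⟩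
    · have := hgood.2.1
      rw [sumDiv_prime_mul hp.2 hpm] at this
      exact this.coprime_dvd_right (dvd_mul_left _ _)
    · rwa [sumDiv_prime_mul hp.2 hpm, sumProper_prime_mul hp.2 hpm] at hcol
  · rintro m p p' ⟨hm, hp⟩ ⟨-, hp'⟩
    rw [← ZMod.natCast_eq_natCast_iff] at hp hp' ⊢
    have hs := sumDiv_eq r'
    rw [hs] at hp hp'
    push_cast at hp hp'
    have hu : IsUnit ((sumDiv m : ZMod g) * r') :=
      ((ZMod.isUnit_iff_coprime _ _).2 hm.symm).mul ((ZMod.isUnit_iff_coprime _ _).2 hr'.1.symm)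
    set c : ZMod g := sumProper r' * sumDiv m - sumProper m * (sumProper r' + r') with hc
    have e1 : (p : ZMod g) * c = sumDiv m * r' := by rw [hc]; linear_combination -hp
    have e2 : (p' : ZMod g) * c = sumDiv m * r' := by rw [hc]; linear_combination -hp'
    have hcu : IsUnit c := isUnit_of_mul_isUnit_right (e1 ▸ hu)
    exact hcu.mul_right_cancel (e1.trans e2.symm)

/-- The indicator of `d ∣ n s(r) + σ(r)`. -/
noncomputable def hitInd (d r n : ℕ) : ℝ := if d ∣ n * sumProper r + sumDiv r then 1 else 0

/-- The condition under which `d ∣ n s(r) + σ(r)` and `d' ∣ n s(r') + σ(r')` can be compatible. -/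
def Collide (d d' r r' : ℕ) : Prop :=
  sumProper r * sumDiv r' ≡ sumProper r' * sumDiv r [MOD d.gcd d']

instance (d d' r r' : ℕ) : Decidable (Collide d d' r r') :=
  inferInstanceAs (Decidable (_ ≡ _ [MOD _]))

lemma abs_sum_hitInd_sub_le {d r : ℕ} (hd : 0 < d) (hr : IsGood d r) {a b : ℕ} (hab : a ≤ b) :
    |∑ n ∈ Finset.Ioc a b, hitInd d r n - ((b : ℝ) - a) / d| ≤ 1 := by
  obtain ⟨v, hv⟩ := exists_dvd_iff_modEq hd hr.2.2 (sumDiv r)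
  simp only [hitInd, hv, Finset.sum_boole]
  exact abs_card_modEq_sub_le hd hab v

lemma collide_of_dvd {d d' r r' n : ℕ} (h : d ∣ n * sumProper r + sumDiv r)
    (h' : d' ∣ n * sumProper r' + sumDiv r') : Collide d d' r r' := by
  have h1 := (Nat.gcd_dvd_left d d').trans h
  have h2 := (Nat.gcd_dvd_right d d').trans h'
  rw [Collide, ← ZMod.natCast_eq_natCast_iff]
  rw [← ZMod.natCast_eq_zero_iff] at h1 h2
  push_cast at h1 h2 ⊢
  linear_combination (sumProper r : ZMod (d.gcd d')) * h2 - (sumProper r' : ZMod (d.gcd d')) * h1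

lemma abs_sum_hitInd_mul_sub_le {d d' r r' : ℕ} (hd : 0 < d) (hd' : 0 < d') (hg : d.Coprime d')
    (hr : IsGood d r) (hr' : IsGood d' r') {a b : ℕ} (hab : a ≤ b) :
    |∑ n ∈ Finset.Ioc a b, hitInd d r n * hitInd d' r' n - ((b : ℝ) - a) / (d * d')| ≤ 1 := by
  obtain ⟨v, hv⟩ := exists_dvd_iff_modEq hd hr.2.2 (sumDiv r)
  obtain ⟨v', hv'⟩ := exists_dvd_iff_modEq hd' hr'.2.2 (sumDiv r')
  obtain ⟨w, hw, hw'⟩ := Nat.chineseRemainder hg v v'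
  have key : ∀ n, hitInd d r n * hitInd d' r' n = if n ≡ w [MOD d * d'] then 1 else 0 := by
    intro n
    have : n ≡ w [MOD d * d'] ↔ n ≡ v [MOD d] ∧ n ≡ v' [MOD d'] := by
      rw [← Nat.modEq_and_modEq_iff_modEq_mul hg]
      exact ⟨fun h => ⟨h.1.trans hw, h.2.trans hw'⟩, fun h => ⟨h.1.trans hw.symm, h.2.trans hw'.symm⟩⟩
    simp only [hitInd, hv, hv', this]
    split_ifs <;> simp_all
  simp only [key, Finset.sum_boole]
  have := abs_card_modEq_sub_le (Nat.mul_pos hd hd') hab w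
  push_cast at this
  exact this

lemma sum_hitInd_mul_le {d d' r r' : ℕ} (hd : 0 < d) (hd' : 0 < d')
    (hr : IsGood d r) (hr' : IsGood d' r') {a b : ℕ} (hab : a ≤ b) :
    ∑ n ∈ Finset.Ioc a b, hitInd d r n * hitInd d' r' n ≤
      (((b : ℝ) - a) / (d * d') * d.gcd d') * (if Collide d d' r r' then 1 else 0) + 1 := by
  obtain ⟨v, hv⟩ := exists_dvd_iff_modEq hd hr.2.2 (sumDiv r)
  obtain ⟨v', hv'⟩ := exists_dvd_iff_modEq hd' hr'.2.2 (sumDiv r')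
  have key : ∀ n, hitInd d r n * hitInd d' r' n =
      if d ∣ n * sumProper r + sumDiv r ∧ d' ∣ n * sumProper r' + sumDiv r' then 1 else 0 := by
    intro n
    simp only [hitInd]
    split_ifs <;> simp_all
  simp only [key, Finset.sum_boole]
  split_ifs with hc
  · have h1 := card_pairwise_modEq_le (d := d.lcm d') (Nat.lcm_pos hd hd') hab
      (Finset.filter_subset (fun n => d ∣ n * sumProper r + sumDiv r ∧
        d' ∣ n * sumProper r' + sumDiv r') _) (fun m hm n hn => by
        simp only [Finset.mem_filter, hv, hv'] at hm hn
        exact Nat.mod_lcm (hm.2.1.trans hn.2.1.symm) (hm.2.2.trans hn.2.2.symm))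
    refine h1.trans (le_of_eq ?_)
    have h2 : (d.gcd d' : ℝ) * d.lcm d' = d * d' := by exact_mod_cast Nat.gcd_mul_lcm d d'
    have h3 : (0 : ℝ) < d.gcd d' := by exact_mod_cast Nat.gcd_pos_of_pos_left _ hd
    have h4 : (0 : ℝ) < d.lcm d' := by exact_mod_cast Nat.lcm_pos hd hd'
    rw [← h2]
    field_simp
  · rw [Finset.filter_false_of_mem fun n _ h => hc (collide_of_dvd h.1 h.2)]
    simp

lemma abs_sum_corr_le {d d' r r' : ℕ} (hd : 0 < d) (hd' : 0 < d')
    (hr : IsGood d r) (hr' : IsGood d' r') {a b t : ℕ} (hbt : b ≤ a + t) :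
    |∑ n ∈ Finset.Ioc a b, (hitInd d r n - 1 / d) * (hitInd d' r' n - 1 / d')| ≤
      3 + if d.gcd d' = 1 then 0 else
        t / ((d : ℝ) * d') * (1 + d.gcd d' * if Collide d d' r r' then 1 else 0) := by
  have hdr : (1 : ℝ) ≤ d := by exact_mod_cast hd
  have hdr' : (1 : ℝ) ≤ d' := by exact_mod_cast hd'
  have hc0 : (0 : ℝ) ≤ if Collide d d' r r' then 1 else 0 := by split_ifs <;> norm_num
  rcases lt_or_ge b a with hab | hab
  · rw [Finset.Ioc_eq_empty (by omega)]
    simp only [Finset.sum_empty, abs_zero]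
    positivity
  have hL0 : (0 : ℝ) ≤ (b : ℝ) - a := by
    have : (a : ℝ) ≤ b := by exact_mod_cast hab
    linarith
  have hLt : (b : ℝ) - a ≤ t := by
    have : (b : ℝ) ≤ a + t := by exact_mod_cast hbt
    linarith
  have hi : 1 / (d : ℝ) ≤ 1 := by rw [div_le_one (by positivity)]; exact hdr
  have hi' : 1 / (d' : ℝ) ≤ 1 := by rw [div_le_one (by positivity)]; exact hdr'
  have hi0 : 0 ≤ 1 / (d : ℝ) := by positivity
  have hi0' : 0 ≤ 1 / (d' : ℝ) := by positivity
  have hX := abs_le.1 (abs_sum_hitInd_sub_le hd hr hab)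
  have hX' := abs_le.1 (abs_sum_hitInd_sub_le hd' hr' hab)
  set X := ∑ n ∈ Finset.Ioc a b, hitInd d r n
  set X' := ∑ n ∈ Finset.Ioc a b, hitInd d' r' n
  have hE : ∑ n ∈ Finset.Ioc a b, (hitInd d r n - 1 / d) * (hitInd d' r' n - 1 / d') =
      ∑ n ∈ Finset.Ioc a b, hitInd d r n * hitInd d' r' n - (X - (b - a) / d) * (1 / d') -
        (X' - (b - a) / d') * (1 / d) - (b - a) / (d * d') := by
    have hcard : ((Finset.Ioc a b).card : ℝ) = b - a := by
      rw [Nat.card_Ioc, Nat.cast_sub hab]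
    have hp : ∀ n, (hitInd d r n - 1 / d) * (hitInd d' r' n - 1 / d') =
        hitInd d r n * hitInd d' r' n - hitInd d r n * (1 / d') - hitInd d' r' n * (1 / d) +
          1 / d * (1 / d') := fun n => by ring
    simp only [hp, Finset.sum_add_distrib, Finset.sum_sub_distrib, ← Finset.sum_mul,
      Finset.sum_const, nsmul_eq_mul, hcard]
    change _ - X * _ - X' * _ + _ = _
    ring
  rw [hE]
  have b1 : |(X - (b - a) / d) * (1 / d')| ≤ 1 := by
    rw [abs_mul, abs_of_nonneg hi0']
    exact mul_le_one₀ (abs_le.2 hX) hi0' hi'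
  have b2 : |(X' - (b - a) / d') * (1 / d)| ≤ 1 := by
    rw [abs_mul, abs_of_nonneg hi0]
    exact mul_le_one₀ (abs_le.2 hX') hi0 hi
  rw [abs_le] at b1 b2
  by_cases hg : d.gcd d' = 1
  · rw [if_pos hg]
    have b3 := abs_le.1 (abs_sum_hitInd_mul_sub_le hd hd' hg hr hr' hab)
    rw [abs_le]
    constructor <;> linarith
  · rw [if_neg hg]
    have b3 := sum_hitInd_mul_le hd hd' hr hr' hab
    have b4 : 0 ≤ ∑ n ∈ Finset.Ioc a b, hitInd d r n * hitInd d' r' n :=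
      Finset.sum_nonneg fun n _ => by unfold hitInd; split_ifs <;> norm_num
    set c : ℝ := if Collide d d' r r' then 1 else 0
    have b5 : ((b : ℝ) - a) / (d * d') ≤ t / (d * d') := by gcongr
    have b6 : 0 ≤ ((b : ℝ) - a) / (d * d') := by positivity
    have b7 : ((b : ℝ) - a) / (d * d') * d.gcd d' * c ≤ t / (d * d') * d.gcd d' * c := by gcongr
    have b8 : 0 ≤ (t : ℝ) / (d * d') * d.gcd d' * c := by positivity
    have e : (t : ℝ) / (d * d') * (1 + d.gcd d' * c) =
      t / (d * d') + t / (d * d') * d.gcd d' * c := by ring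
    rw [e, abs_le]
    constructor <;> linarith

/-- Integers in `[1, D]` all of whose prime factors exceed `z`. -/
def roughSet (z D : ℕ) : Finset ℕ :=
  (Finset.Ioc 0 D).filter fun d => ∀ q ∈ d.primeFactors, z < q

lemma mem_roughSet {z D d : ℕ} :
    d ∈ roughSet z D ↔ (0 < d ∧ d ≤ D) ∧ ∀ q ∈ d.primeFactors, z < q := by
  simp [roughSet]

lemma lt_gcd_of_mem_roughSet {z D d d' : ℕ} (hd : d ∈ roughSet z D) (hg : d.gcd d' ≠ 1) :
    z < d.gcd d' ∧ d.gcd d' ≤ D := by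
  rw [mem_roughSet] at hd
  have hpos := Nat.gcd_pos_of_pos_left d' hd.1.1
  refine ⟨?_, (Nat.gcd_le_left _ hd.1.1).trans hd.1.2⟩
  obtain ⟨q, hq, hqd⟩ := Nat.exists_prime_and_dvd hg
  exact (hd.2 q (Nat.mem_primeFactors.2 ⟨hq, hqd.trans (Nat.gcd_dvd_left _ _), hd.1.1.ne'⟩)).trans_le
    (Nat.le_of_dvd hpos hqd)

lemma sum_inv_multiples_le {D k : ℕ} (hk : 0 < k) :
    ∑ d ∈ Finset.Ioc 0 D, (if k ∣ d then (1 : ℝ) / d else 0) ≤ (1 + Real.log D) / k := by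
  rw [← Finset.sum_filter]
  have h1 : ((Finset.Ioc 0 D).filter fun d => k ∣ d) ⊆ (Finset.Icc 1 D).image fun e => k * e := by
    intro d hd
    simp only [Finset.mem_filter, Finset.mem_Ioc, Finset.mem_image, Finset.mem_Icc] at hd ⊢
    obtain ⟨⟨h0, h1⟩, e, rfl⟩ := hd
    exact ⟨e, ⟨Nat.pos_of_mul_pos_left h0, (Nat.le_mul_of_pos_left _ hk).trans h1⟩, rfl⟩
  calc _ ≤ ∑ d ∈ (Finset.Icc 1 D).image fun e => k * e, (1 : ℝ) / d :=
        Finset.sum_le_sum_of_subset_of_nonneg h1 fun _ _ _ => by positivity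
    _ = ∑ e ∈ Finset.Icc 1 D, (1 : ℝ) / e / k := by
        rw [Finset.sum_image fun a _ b _ h => Nat.eq_of_mul_eq_mul_left hk h]
        refine Finset.sum_congr rfl fun e _ => ?_
        push_cast
        rw [div_div, mul_comm]
    _ ≤ _ := by
        rw [← Finset.sum_div]
        have := sum_inv_Icc_le D
        gcongr

lemma sum_gcd_weight_le {z D : ℕ} {w : ℕ → ℝ} (hw : ∀ k, 0 ≤ w k) :
    ∑ d ∈ roughSet z D, ∑ d' ∈ roughSet z D,
      (if d.gcd d' = 1 then 0 else w (d.gcd d') / ((d : ℝ) * d')) ≤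
      ∑ k ∈ Finset.Ioc z D, w k * ((1 + Real.log D) / k) ^ 2 := by
  have h1 : ∀ d ∈ roughSet z D, ∀ d' ∈ roughSet z D,
      (if d.gcd d' = 1 then 0 else w (d.gcd d') / ((d : ℝ) * d')) ≤
      ∑ k ∈ Finset.Ioc z D, w k * ((if k ∣ d then (1 : ℝ) / d else 0) *
        (if k ∣ d' then (1 : ℝ) / d' else 0)) := by
    intro d hd d' hd'
    have h0 : ∀ k ∈ Finset.Ioc z D, 0 ≤ w k * ((if k ∣ d then (1 : ℝ) / d else 0) *
        (if k ∣ d' then (1 : ℝ) / d' else 0)) := fun k _ => by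
      refine mul_nonneg (hw k) (mul_nonneg ?_ ?_) <;> split_ifs <;> positivity
    split_ifs with hg
    · exact Finset.sum_nonneg h0
    · refine le_trans (le_of_eq ?_)
        (Finset.single_le_sum h0 (Finset.mem_Ioc.2 (lt_gcd_of_mem_roughSet hd hg)))
      rw [if_pos (Nat.gcd_dvd_left _ _), if_pos (Nat.gcd_dvd_right _ _)]
      ring
  calc _ ≤ ∑ d ∈ roughSet z D, ∑ d' ∈ roughSet z D, ∑ k ∈ Finset.Ioc z D,
        w k * ((if k ∣ d then (1 : ℝ) / d else 0) * (if k ∣ d' then (1 : ℝ) / d' else 0)) :=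
        Finset.sum_le_sum fun d hd => Finset.sum_le_sum fun d' hd' => h1 d hd d' hd'
    _ = ∑ k ∈ Finset.Ioc z D, w k * (∑ d ∈ roughSet z D, if k ∣ d then (1 : ℝ) / d else 0) ^ 2 := by
        rw [Finset.sum_congr rfl fun d _ => Finset.sum_comm, Finset.sum_comm]
        refine Finset.sum_congr rfl fun k _ => ?_
        rw [pow_two, Finset.sum_mul_sum, Finset.mul_sum]
        exact Finset.sum_congr rfl fun d _ => (Finset.mul_sum _ _ _).symm
    _ ≤ _ := by
        refine Finset.sum_le_sum fun k hk => mul_le_mul_of_nonneg_left ?_ (hw k)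
        have hk0 : 0 < k := by
          have := (Finset.mem_Ioc.1 hk).1
          omega
        refine pow_le_pow_left₀ (Finset.sum_nonneg fun d _ => by split_ifs <;> positivity) ?_ 2
        refine le_trans ?_ (sum_inv_multiples_le hk0)
        exact Finset.sum_le_sum_of_subset_of_nonneg (Finset.filter_subset _ _)
          fun d _ _ => by split_ifs <;> positivity

lemma sum_gcd_inv_le {z D : ℕ} (hz : 0 < z) :
    ∑ d ∈ roughSet z D, ∑ d' ∈ roughSet z D,
      (if d.gcd d' = 1 then 0 else 1 / ((d : ℝ) * d')) ≤ (1 + Real.log D) ^ 2 / z := by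
  refine (sum_gcd_weight_le (w := fun _ => 1) fun _ => zero_le_one).trans ?_
  calc _ = (1 + Real.log D) ^ 2 * ∑ k ∈ Finset.Ioc z D, 1 / (k : ℝ) ^ 2 := by
        rw [Finset.mul_sum]
        exact Finset.sum_congr rfl fun k _ => by ring
    _ ≤ (1 + Real.log D) ^ 2 * (1 / z) :=
        mul_le_mul_of_nonneg_left (sum_inv_sq_Ioc_le hz) (by positivity)
    _ = _ := by ring

lemma sum_gcd_div_le {z D : ℕ} :
    ∑ d ∈ roughSet z D, ∑ d' ∈ roughSet z D,
      (if d.gcd d' = 1 then 0 else (d.gcd d' : ℝ) / ((d : ℝ) * d')) ≤ (1 + Real.log D) ^ 3 := by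
  refine (sum_gcd_weight_le (w := fun k => (k : ℝ)) fun _ => Nat.cast_nonneg _).trans ?_
  calc _ = (1 + Real.log D) ^ 2 * ∑ k ∈ Finset.Ioc z D, 1 / (k : ℝ) := by
        rw [Finset.mul_sum]
        refine Finset.sum_congr rfl fun k hk => ?_
        have hk0 : (k : ℝ) ≠ 0 := by
          have := (Finset.mem_Ioc.1 hk).1
          exact_mod_cast (by omega : k ≠ 0)
        field_simp
    _ ≤ (1 + Real.log D) ^ 2 * (1 + Real.log D) := by
        refine mul_le_mul_of_nonneg_left (le_trans ?_ (sum_inv_Icc_le D)) (by positivity)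
        refine Finset.sum_le_sum_of_subset_of_nonneg (fun k hk => ?_) fun _ _ _ => by positivity
        simp only [Finset.mem_Ioc, Finset.mem_Icc] at hk ⊢
        omega
    _ = _ := by ring

open Classical in
/-- Integers `r ≤ R` having an exact prime factor in `(M, P]`. -/
noncomputable def exactSet (M P R : ℕ) : Finset ℕ :=
  (Finset.Ioc 0 R).filter (HasExactPrimeFactor M P)

lemma mem_exactSet {M P R r : ℕ} :
    r ∈ exactSet M P R ↔ (0 < r ∧ r ≤ R) ∧ HasExactPrimeFactor M P r := by
  simp [exactSet]

lemma card_exactSet_le (M P R : ℕ) : (exactSet M P R).card ≤ R := by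
  classical
  exact (Finset.card_filter_le _ _).trans (by simp)

open Classical in
/-- The deviation `1[d ∣ n s(r) + σ(r)] - 1/d`, restricted to `r` that are good for `d`. -/
noncomputable def devTerm (d r n : ℕ) : ℝ := if IsGood d r then hitInd d r n - 1 / d else 0

open Classical in
lemma abs_sum_devTerm_mul_le {d d' r r' a b t : ℕ} (hd : 0 < d) (hd' : 0 < d') (hbt : b ≤ a + t) :
    |∑ n ∈ Finset.Ioc a b, devTerm d r n * devTerm d' r' n| ≤
      3 + (if d.gcd d' = 1 then 0 else t / ((d : ℝ) * d')) +
        (if d.gcd d' = 1 then 0 else t * ((d.gcd d' : ℝ) / ((d : ℝ) * d'))) *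
          (if IsGood d r ∧ IsGood d' r' ∧ Collide d d' r r' then 1 else 0) := by
  have h0 : (0 : ℝ) ≤ (if d.gcd d' = 1 then 0 else t / ((d : ℝ) * d')) := by
    split_ifs <;> positivity
  have h0' : (0 : ℝ) ≤ (if d.gcd d' = 1 then 0 else t * ((d.gcd d' : ℝ) / ((d : ℝ) * d'))) := by
    split_ifs <;> positivity
  have h0'' : (0 : ℝ) ≤ (if IsGood d r ∧ IsGood d' r' ∧ Collide d d' r r' then 1 else 0) := by
    split_ifs <;> positivity
  by_cases hr : IsGood d r
  · by_cases hr' : IsGood d' r'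
    · simp only [devTerm, hr, hr', if_true, true_and]
      refine (abs_sum_corr_le hd hd' hr hr' hbt).trans (le_of_eq ?_)
      by_cases hg : d.gcd d' = 1
      · simp [hg]
      · simp only [hg, if_false]
        ring
    · simp only [devTerm, hr', if_false, mul_zero, Finset.sum_const_zero, abs_zero]
      positivity
  · simp only [devTerm, hr, if_false, zero_mul, Finset.sum_const_zero, abs_zero]
    positivity

open Classical in
lemma sum_collide_le {R M P d d' : ℕ} (hM : 0 < M) (hd : 0 < d) :
    ∑ r ∈ exactSet M P R, ∑ r' ∈ exactSet M P R,
      (if IsGood d r ∧ IsGood d' r' ∧ Collide d d' r r' then (1 : ℝ) else 0) ≤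
      R * (R * ((1 + Real.log P) / d.gcd d' + 1 / M)) := by
  rw [Finset.sum_comm]
  have h1 : ∀ r' ∈ exactSet M P R, ∑ r ∈ exactSet M P R,
      (if IsGood d r ∧ IsGood d' r' ∧ Collide d d' r r' then (1 : ℝ) else 0) ≤
      R * ((1 + Real.log P) / d.gcd d' + 1 / M) := by
    intro r' _
    by_cases hr' : IsGood d' r'
    · rw [Finset.sum_boole]
      refine card_collision_le hM (Nat.gcd_pos_of_pos_left d' hd)
        (hr'.of_dvd (Nat.gcd_dvd_right d d')) (fun r hr => ?_) (fun r hr => ?_)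
      · exact Finset.mem_Ioc.2 (mem_exactSet.1 (Finset.mem_filter.1 hr).1).1
      · rw [Finset.mem_filter] at hr
        exact ⟨(mem_exactSet.1 hr.1).2, hr.2.1.of_dvd (Nat.gcd_dvd_left d d'), hr.2.2.2⟩
    · simp only [hr', false_and, and_false, if_false, Finset.sum_const_zero]
      have : 0 ≤ Real.log P := Real.log_natCast_nonneg P
      positivity
  refine (Finset.sum_le_card_nsmul _ _ _ h1).trans ?_
  rw [nsmul_eq_mul]
  have : 0 ≤ Real.log P := Real.log_natCast_nonneg P
  have h2 : ((exactSet M P R).card : ℝ) ≤ R := by exact_mod_cast card_exactSet_le M P R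
  gcongr

/-- The second moment estimate behind the dispersion bound. -/
lemma sum_sq_devTerm_le {N M P D z t : ℕ} (hM : 0 < M) (hz : 0 < z) (hDP : D ≤ P) (ht : 0 < t)
    {ε : ℕ → ℝ} (hε : ∀ d, |ε d| ≤ 1) :
    ∑ n ∈ Finset.Ioc t (t + t), (∑ d ∈ roughSet z D, ∑ r ∈ exactSet M P (N / t),
      if n * r ≤ N then ε d * devTerm d r n else 0) ^ 2 ≤
    ((N / t : ℕ) : ℝ) ^ 2 * (3 * D ^ 2 + t * ((1 + (1 + Real.log P)) * ((1 + Real.log P) ^ 2 / z) +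
      (1 + Real.log P) ^ 3 / M)) := by
  classical
  set R := N / t
  set l := 1 + Real.log P with hl
  have hl1 : 1 ≤ l := by
    have : 0 ≤ Real.log P := Real.log_natCast_nonneg P
    linarith
  have hlD : 1 + Real.log D ≤ l := by
    rcases D.eq_zero_or_pos with rfl | h
    · simpa using hl1
    · have : (D : ℝ) ≤ P := by exact_mod_cast hDP
      have := Real.log_le_log (by exact_mod_cast h) this
      linarith
  have hlD0 : 0 ≤ 1 + Real.log D := by
    have : 0 ≤ Real.log D := Real.log_natCast_nonneg D
    linarith
  let A : ℕ → ℕ → ℝ := fun d d' => if d.gcd d' = 1 then 0 else 1 / ((d : ℝ) * d')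
  let B : ℕ → ℕ → ℝ := fun d d' => if d.gcd d' = 1 then 0 else (d.gcd d' : ℝ) / ((d : ℝ) * d')
  let W : ℕ → ℕ → ℕ → ℕ → ℝ := fun d d' r r' => 3 + t * A d d' + t * B d d' *
    (if IsGood d r ∧ IsGood d' r' ∧ Collide d d' r r' then 1 else 0)
  have hB0 : ∀ d d', 0 ≤ B d d' := fun d d' => by
    simp only [B]
    split_ifs <;> positivity
  have hA0 : ∀ d d', 0 ≤ A d d' := fun d d' => by
    simp only [A]
    split_ifs <;> positivity
  have hW : ∀ d ∈ roughSet z D, ∀ d' ∈ roughSet z D, ∀ r ∈ exactSet M P R,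
      ∀ r' ∈ exactSet M P R,
      ∑ n ∈ Finset.Ioc t (t + t), (if n * r ≤ N then ε d * devTerm d r n else 0) *
        (if n * r' ≤ N then ε d' * devTerm d' r' n else 0) ≤ W d d' r r' := by
    intro d hd d' hd' r hr r' hr'
    have hd0 := (mem_roughSet.1 hd).1.1
    have hd0' := (mem_roughSet.1 hd').1.1
    have hr0 := (mem_exactSet.1 hr).1.1
    have hr0' := (mem_exactSet.1 hr').1.1
    have e1 : ∑ n ∈ Finset.Ioc t (t + t), (if n * r ≤ N then ε d * devTerm d r n else 0) *
        (if n * r' ≤ N then ε d' * devTerm d' r' n else 0) =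
        ε d * ε d' * ∑ n ∈ Finset.Ioc t (min (t + t) (min (N / r) (N / r'))),
          devTerm d r n * devTerm d' r' n := by
      have : Finset.Ioc t (min (t + t) (min (N / r) (N / r'))) =
          (Finset.Ioc t (t + t)).filter fun n => n * r ≤ N ∧ n * r' ≤ N := by
        ext n
        simp only [Finset.mem_filter, Finset.mem_Ioc, le_min_iff, Nat.le_div_iff_mul_le hr0,
          Nat.le_div_iff_mul_le hr0']
        tauto
      rw [this, Finset.sum_filter, Finset.mul_sum]
      refine Finset.sum_congr rfl fun n _ => ?_
      by_cases h1 : n * r ≤ N <;> by_cases h2 : n * r' ≤ N <;> simp [h1, h2]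
      ring
    rw [e1]
    refine (le_abs_self _).trans ?_
    rw [abs_mul, abs_mul]
    refine (mul_le_of_le_one_left (abs_nonneg _)
      (mul_le_one₀ (hε d) (abs_nonneg _) (hε d'))).trans ?_
    refine (abs_sum_devTerm_mul_le (t := t) hd0 hd0' (min_le_left _ _)).trans (le_of_eq ?_)
    simp only [W, A, B]
    split_ifs <;> ring
  have hcard : ((exactSet M P R).card : ℝ) ≤ R := by exact_mod_cast card_exactSet_le M P R
  have hcard2 : ((exactSet M P R).card : ℝ) * (exactSet M P R).card ≤ (R : ℝ) ^ 2 := by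
    rw [pow_two]
    gcongr
  have hWsum : ∀ d ∈ roughSet z D, ∀ d' ∈ roughSet z D,
      ∑ r ∈ exactSet M P R, ∑ r' ∈ exactSet M P R, W d d' r r' ≤
        (R : ℝ) ^ 2 * (3 + t * ((1 + l) * A d d' + B d d' / M)) := by
    intro d hd d' hd'
    have hd0 := (mem_roughSet.1 hd).1.1
    have hBA : B d d' * (l / d.gcd d' + 1 / M) = l * A d d' + B d d' / M := by
      simp only [A, B]
      split_ifs with hg
      · simp
      · have : (d.gcd d' : ℝ) ≠ 0 := by
          exact_mod_cast (Nat.gcd_pos_of_pos_left d' hd0).ne'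
        field_simp
    calc _ = (exactSet M P R).card * (exactSet M P R).card * (3 + t * A d d') +
          t * B d d' * ∑ r ∈ exactSet M P R, ∑ r' ∈ exactSet M P R,
            (if IsGood d r ∧ IsGood d' r' ∧ Collide d d' r r' then (1 : ℝ) else 0) := by
          simp only [W, Finset.sum_add_distrib, ← Finset.mul_sum, Finset.sum_const, nsmul_eq_mul]
          ring
      _ ≤ (R : ℝ) ^ 2 * (3 + t * A d d') + t * B d d' * (R * (R * (l / d.gcd d' + 1 / M))) := by
          have h1 := sum_collide_le (R := R) (P := P) (d' := d') hM hd0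
          have h2 := hA0 d d'
          have h3 := hB0 d d'
          gcongr
      _ = (R : ℝ) ^ 2 * (3 + t * A d d') + R ^ 2 * t * (B d d' * (l / d.gcd d' + 1 / M)) := by ring
      _ = _ := by
          rw [hBA]
          ring
  have hcardD : ((roughSet z D).card : ℝ) ≤ D := by
    have : (roughSet z D).card ≤ D := (Finset.card_filter_le _ _).trans (by simp)
    exact_mod_cast this
  calc _ = ∑ d ∈ roughSet z D, ∑ d' ∈ roughSet z D, ∑ r ∈ exactSet M P R, ∑ r' ∈ exactSet M P R,
        ∑ n ∈ Finset.Ioc t (t + t), (if n * r ≤ N then ε d * devTerm d r n else 0) *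
        (if n * r' ≤ N then ε d' * devTerm d' r' n else 0) := by
        simp only [pow_two, Finset.sum_mul_sum]
        rw [Finset.sum_comm]
        refine Finset.sum_congr rfl fun d _ => ?_
        rw [Finset.sum_comm]
        refine Finset.sum_congr rfl fun d' _ => ?_
        rw [Finset.sum_comm]
        refine Finset.sum_congr rfl fun r _ => ?_
        rw [Finset.sum_comm]
    _ ≤ ∑ d ∈ roughSet z D, ∑ d' ∈ roughSet z D,
        (R : ℝ) ^ 2 * (3 + t * ((1 + l) * A d d' + B d d' / M)) :=
        Finset.sum_le_sum fun d hd => Finset.sum_le_sum fun d' hd' =>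
          (Finset.sum_le_sum fun r hr => Finset.sum_le_sum fun r' hr' =>
            hW d hd d' hd' r hr r' hr').trans (hWsum d hd d' hd')
    _ = (R : ℝ) ^ 2 * (3 * ((roughSet z D).card * (roughSet z D).card) +
          t * ((1 + l) * (∑ d ∈ roughSet z D, ∑ d' ∈ roughSet z D, A d d') +
            (∑ d ∈ roughSet z D, ∑ d' ∈ roughSet z D, B d d') / M)) := by
        simp only [← Finset.mul_sum, Finset.sum_add_distrib, Finset.sum_const, nsmul_eq_mul,
          ← Finset.sum_div]
        ring
    _ ≤ _ := by
        have h1 : ∑ d ∈ roughSet z D, ∑ d' ∈ roughSet z D, A d d' ≤ l ^ 2 / z :=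
          (sum_gcd_inv_le hz).trans (by gcongr)
        have h2 : ∑ d ∈ roughSet z D, ∑ d' ∈ roughSet z D, B d d' ≤ l ^ 3 :=
          sum_gcd_div_le.trans (by gcongr)
        have h3 : ((roughSet z D).card : ℝ) * (roughSet z D).card ≤ (D : ℝ) ^ 2 := by
          rw [pow_two]
          gcongr
        gcongr

/-- Contribution of one dyadic block of primes to the dispersion bound. -/
lemma abs_sum_block_le {N M P D z t : ℕ} (hM : 0 < M) (hz : 0 < z) (hD : 0 < D) (hDP : D ≤ P)
    (hMt : M ≤ t) {ε : ℕ → ℝ} (hε : ∀ d, |ε d| ≤ 1) {Q : Finset ℕ}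
    (hQ : Q ⊆ Finset.Ioc t (t + t)) :
    |∑ n ∈ Q, ∑ d ∈ roughSet z D, ∑ r ∈ exactSet M P (N / t),
      if n * r ≤ N then ε d * devTerm d r n else 0| ≤
    N * √(4 * (1 + Real.log P) ^ 3 * ((D : ℝ) ^ 2 / M + 1 / z)) := by
  have ht : 0 < t := hM.trans_le hMt
  have h := sum_sq_devTerm_le (N := N) hM hz hDP ht hε
  set F : ℕ → ℝ := fun n => ∑ d ∈ roughSet z D, ∑ r ∈ exactSet M P (N / t),
      if n * r ≤ N then ε d * devTerm d r n else 0
  set l := 1 + Real.log P with hl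
  have hl1 : 1 ≤ l := by
    have : 0 ≤ Real.log P := Real.log_natCast_nonneg P
    linarith
  have hcs := sq_sum_le_card_mul_sum_sq (s := Q) (f := F)
  have hQc : (Q.card : ℝ) ≤ t := by
    have := Finset.card_le_card hQ
    rw [Nat.card_Ioc] at this
    exact_mod_cast (by omega : Q.card ≤ t)
  have hQs : ∑ n ∈ Q, F n ^ 2 ≤ ∑ n ∈ Finset.Ioc t (t + t), F n ^ 2 :=
    Finset.sum_le_sum_of_subset_of_nonneg hQ fun _ _ _ => sq_nonneg _
  rw [← Real.sqrt_sq_eq_abs]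
  have hN : (N : ℝ) = √((N : ℝ) ^ 2) := (Real.sqrt_sq (by positivity)).symm
  rw [hN, ← Real.sqrt_mul (by positivity)]
  apply Real.sqrt_le_sqrt
  have ht0 : (0 : ℝ) < t := by exact_mod_cast ht
  have hM0 : (0 : ℝ) < M := by exact_mod_cast hM
  have hz0 : (0 : ℝ) < z := by exact_mod_cast hz
  have hMt' : (M : ℝ) ≤ t := by exact_mod_cast hMt
  have hD1 : (1 : ℝ) ≤ D := by exact_mod_cast hD
  have hR : (((N / t : ℕ) : ℝ)) * t ≤ N := by exact_mod_cast Nat.div_mul_le_self N t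
  have hl3 : l ^ 2 ≤ l ^ 3 := pow_le_pow_right₀ hl1 (by norm_num)
  have hl3' : 1 ≤ l ^ 3 := one_le_pow₀ hl1
  calc (∑ n ∈ Q, F n) ^ 2 ≤ t * (((N / t : ℕ) : ℝ) ^ 2 * (3 * D ^ 2 +
        t * ((1 + l) * (l ^ 2 / z) + l ^ 3 / M))) :=
        hcs.trans (mul_le_mul hQc (hQs.trans h) (Finset.sum_nonneg fun _ _ => sq_nonneg _)
          ht0.le)
    _ = (((N / t : ℕ) : ℝ) * t) ^ 2 * (3 * D ^ 2 / t + ((l ^ 2 + l ^ 3) / z + l ^ 3 / M)) := by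
        field_simp
    _ ≤ (N : ℝ) ^ 2 * (3 * (l ^ 3 * D ^ 2) / M + ((l ^ 3 + l ^ 3) / z + l ^ 3 * D ^ 2 / M)) := by
        have h1 : (3 : ℝ) * D ^ 2 / t ≤ 3 * (l ^ 3 * D ^ 2) / M := by
          gcongr
          exact le_mul_of_one_le_left (by positivity) hl3'
        have h2 : l ^ 3 / M ≤ l ^ 3 * D ^ 2 / M := by
          gcongr
          exact le_mul_of_one_le_right (by positivity) (one_le_pow₀ hD1)
        gcongr
    _ ≤ (N : ℝ) ^ 2 * (4 * l ^ 3 * ((D : ℝ) ^ 2 / M + 1 / z)) := by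
        gcongr
        have e : 4 * l ^ 3 * ((D : ℝ) ^ 2 / M + 1 / z) =
          3 * (l ^ 3 * D ^ 2) / M + ((l ^ 3 + l ^ 3) / z + l ^ 3 * D ^ 2 / M) + 2 * (l ^ 3 / z) := by
          ring
        have : 0 ≤ l ^ 3 / z := by positivity
        linarith

lemma sum_primePairs_eq_sum_primesIoc {N M P : ℕ} (G : ℕ → ℕ → ℝ) :
    ∑ x ∈ primePairs N M P, G x.1 x.2 = ∑ p ∈ primesIoc M P, ∑ r ∈ exactSet M P N,
      if p * r ≤ N then G p r else 0 := by
  rw [← Finset.sum_product', ← Finset.sum_filter]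
  refine Finset.sum_congr ?_ fun _ _ => rfl
  ext ⟨p, r⟩
  simp only [mem_primePairs, Finset.mem_filter, Finset.mem_product, mem_exactSet]
  constructor
  · rintro ⟨h1, h2, h3, h4⟩
    exact ⟨⟨h1, ⟨h2, (Nat.le_mul_of_pos_left _ (mem_primesIoc.1 h1).2.pos).trans h3⟩, h4⟩, h3⟩
  · rintro ⟨⟨h1, ⟨h2, -⟩, h4⟩, h3⟩
    exact ⟨h1, h2, h3, h4⟩

lemma sum_exactSet_div {N M P t p : ℕ} (ht : 0 < t) (htp : t ≤ p) (G : ℕ → ℝ) :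
    (∑ r ∈ exactSet M P N, if p * r ≤ N then G r else 0) =
      ∑ r ∈ exactSet M P (N / t), if p * r ≤ N then G r else 0 := by
  symm
  refine Finset.sum_subset (fun r hr => ?_) fun r hr hr' => ?_
  · rw [mem_exactSet] at hr ⊢
    exact ⟨⟨hr.1.1, hr.1.2.trans (Nat.div_le_self _ _)⟩, hr.2⟩
  · refine if_neg fun h => hr' ?_
    rw [mem_exactSet] at hr ⊢
    refine ⟨⟨hr.1.1, (Nat.le_div_iff_mul_le ht).2 ?_⟩, hr.2⟩
    nlinarith

/-- The quantity controlling the dispersion of `d ∣ p s(r) + σ(r)`. -/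
noncomputable def dispErr (M P D z : ℕ) : ℝ :=
  2 * (1 + Real.log P) * √(4 * (1 + Real.log P) ^ 3 * ((D : ℝ) ^ 2 / M + 1 / z))

/-- The divisibility `d ∣ p s(r) + σ(r)` is equidistributed on average over rough `d`. -/
lemma sum_abs_sum_devTerm_le {N M P D z : ℕ} (hM : 0 < M) (hz : 0 < z) (hD : 0 < D)
    (hDP : D ≤ P) :
    ∑ d ∈ roughSet z D, |∑ x ∈ primePairs N M P, devTerm d x.2 x.1| ≤ N * dispErr M P D z := by
  let ε : ℕ → ℝ := fun d => if 0 ≤ ∑ x ∈ primePairs N M P, devTerm d x.2 x.1 then 1 else -1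
  have hε : ∀ d, |ε d| ≤ 1 := fun d => by
    simp only [ε]
    split_ifs <;> simp
  have habs : ∀ d, |∑ x ∈ primePairs N M P, devTerm d x.2 x.1| =
      ∑ x ∈ primePairs N M P, ε d * devTerm d x.2 x.1 := fun d => by
    rw [← Finset.mul_sum]
    simp only [ε]
    split_ifs with h
    · rw [abs_of_nonneg h, one_mul]
    · rw [abs_of_neg (not_le.1 h), neg_one_mul]
  let idx : ℕ → ℕ := fun p => Nat.log 2 ((p - 1) / M)
  have hidx : ∀ p ∈ primesIoc M P, idx p ∈ Finset.range (Nat.log 2 P + 1) := fun p hp => by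
    rw [Finset.mem_range, Nat.lt_succ_iff]
    refine Nat.log_mono_right ((Nat.div_le_self _ _).trans ?_)
    have := (mem_primesIoc.1 hp).1.2
    omega
  have hblock : ∀ j, ∀ p ∈ primesIoc M P, idx p = j → p ∈ Finset.Ioc (M * 2 ^ j)
      (M * 2 ^ j + M * 2 ^ j) := fun j p hp hj => by
    have hpM := (mem_primesIoc.1 hp).1.1
    have h0 : (p - 1) / M ≠ 0 := (Nat.div_pos (by omega) hM).ne'
    have h1 : 2 ^ j ≤ (p - 1) / M := hj ▸ Nat.pow_log_le_self 2 h0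
    have h2 : (p - 1) / M < 2 ^ (j + 1) := hj ▸ Nat.lt_pow_succ_log_self (by norm_num) _
    rw [Nat.le_div_iff_mul_le hM] at h1
    rw [Nat.div_lt_iff_lt_mul hM, pow_succ] at h2
    rw [Finset.mem_Ioc]
    constructor
    · rw [mul_comm]
      omega
    · have : 2 ^ j * 2 * M = M * 2 ^ j + M * 2 ^ j := by ring
      omega
  calc _ = ∑ x ∈ primePairs N M P, ∑ d ∈ roughSet z D, ε d * devTerm d x.2 x.1 := by
        rw [Finset.sum_comm]
        exact Finset.sum_congr rfl fun d _ => habs d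
    _ = ∑ p ∈ primesIoc M P, ∑ r ∈ exactSet M P N,
          if p * r ≤ N then ∑ d ∈ roughSet z D, ε d * devTerm d r p else 0 :=
        sum_primePairs_eq_sum_primesIoc fun p r => ∑ d ∈ roughSet z D, ε d * devTerm d r p
    _ = ∑ j ∈ Finset.range (Nat.log 2 P + 1), ∑ p ∈ (primesIoc M P).filter (fun p => idx p = j),
          ∑ d ∈ roughSet z D, ∑ r ∈ exactSet M P (N / (M * 2 ^ j)),
            if p * r ≤ N then ε d * devTerm d r p else 0 := by
        rw [← Finset.sum_fiberwise_of_maps_to hidx]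
        refine Finset.sum_congr rfl fun j _ => Finset.sum_congr rfl fun p hp => ?_
        rw [Finset.mem_filter] at hp
        have := Finset.mem_Ioc.1 (hblock j p hp.1 hp.2)
        rw [sum_exactSet_div (t := M * 2 ^ j) (by positivity) this.1.le, Finset.sum_comm]
        refine Finset.sum_congr rfl fun r _ => ?_
        split_ifs <;> simp
    _ ≤ ∑ j ∈ Finset.range (Nat.log 2 P + 1),
          N * √(4 * (1 + Real.log P) ^ 3 * ((D : ℝ) ^ 2 / M + 1 / z)) := by
        refine Finset.sum_le_sum fun j _ => (le_abs_self _).trans ?_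
        refine abs_sum_block_le hM hz hD hDP (Nat.le_mul_of_pos_right _ (by positivity)) hε
          fun p hp => ?_
        rw [Finset.mem_filter] at hp
        exact hblock j p hp.1 hp.2
    _ ≤ _ := by
        rw [Finset.sum_const, Finset.card_range, nsmul_eq_mul, dispErr]
        have h1 : (Nat.log 2 P : ℝ) ≤ 2 * Real.log P := by
          have hP : 0 < P := hD.trans_le hDP
          have h2 : ((2 ^ Nat.log 2 P : ℕ) : ℝ) ≤ P := by
            exact_mod_cast Nat.pow_log_le_self 2 hP.ne'
          have h3 := Real.log_le_log (by positivity) h2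
          push_cast at h3
          rw [Real.log_pow] at h3
          have h4 := Real.log_two_gt_d9
          have h5 : (0 : ℝ) ≤ Nat.log 2 P := Nat.cast_nonneg _
          nlinarith
        have h6 : ((Nat.log 2 P + 1 : ℕ) : ℝ) ≤ 2 * (1 + Real.log P) := by
          push_cast
          linarith
        set q := √(4 * (1 + Real.log P) ^ 3 * ((D : ℝ) ^ 2 / M + 1 / z))
        calc _ ≤ 2 * (1 + Real.log P) * (N * q) := by gcongr
          _ = _ := by ring

lemma sumDiv_prime_pow {p : ℕ} (hp : p.Prime) (a : ℕ) :
    sumDiv (p ^ a) = ∑ i ∈ Finset.range (a + 1), p ^ i := by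
  rw [sumDiv, Nat.sum_divisors_prime_pow hp]

lemma sumDiv_prime_pow_lt {p : ℕ} (hp : p.Prime) (a : ℕ) : sumDiv (p ^ a) < 2 * p ^ a := by
  rw [sumDiv_prime_pow hp]
  induction a with
  | zero => simp
  | succ a ih =>
    rw [Finset.sum_range_succ]
    have : 2 * p ^ a ≤ p ^ (a + 1) := by
      rw [pow_succ, mul_comm]
      exact Nat.mul_le_mul_left _ hp.two_le
    omega

lemma exists_primePow_of_dvd_sumDiv {q n : ℕ} (hq : q.Prime) (hn : n ≠ 0) (h : q ∣ sumDiv n) :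
    ∃ p a, p.Prime ∧ 0 < a ∧ p ^ a ∣ n ∧ q ∣ sumDiv (p ^ a) := by
  rw [sumDiv_eq_sigma,
    ArithmeticFunction.isMultiplicative_sigma.multiplicative_factorization _ hn, Finsupp.prod,
    hq.prime.dvd_finsetProd_iff] at h
  obtain ⟨p, hp, hdvd⟩ := h
  rw [← sumDiv_eq_sigma] at hdvd
  have hpp := Nat.prime_of_mem_primeFactors (by simpa using hp)
  exact ⟨p, n.factorization p, hpp, Nat.pos_of_ne_zero (Finsupp.mem_support_iff.1 hp),
    Nat.ordProj_dvd n p, hdvd⟩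

/-- Pairs `(p, a)` with `p ^ a ≤ N` a prime power such that `q ∣ σ(p ^ a)`. -/
def sigmaPairs (q N : ℕ) : Finset (ℕ × ℕ) :=
  ((Finset.Ioc 0 N) ×ˢ (Finset.Icc 1 (Nat.log 2 N))).filter
    fun x => x.1.Prime ∧ x.1 ^ x.2 ≤ N ∧ q ∣ sumDiv (x.1 ^ x.2)

lemma mem_sigmaPairs {q N p a : ℕ} (hp : p.Prime) (ha : 0 < a) (h : p ^ a ≤ N)
    (hq : q ∣ sumDiv (p ^ a)) : (p, a) ∈ sigmaPairs q N := by
  simp only [sigmaPairs, Finset.mem_filter, Finset.mem_product, Finset.mem_Ioc, Finset.mem_Icc]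
  refine ⟨⟨⟨hp.pos, (Nat.le_self_pow ha.ne' p).trans h⟩, ha, ?_⟩, hp, h, hq⟩
  exact Nat.le_log_of_pow_le (by norm_num) ((Nat.pow_le_pow_left hp.two_le a).trans h)

lemma sum_sigmaPairs_le {q N : ℕ} (hq : 0 < q) (hN : 0 < N) :
    ∑ x ∈ sigmaPairs q N, (1 : ℝ) / ((x.1 ^ x.2 : ℕ) : ℝ) ≤ 6 * (1 + Real.log N) ^ 2 / q := by
  have hlN : 0 ≤ Real.log N := Real.log_natCast_nonneg N
  have h1 : ∀ a ∈ Finset.Icc 1 (Nat.log 2 N), ∑ p ∈ Finset.Ioc 0 N,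
      (if p.Prime ∧ p ^ a ≤ N ∧ q ∣ sumDiv (p ^ a) then (1 : ℝ) / ((p ^ a : ℕ) : ℝ) else 0) ≤
      2 * ((1 + Real.log (2 * N : ℕ)) / q) := by
    intro a ha
    have ha1 := (Finset.mem_Icc.1 ha).1
    rw [← Finset.sum_filter]
    set S := (Finset.Ioc 0 N).filter fun p => p.Prime ∧ p ^ a ≤ N ∧ q ∣ sumDiv (p ^ a) with hS
    have hinj : Set.InjOn (fun p => sumDiv (p ^ a)) S := by
      have hmono : ∀ p p', p.Prime → p'.Prime → p < p' → sumDiv (p ^ a) < sumDiv (p' ^ a) := by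
        intro p p' hp hp' hlt
        rw [sumDiv_prime_pow hp, sumDiv_prime_pow hp']
        refine Finset.sum_lt_sum (fun i _ => Nat.pow_le_pow_left hlt.le i)
          ⟨1, Finset.mem_range.2 (by omega), by simpa using hlt⟩
      intro p hp p' hp' heq
      have hpp := (Finset.mem_filter.1 hp).2.1
      have hpp' := (Finset.mem_filter.1 hp').2.1
      simp only at heq
      rcases lt_trichotomy p p' with h | h | h
      · have := hmono p p' hpp hpp' h
        omega
      · exact h
      · have := hmono p' p hpp' hpp h
        omega
    calc ∑ p ∈ S, (1 : ℝ) / ((p ^ a : ℕ) : ℝ) ≤ ∑ p ∈ S, 2 * (1 / (sumDiv (p ^ a) : ℝ)) := by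
          refine Finset.sum_le_sum fun p hp => ?_
          have hpp := (Finset.mem_filter.1 hp).2.1
          have h2 : (sumDiv (p ^ a) : ℝ) ≤ 2 * (p ^ a : ℕ) := by
            exact_mod_cast (sumDiv_prime_pow_lt hpp a).le
          have h3 : (0 : ℝ) < sumDiv (p ^ a) := by
            have : 0 < sumDiv (p ^ a) := by
              rw [sumDiv_eq]
              have := Nat.pow_pos (n := a) hpp.pos
              omega
            exact_mod_cast this
          have h4 : (0 : ℝ) < (p ^ a : ℕ) := by exact_mod_cast Nat.pow_pos (n := a) hpp.pos
          rw [mul_one_div, div_le_div_iff₀ h4 h3]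
          linarith
      _ = 2 * ∑ v ∈ S.image fun p => sumDiv (p ^ a), 1 / (v : ℝ) := by
          rw [← Finset.mul_sum, Finset.sum_image hinj]
      _ ≤ 2 * ∑ v ∈ Finset.Ioc 0 (2 * N), (if q ∣ v then 1 / (v : ℝ) else 0) := by
          rw [← Finset.sum_filter]
          refine mul_le_mul_of_nonneg_left (Finset.sum_le_sum_of_subset_of_nonneg ?_
            fun _ _ _ => by positivity) (by norm_num)
          intro v hv
          obtain ⟨p, hp, rfl⟩ := Finset.mem_image.1 hv
          obtain ⟨hp1, hpp, hpa, hpq⟩ := Finset.mem_filter.1 hp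
          refine Finset.mem_filter.2 ⟨Finset.mem_Ioc.2 ⟨?_, ?_⟩, hpq⟩
          · rw [sumDiv_eq]
            have := Nat.pow_pos (n := a) hpp.pos
            omega
          · exact (sumDiv_prime_pow_lt hpp a).le.trans (by omega)
      _ ≤ _ := mul_le_mul_of_nonneg_left (sum_inv_multiples_le hq) (by norm_num)
  rw [sigmaPairs, Finset.sum_filter, Finset.sum_product_right]
  refine (Finset.sum_le_card_nsmul _ _ _ h1).trans ?_
  rw [nsmul_eq_mul, Nat.card_Icc, Nat.add_sub_cancel]
  have hlog : (Nat.log 2 N : ℝ) ≤ 1.45 * Real.log N := by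
    have h2 : ((2 ^ Nat.log 2 N : ℕ) : ℝ) ≤ N := by exact_mod_cast Nat.pow_log_le_self 2 hN.ne'
    have h3 := Real.log_le_log (by positivity) h2
    push_cast at h3
    rw [Real.log_pow] at h3
    have h4 := Real.log_two_gt_d9
    have h5 : (0 : ℝ) ≤ Nat.log 2 N := Nat.cast_nonneg _
    nlinarith
  have hlog2 : Real.log (2 * N : ℕ) ≤ 0.7 + Real.log N := by
    push_cast
    rw [Real.log_mul (by norm_num) (by positivity)]
    have := Real.log_two_lt_d9
    linarith
  calc _ ≤ 1.45 * Real.log N * (2 * ((1 + (0.7 + Real.log N)) / q)) := by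
        have : 0 ≤ Real.log (2 * N : ℕ) := Real.log_natCast_nonneg _
        gcongr
    _ = 1.45 * Real.log N * 2 * (1 + (0.7 + Real.log N)) / q := by ring
    _ ≤ _ := by
        have : 1.45 * Real.log N * 2 * (1 + (0.7 + Real.log N)) ≤ 6 * (1 + Real.log N) ^ 2 := by
          nlinarith
        gcongr

lemma card_dvd_sumDiv_le {q N : ℕ} (hq : q.Prime) :
    (((Finset.Ioc 0 N).filter fun n => q ∣ sumDiv n).card : ℝ) ≤
      N * (6 * (1 + Real.log N) ^ 2 / q) := by
  rcases N.eq_zero_or_pos with rfl | hN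
  · simp
  have h1 : ((Finset.Ioc 0 N).filter fun n => q ∣ sumDiv n) ⊆
      (sigmaPairs q N).biUnion fun x => (Finset.Ioc 0 N).filter fun n => x.1 ^ x.2 ∣ n := by
    intro n hn
    obtain ⟨hn1, hn2⟩ := Finset.mem_filter.1 hn
    obtain ⟨hn0, hnN⟩ := Finset.mem_Ioc.1 hn1
    obtain ⟨p, a, hp, ha, hd, hqd⟩ := exists_primePow_of_dvd_sumDiv hq hn0.ne' hn2
    exact Finset.mem_biUnion.2 ⟨(p, a), mem_sigmaPairs hp ha ((Nat.le_of_dvd hn0 hd).trans hnN) hqd,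
      Finset.mem_filter.2 ⟨hn1, hd⟩⟩
  calc _ ≤ ∑ x ∈ sigmaPairs q N,
          (((Finset.Ioc 0 N).filter fun n => x.1 ^ x.2 ∣ n).card : ℝ) := by
        exact_mod_cast (Finset.card_le_card h1).trans Finset.card_biUnion_le
    _ ≤ ∑ x ∈ sigmaPairs q N, N * (1 / ((x.1 ^ x.2 : ℕ) : ℝ)) :=
        Finset.sum_le_sum fun x _ => by
          rw [mul_one_div]
          exact card_dvd_le N _
    _ ≤ _ := by
        rw [← Finset.mul_sum]
        exact mul_le_mul_of_nonneg_left (sum_sigmaPairs_le hq.pos hN) (by positivity)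

lemma card_dvd_and_dvd_sumDiv_le {q N : ℕ} (hq : q.Prime) :
    (((Finset.Ioc 0 N).filter fun n => q ∣ n ∧ q ∣ sumDiv n).card : ℝ) ≤
      N * (6 * (1 + Real.log N) ^ 2 / q ^ 2) := by
  rcases N.eq_zero_or_pos with rfl | hN
  · simp
  have h1 : ((Finset.Ioc 0 N).filter fun n => q ∣ n ∧ q ∣ sumDiv n) ⊆
      (sigmaPairs q N).biUnion fun x => (Finset.Ioc 0 N).filter fun n => q * x.1 ^ x.2 ∣ n := by
    intro n hn
    obtain ⟨hn1, hqn, hn2⟩ := Finset.mem_filter.1 hn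
    obtain ⟨hn0, hnN⟩ := Finset.mem_Ioc.1 hn1
    obtain ⟨p, a, hp, ha, hd, hqd⟩ := exists_primePow_of_dvd_sumDiv hq hn0.ne' hn2
    refine Finset.mem_biUnion.2 ⟨(p, a), mem_sigmaPairs hp ha
      ((Nat.le_of_dvd hn0 hd).trans hnN) hqd, Finset.mem_filter.2 ⟨hn1, ?_⟩⟩
    have hne : q ≠ p := by
      rintro rfl
      rw [sumDiv_prime_pow hq, Finset.sum_range_succ'] at hqd
      have : q ∣ ∑ i ∈ Finset.range a, q ^ (i + 1) :=
        Finset.dvd_sum fun i _ => dvd_pow_self q (Nat.succ_ne_zero i)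
      rw [Nat.dvd_add_right this, pow_zero] at hqd
      exact hq.one_lt.ne' (Nat.dvd_one.1 hqd)
    exact (((Nat.coprime_primes hq hp).2 hne).pow_right a).mul_dvd_of_dvd_of_dvd hqn hd
  calc _ ≤ ∑ x ∈ sigmaPairs q N,
          (((Finset.Ioc 0 N).filter fun n => q * x.1 ^ x.2 ∣ n).card : ℝ) := by
        exact_mod_cast (Finset.card_le_card h1).trans Finset.card_biUnion_le
    _ ≤ ∑ x ∈ sigmaPairs q N, N / q * (1 / ((x.1 ^ x.2 : ℕ) : ℝ)) :=
        Finset.sum_le_sum fun x _ => by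
          refine (card_dvd_le N _).trans (le_of_eq ?_)
          push_cast
          rw [div_mul_div_comm, mul_one]
    _ ≤ N / q * (6 * (1 + Real.log N) ^ 2 / q) := by
        rw [← Finset.mul_sum]
        exact mul_le_mul_of_nonneg_left (sum_sigmaPairs_le hq.pos hN) (by positivity)
    _ = _ := by
        rw [div_mul_div_comm, pow_two (q : ℝ), mul_div_assoc]

open Classical in
lemma card_not_isGood_le {q R M P : ℕ} (hM : 0 < M) (hq : q.Prime) :
    (((exactSet M P R).filter fun r => ¬ IsGood q r).card : ℝ) ≤
      R * ((2 + 6 * (1 + Real.log R) ^ 2 + Real.log P) / q + 1 / M) := by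
  set S := (exactSet M P R).filter fun r =>
    q.Coprime (sumDiv r) ∧ q ∣ sumProper r with hS
  have h1 : ((exactSet M P R).filter fun r => ¬ IsGood q r) ⊆
      ((Finset.Ioc 0 R).filter fun n => q ∣ n) ∪ ((Finset.Ioc 0 R).filter fun n => q ∣ sumDiv n) ∪
        S := by
    intro r hr
    obtain ⟨hr1, hr2⟩ := Finset.mem_filter.1 hr
    have hr3 := Finset.mem_Ioc.2 (mem_exactSet.1 hr1).1
    simp only [Finset.mem_union, Finset.mem_filter, hS]
    simp only [IsGood, hq.coprime_iff_not_dvd] at hr2 ⊢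
    tauto
  have h2 : (S.card : ℝ) ≤ R * ((1 + Real.log P) / q + 1 / M) := by
    refine card_le_of_modEq_class hM hq.pos (fun r hr => Finset.mem_Ioc.2
      (mem_exactSet.1 (Finset.mem_filter.1 hr).1).1) (Q := fun p m => q.Coprime (sumDiv m) ∧
        q ∣ p * sumProper m + sumDiv m) (fun r hr => ?_) ?_
    · obtain ⟨hr1, hr2, hr3⟩ := Finset.mem_filter.1 hr
      obtain ⟨p, hp, m, rfl, hpm⟩ := (mem_exactSet.1 hr1).2
      rw [mem_primesIoc] at hp
      rw [sumProper_prime_mul hp.2 hpm] at hr3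
      rw [sumDiv_prime_mul hp.2 hpm] at hr2
      exact ⟨p, Finset.mem_Ioc.2 hp.1, m, rfl, hr2.coprime_dvd_right (dvd_mul_left _ _), hr3⟩
    · rintro m p p' ⟨hm, hp⟩ ⟨-, hp'⟩
      have hs : q.Coprime (sumProper m) := by
        rw [hq.coprime_iff_not_dvd] at hm ⊢
        exact fun h => hm ((Nat.dvd_add_right (h.mul_left p)).1 hp)
      obtain ⟨v, hv⟩ := exists_dvd_iff_modEq hq.pos hs (sumDiv m)
      rw [hv] at hp hp'
      exact hp.trans hp'.symm
  have h3 := card_dvd_le R q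
  have h4 := card_dvd_sumDiv_le (N := R) hq
  have h5 : (((exactSet M P R).filter fun r => ¬ IsGood q r).card : ℝ) ≤
      ((Finset.Ioc 0 R).filter fun n => q ∣ n).card +
        ((Finset.Ioc 0 R).filter fun n => q ∣ sumDiv n).card + S.card := by
    exact_mod_cast (Finset.card_le_card h1).trans ((Finset.card_union_le _ _).trans
      (Nat.add_le_add_right (Finset.card_union_le _ _) _))
  refine h5.trans ((add_le_add (add_le_add h3 h4) h2).trans (le_of_eq ?_))
  ring

open Classical in
lemma card_primePairs_not_isGood_le {q N M P : ℕ} (hM : 0 < M) (hq : q.Prime) :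
    (((primePairs N M P).filter fun x => ¬ IsGood q x.2).card : ℝ) ≤
      N * recipSum M P * ((2 + 6 * (1 + Real.log N) ^ 2 + Real.log P) / q + 1 / M) := by
  set c := (2 + 6 * (1 + Real.log N) ^ 2 + Real.log P) / q + 1 / M with hc
  have hP : 0 ≤ Real.log P := Real.log_natCast_nonneg P
  have h1 : (((primePairs N M P).filter fun x => ¬ IsGood q x.2).card : ℝ) =
      ∑ p ∈ primesIoc M P, ∑ r ∈ exactSet M P N,
        if p * r ≤ N then (if ¬ IsGood q r then (1 : ℝ) else 0) else 0 := by
    rw [← sum_primePairs_eq_sum_primesIoc fun _ r => if ¬ IsGood q r then (1 : ℝ) else 0,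
      Finset.sum_boole]
  rw [h1, recipSum, mul_assoc, mul_comm _ c, Finset.mul_sum, Finset.mul_sum]
  refine Finset.sum_le_sum fun p hp => ?_
  have hp0 := (mem_primesIoc.1 hp).2.pos
  rw [sum_exactSet_div hp0 le_rfl]
  calc _ ≤ ∑ r ∈ exactSet M P (N / p), if ¬ IsGood q r then (1 : ℝ) else 0 := by
        refine Finset.sum_le_sum fun r _ => ?_
        split_ifs <;> norm_num
    _ ≤ (N / p : ℕ) *
          ((2 + 6 * (1 + Real.log (N / p : ℕ)) ^ 2 + Real.log P) / q + 1 / M) := by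
        rw [Finset.sum_boole]
        exact card_not_isGood_le hM hq
    _ ≤ (N / p : ℝ) * c := by
        have h2 : Real.log (N / p : ℕ) ≤ Real.log N := by
          rcases (N / p).eq_zero_or_pos with h | h
          · rw [h]
            simpa using Real.log_natCast_nonneg N
          · exact Real.log_le_log (by exact_mod_cast h) (by exact_mod_cast Nat.div_le_self N p)
        have h3 : ((N / p : ℕ) : ℝ) ≤ N / p := Nat.cast_div_le
        have h4 : 0 ≤ Real.log (N / p : ℕ) := Real.log_natCast_nonneg _
        rw [hc]
        gcongr
    _ = _ := by ring

/-- The quantity controlling the pairs `(p, r)` for which `r` is not good. -/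
noncomputable def badErr (N M P D z : ℕ) : ℝ :=
  recipSum M P * (1 + Real.log D) *
    ((2 + 6 * (1 + Real.log N) ^ 2 + Real.log P) / z + (1 + Real.log D) / M)

lemma exists_prime_not_isGood {d r : ℕ} (h : ¬ IsGood d r) :
    ∃ q, q.Prime ∧ q ∣ d ∧ ¬ IsGood q r := by
  have aux : ∀ X, ¬ d.Coprime X → ∃ q, q.Prime ∧ q ∣ d ∧ ¬ q.Coprime X := fun X hX => by
    obtain ⟨q, hq, h1, h2⟩ := Nat.Prime.not_coprime_iff_dvd.1 hX
    exact ⟨q, hq, h1, fun hc => (hq.coprime_iff_not_dvd.1 hc) h2⟩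
  simp only [IsGood, not_and_or] at h ⊢
  rcases h with h | h | h <;> obtain ⟨q, h1, h2, h3⟩ := aux _ h <;> exact ⟨q, h1, h2, by tauto⟩

open Classical in
lemma sum_inv_mul_card_not_isGood_le {N M P D z : ℕ} (hM : 0 < M) (hz : 0 < z) :
    ∑ d ∈ roughSet z D, 1 / (d : ℝ) * ((primePairs N M P).filter fun x => ¬ IsGood d x.2).card ≤
      N * badErr N M P D z := by
  set b : ℕ → ℝ := fun q => ((primePairs N M P).filter fun x => ¬ IsGood q x.2).card with hb
  set c := 2 + 6 * (1 + Real.log N) ^ 2 + Real.log P with hc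
  have hP : 0 ≤ Real.log P := Real.log_natCast_nonneg P
  have hD : 0 ≤ Real.log D := Real.log_natCast_nonneg D
  have hc0 : 0 ≤ c := by positivity
  have h1 : ∀ d ∈ roughSet z D, 1 / (d : ℝ) * b d ≤
      ∑ q ∈ primesIoc z D, (if q ∣ d then 1 / (d : ℝ) else 0) * b q := by
    intro d hd
    rw [mem_roughSet] at hd
    have h2 : b d ≤ ∑ q ∈ primesIoc z D, if q ∣ d then b q else 0 := by
      have : ((primePairs N M P).filter fun x => ¬ IsGood d x.2) ⊆
          ((primesIoc z D).filter fun q => q ∣ d).biUnion fun q =>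
            (primePairs N M P).filter fun x => ¬ IsGood q x.2 := by
        intro x hx
        obtain ⟨hx1, hx2⟩ := Finset.mem_filter.1 hx
        obtain ⟨q, hq, hqd, hqx⟩ := exists_prime_not_isGood hx2
        refine Finset.mem_biUnion.2 ⟨q, Finset.mem_filter.2 ⟨mem_primesIoc.2 ⟨⟨?_, ?_⟩, hq⟩, hqd⟩,
          Finset.mem_filter.2 ⟨hx1, hqx⟩⟩
        · exact hd.2 q (Nat.mem_primeFactors.2 ⟨hq, hqd, hd.1.1.ne'⟩)
        · exact (Nat.le_of_dvd hd.1.1 hqd).trans hd.1.2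
      rw [← Finset.sum_filter]
      simp only [hb]
      exact_mod_cast (Finset.card_le_card this).trans Finset.card_biUnion_le
    calc _ ≤ 1 / (d : ℝ) * ∑ q ∈ primesIoc z D, if q ∣ d then b q else 0 := by gcongr
      _ = _ := by
        rw [Finset.mul_sum]
        refine Finset.sum_congr rfl fun q _ => ?_
        split_ifs <;> ring
  calc _ ≤ ∑ d ∈ roughSet z D, ∑ q ∈ primesIoc z D, (if q ∣ d then 1 / (d : ℝ) else 0) * b q :=
        Finset.sum_le_sum h1
    _ = ∑ q ∈ primesIoc z D, (∑ d ∈ roughSet z D, if q ∣ d then 1 / (d : ℝ) else 0) * b q := by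
        rw [Finset.sum_comm]
        exact Finset.sum_congr rfl fun q _ => (Finset.sum_mul _ _ _).symm
    _ ≤ ∑ q ∈ primesIoc z D, (1 + Real.log D) / q * (N * recipSum M P * (c / q + 1 / M)) := by
        refine Finset.sum_le_sum fun q hq => ?_
        have hqp := (mem_primesIoc.1 hq).2
        refine mul_le_mul ?_ (card_primePairs_not_isGood_le hM hqp) (by positivity) (by positivity)
        refine le_trans ?_ (sum_inv_multiples_le hqp.pos)
        exact Finset.sum_le_sum_of_subset_of_nonneg (Finset.filter_subset _ _)
          fun d _ _ => by split_ifs <;> positivity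
    _ = N * recipSum M P * (1 + Real.log D) * (c * ∑ q ∈ primesIoc z D, 1 / (q : ℝ) ^ 2 +
          (∑ q ∈ primesIoc z D, 1 / (q : ℝ)) / M) := by
        rw [Finset.mul_sum, Finset.sum_div, ← Finset.sum_add_distrib, Finset.mul_sum]
        exact Finset.sum_congr rfl fun q _ => by ring
    _ ≤ N * recipSum M P * (1 + Real.log D) * (c * (1 / z) + (1 + Real.log D) / M) := by
        have h3 : ∑ q ∈ primesIoc z D, 1 / (q : ℝ) ^ 2 ≤ 1 / (z : ℝ) :=
          (Finset.sum_le_sum_of_subset_of_nonneg (Finset.filter_subset _ _)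
            fun _ _ _ => by positivity).trans (sum_inv_sq_Ioc_le hz)
        have h4 : ∑ q ∈ primesIoc z D, 1 / (q : ℝ) ≤ 1 + Real.log D := by
          refine le_trans (Finset.sum_le_sum_of_subset_of_nonneg (fun q hq => ?_)
            fun _ _ _ => by positivity) (sum_inv_Icc_le D)
          have := mem_primesIoc.1 hq
          exact Finset.mem_Icc.2 ⟨this.2.pos, this.1.2⟩
        have h5 := recipSum_nonneg M P
        gcongr
    _ = _ := by
        rw [badErr]
        ring

/-- `d` divides `s(n)` and is coprime to `n`. -/
def IsProperDivisor (d n : ℕ) : Prop := d ∣ sumProper n ∧ d.Coprime n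

instance (d n : ℕ) : Decidable (IsProperDivisor d n) :=
  inferInstanceAs (Decidable (_ ∧ _))

/-- The pairs `(p, r)` in `primePairs N M P` with `p ∤ r`. -/
noncomputable def properPairs (N M P : ℕ) : Finset (ℕ × ℕ) :=
  (primePairs N M P).filter fun x => ¬ x.1 ∣ x.2

/-- The number of pairs `(p, r)` in `properPairs N M P` such that `d` divides `s(p r)` and is
coprime to `p r`. -/
noncomputable def divPairCount (N M P d : ℕ) : ℕ :=
  ((properPairs N M P).filter fun x => IsProperDivisor d (x.1 * x.2)).card

lemma isProperDivisor_mul_iff {p r d : ℕ} (hp : p.Prime) (hpr : ¬ p ∣ r) (hd : 0 < d)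
    (hdp : d < p) :
    IsProperDivisor d (p * r) ↔ IsGood d r ∧ d ∣ p * sumProper r + sumDiv r := by
  have hcop : d.Coprime p := (hp.coprime_iff_not_dvd.2 (Nat.not_dvd_of_pos_of_lt hd hdp)).symm
  rw [IsProperDivisor, sumProper_prime_mul hp hpr, Nat.coprime_mul_iff_right]
  constructor
  · rintro ⟨h1, -, h2⟩
    have key : ∀ q, q.Prime → q ∣ d → (q ∣ sumDiv r ∨ q ∣ sumProper r) → False := by
      intro q hq hqd hor
      have hqp : ¬ q ∣ p := fun h => hq.one_lt.ne'
        (Nat.dvd_one.1 (hcop ▸ Nat.dvd_gcd hqd h))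
      have hqr : ¬ q ∣ r := fun h => hq.one_lt.ne'
        (Nat.dvd_one.1 (h2 ▸ Nat.dvd_gcd hqd h))
      have h3 := hqd.trans h1
      have hboth : q ∣ sumDiv r ∧ q ∣ sumProper r := by
        rcases hor with h | h
        · refine ⟨h, ?_⟩
          have := (Nat.dvd_add_left h).1 h3
          exact (hq.dvd_mul.1 this).resolve_left hqp
        · exact ⟨(Nat.dvd_add_right (h.mul_left p)).1 h3, h⟩
      have h4 := sumDiv_eq r
      rw [h4] at hboth
      exact hqr ((Nat.dvd_add_right hboth.2).1 hboth.1)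
    refine ⟨⟨h2, ?_, ?_⟩, h1⟩
    · exact Nat.Coprime.symm (Nat.coprime_of_dvd fun q hq h3 h4 => key q hq h4 (Or.inl h3))
    · exact Nat.Coprime.symm (Nat.coprime_of_dvd fun q hq h3 h4 => key q hq h4 (Or.inr h3))
  · rintro ⟨h1, h2⟩
    exact ⟨h2, hcop, h1.1⟩

open Classical in
lemma sum_devTerm_eq (N M P d : ℕ) :
    ∑ x ∈ primePairs N M P, devTerm d x.2 x.1 =
      ((primePairs N M P).filter fun x =>
        IsGood d x.2 ∧ d ∣ x.1 * sumProper x.2 + sumDiv x.2).card -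
      1 / (d : ℝ) * ((primePairs N M P).card -
        ((primePairs N M P).filter fun x => ¬ IsGood d x.2).card) := by
  have h : ∀ x : ℕ × ℕ, devTerm d x.2 x.1 =
      (if IsGood d x.2 ∧ d ∣ x.1 * sumProper x.2 + sumDiv x.2 then 1 else 0) -
        1 / (d : ℝ) * (1 - if ¬ IsGood d x.2 then 1 else 0) := fun x => by
    simp only [devTerm, hitInd]
    split_ifs <;> simp_all
  simp only [h, Finset.sum_sub_distrib, ← Finset.mul_sum, Finset.sum_boole]
  simp

open Classical in
lemma divPairCount_eq {N M P d : ℕ} (hd : 0 < d) (hdM : d ≤ M) :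
    divPairCount N M P d = ((primePairs N M P).filter fun x =>
      (IsGood d x.2 ∧ d ∣ x.1 * sumProper x.2 + sumDiv x.2) ∧ ¬ x.1 ∣ x.2).card := by
  rw [divPairCount, properPairs, Finset.filter_filter]
  congr 1
  refine Finset.filter_congr fun x hx => ?_
  have hx1 := mem_primesIoc.1 (mem_primePairs.1 hx).1
  constructor
  · rintro ⟨h1, h2⟩
    exact ⟨(isProperDivisor_mul_iff hx1.2 h1 hd (hdM.trans_lt hx1.1.1)).1 h2, h1⟩
  · rintro ⟨h1, h2⟩
    exact ⟨h2, (isProperDivisor_mul_iff hx1.2 h2 hd (hdM.trans_lt hx1.1.1)).2 h1⟩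

lemma sum_divPairCount_le {N M P D z : ℕ} (hM : 0 < M) (hz : 0 < z) (hD : 0 < D)
    (hDP : D ≤ P) (hDM : D ≤ M) :
    ∑ q ∈ primesIoc z D, (divPairCount N M P q : ℝ) ≤
      N * (recipSum M P * recipSum z D + dispErr M P D z) := by
  classical
  have hsub : primesIoc z D ⊆ roughSet z D := by
    intro q hq
    rw [mem_primesIoc] at hq
    refine mem_roughSet.2 ⟨⟨hq.2.pos, hq.1.2⟩, fun q' hq' => ?_⟩
    rw [hq.2.primeFactors, Finset.mem_singleton] at hq'
    exact hq' ▸ hq.1.1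
  have h1 : ∀ q ∈ primesIoc z D, (divPairCount N M P q : ℝ) ≤
      N * recipSum M P * (1 / q) + |∑ x ∈ primePairs N M P, devTerm q x.2 x.1| := by
    intro q hq
    rw [mem_primesIoc] at hq
    rw [divPairCount_eq hq.2.pos (hq.1.2.trans hDM)]
    have h2 : (((primePairs N M P).filter fun x =>
        (IsGood q x.2 ∧ q ∣ x.1 * sumProper x.2 + sumDiv x.2) ∧ ¬ x.1 ∣ x.2).card : ℝ) ≤
        ((primePairs N M P).filter fun x =>
          IsGood q x.2 ∧ q ∣ x.1 * sumProper x.2 + sumDiv x.2).card := by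
      exact_mod_cast Finset.card_le_card fun x hx => by
        rw [Finset.mem_filter] at hx ⊢
        exact ⟨hx.1, hx.2.1⟩
    have h3 := le_abs_self (∑ x ∈ primePairs N M P, devTerm q x.2 x.1)
    have h4 := sum_devTerm_eq N M P q
    have h5 : 1 / (q : ℝ) * ((primePairs N M P).card -
        ((primePairs N M P).filter fun x => ¬ IsGood q x.2).card) ≤
        N * recipSum M P * (1 / q) := by
      rw [mul_comm]
      refine mul_le_mul_of_nonneg_right ((sub_le_self _ (Nat.cast_nonneg _)).trans
        (card_primePairs_le N M P)) (by positivity)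
    linarith
  refine (Finset.sum_le_sum h1).trans ?_
  rw [Finset.sum_add_distrib, ← Finset.mul_sum]
  have h2 := sum_abs_sum_devTerm_le (N := N) hM hz hD hDP
  have h3 : ∑ q ∈ primesIoc z D, |∑ x ∈ primePairs N M P, devTerm q x.2 x.1| ≤
      ∑ q ∈ roughSet z D, |∑ x ∈ primePairs N M P, devTerm q x.2 x.1| :=
    Finset.sum_le_sum_of_subset_of_nonneg hsub fun _ _ _ => abs_nonneg _
  change N * recipSum M P * recipSum z D + _ ≤ _
  linarith

/-- For most rough `d`, the proportion of pairs with `d ∣ s(p r)`, `(d, p r) = 1` is close to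
`1 / d`. -/
lemma sum_abs_divPairCount_sub_le {N M P D z : ℕ} (hM : 0 < M) (hz : 0 < z) (hD : 0 < D)
    (hDP : D ≤ P) (hDM : D ≤ M) :
    ∑ d ∈ roughSet z D, |(divPairCount N M P d : ℝ) - (primePairs N M P).card / d| ≤
      N * (dispErr M P D z + badErr N M P D z + D / M) := by
  classical
  have h1 : ∀ d ∈ roughSet z D, |(divPairCount N M P d : ℝ) - (primePairs N M P).card / d| ≤
      |∑ x ∈ primePairs N M P, devTerm d x.2 x.1| +
        1 / (d : ℝ) * ((primePairs N M P).filter fun x => ¬ IsGood d x.2).card + N / M := by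
    intro d hd
    rw [mem_roughSet] at hd
    have h2 : (((primePairs N M P).filter fun x =>
          IsGood d x.2 ∧ d ∣ x.1 * sumProper x.2 + sumDiv x.2).card : ℝ) =
        divPairCount N M P d + ((primePairs N M P).filter fun x =>
        (IsGood d x.2 ∧ d ∣ x.1 * sumProper x.2 + sumDiv x.2) ∧ x.1 ∣ x.2).card := by
      have h := Finset.card_filter_add_card_filter_not (s := (primePairs N M P).filter fun x =>
        IsGood d x.2 ∧ d ∣ x.1 * sumProper x.2 + sumDiv x.2) (fun x => x.1 ∣ x.2)
      rw [Finset.filter_filter, Finset.filter_filter] at h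
      rw [divPairCount_eq hd.1.1 (hd.1.2.trans hDM), ← h, Nat.cast_add, add_comm]
    have h3 : (((primePairs N M P).filter fun x =>
        (IsGood d x.2 ∧ d ∣ x.1 * sumProper x.2 + sumDiv x.2) ∧ x.1 ∣ x.2).card : ℝ) ≤ N / M := by
      refine le_trans ?_ (card_primePairs_dvd_le (N := N) (P := P) hM)
      exact_mod_cast Finset.card_le_card fun x hx => by
        rw [Finset.mem_filter] at hx ⊢
        exact ⟨hx.1, hx.2.2⟩
    have h4 := sum_devTerm_eq N M P d
    rw [h2] at h4
    have h5 : (divPairCount N M P d : ℝ) - (primePairs N M P).card / d =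
        ∑ x ∈ primePairs N M P, devTerm d x.2 x.1 -
          1 / (d : ℝ) * ((primePairs N M P).filter fun x => ¬ IsGood d x.2).card -
        ((primePairs N M P).filter fun x =>
          (IsGood d x.2 ∧ d ∣ x.1 * sumProper x.2 + sumDiv x.2) ∧ x.1 ∣ x.2).card := by
      rw [h4]
      ring
    rw [h5]
    refine (abs_sub _ _).trans (add_le_add ((abs_sub _ _).trans (add_le_add le_rfl ?_)) ?_)
    · rw [abs_of_nonneg (by positivity)]
    · rw [abs_of_nonneg (by positivity)]
      exact h3
  refine (Finset.sum_le_sum h1).trans ?_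
  rw [Finset.sum_add_distrib, Finset.sum_add_distrib]
  have h2 := sum_abs_sum_devTerm_le (N := N) hM hz hD hDP
  have h3 := sum_inv_mul_card_not_isGood_le (N := N) (P := P) (D := D) hM hz
  have h4 : ∑ _d ∈ roughSet z D, (N : ℝ) / M ≤ D * (N / M) := by
    rw [Finset.sum_const, nsmul_eq_mul]
    have : (roughSet z D).card ≤ D := (Finset.card_filter_le _ _).trans (by simp)
    gcongr
  calc _ ≤ _ := add_le_add (add_le_add h2 h3) h4
    _ = _ := by ring

/-- The number of `q ∈ 𝒯` dividing `s(n)` but coprime to `n`. -/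
def newCount (T : Finset ℕ) (n : ℕ) : ℕ := (T.filter fun q => IsProperDivisor q n).card

lemma sum_newCount_properPairs (T : Finset ℕ) (N M P : ℕ) :
    ∑ x ∈ properPairs N M P, (newCount T (x.1 * x.2) : ℝ) =
      ∑ q ∈ T, (divPairCount N M P q : ℝ) := by
  have h1 : ∀ n, (newCount T n : ℝ) = ∑ q ∈ T, if IsProperDivisor q n then 1 else 0 := fun n => by
    rw [newCount, Finset.sum_boole]
  simp only [h1]
  rw [Finset.sum_comm]
  refine Finset.sum_congr rfl fun q _ => ?_
  rw [Finset.sum_boole, divPairCount]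

/-- The error made in passing from integers to pairs. -/
noncomputable def pairErr (M P : ℕ) : ℝ := 2 * √(2 * recipSum M P) + 1 + recipSum M P / M

/-- A Markov-type bound for the number of `n` such that `s(n)` has many prime factors in
`(z, D]` not dividing `n`. -/
lemma card_le_newCount_le {N M P D z : ℕ} (hM : 0 < M) (hz : 0 < z) (hD : 0 < D)
    (hDP : D ≤ P) (hDM : D ≤ M) (hP : 2 * P ≤ N) {K : ℝ} (hK : 0 < K) :
    recipSum M P * ((Finset.Ioc 0 N).filter fun n => K ≤ newCount (primesIoc z D) n).card ≤
      N * (pairErr M P + 1 / M +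
        (recipSum M P * recipSum z D + dispErr M P D z) / K) := by
  classical
  set T := primesIoc z D
  let g : ℕ → ℝ := fun n => if K ≤ newCount T n then 1 else 0
  have hg0 : ∀ n, 0 ≤ g n := fun n => by
    simp only [g]
    split_ifs <;> norm_num
  have hg1 : ∀ n, g n ≤ 1 := fun n => by
    simp only [g]
    split_ifs <;> norm_num
  have h1 := norm_recipSum_smul_sum_sub_le hM hP (g := g) fun n => by
    rw [Real.norm_eq_abs, abs_of_nonneg (hg0 n)]
    exact hg1 n
  rw [Real.norm_eq_abs, smul_eq_mul] at h1
  have h2 := (abs_le.1 h1).2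
  have h3 : ∑ n ∈ Finset.Ioc 0 N, g n =
      ((Finset.Ioc 0 N).filter fun n => K ≤ newCount T n).card := by
    simp only [g, Finset.sum_boole]
  have h4 : ∑ x ∈ primePairs N M P, g (x.1 * x.2) ≤ N / M +
      1 / K * (N * (recipSum M P * recipSum z D + dispErr M P D z)) := by
    rw [← Finset.sum_filter_add_sum_filter_not _ fun x => x.1 ∣ x.2]
    refine add_le_add ?_ ?_
    · refine le_trans ((Finset.sum_le_card_nsmul _ _ 1 fun x _ => hg1 _).trans (le_of_eq ?_))
        (card_primePairs_dvd_le (N := N) (P := P) hM)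
      simp
    · calc _ ≤ ∑ x ∈ properPairs N M P, 1 / K * (newCount T (x.1 * x.2) : ℝ) := by
            refine Finset.sum_le_sum fun x _ => ?_
            simp only [g]
            split_ifs with h
            · rwa [one_div_mul_eq_div, one_le_div hK]
            · positivity
        _ ≤ _ := by
            rw [← Finset.mul_sum, sum_newCount_properPairs]
            exact mul_le_mul_of_nonneg_left (sum_divPairCount_le hM hz hD hDP hDM)
              (by positivity)
  rw [h3] at h2
  have e : N * (pairErr M P + 1 / M + (recipSum M P * recipSum z D + dispErr M P D z) / K) =
      N * pairErr M P +
      (N / M + 1 / K * (N * (recipSum M P * recipSum z D + dispErr M P D z))) := by ring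
  rw [e, pairErr]
  linarith

lemma norm_one_add_pow_sub_sum_le {w : ℂ} (hw : ‖1 + w‖ ≤ 1) (f : ℕ) : ∀ K : ℕ,
    ‖(1 + w) ^ f - ∑ k ∈ Finset.range K, (f.choose k : ℂ) * w ^ k‖ ≤ f.choose K * ‖w‖ ^ K := by
  induction f with
  | zero =>
    rintro (_ | K)
    · simp
    · rw [Finset.sum_range_succ']
      simp
  | succ f ih =>
    rintro (_ | K)
    · simpa using pow_le_one₀ (norm_nonneg _) hw
    · have h1 : (1 + w) ^ (f + 1) - ∑ k ∈ Finset.range (K + 1), ((f + 1).choose k : ℂ) * w ^ k =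
          ((1 + w) ^ f - ∑ k ∈ Finset.range (K + 1), (f.choose k : ℂ) * w ^ k) +
          w * ((1 + w) ^ f - ∑ k ∈ Finset.range K, (f.choose k : ℂ) * w ^ k) := by
        rw [Finset.sum_range_succ', Finset.sum_range_succ' _ K, mul_sub, Finset.mul_sum]
        simp only [Nat.choose_succ_succ, Nat.cast_add, add_mul, Finset.sum_add_distrib]
        have : ∑ k ∈ Finset.range K, (f.choose k : ℂ) * w ^ (k + 1) =
            ∑ k ∈ Finset.range K, w * ((f.choose k : ℂ) * w ^ k) :=
          Finset.sum_congr rfl fun k _ => by ring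
        rw [this]
        simp
        ring
      rw [h1]
      refine (norm_add_le _ _).trans ((add_le_add (ih (K + 1)) ((norm_mul_le _ _).trans
        (mul_le_mul_of_nonneg_left (ih K) (norm_nonneg _)))).trans (le_of_eq ?_))
      rw [Nat.choose_succ_succ]
      push_cast
      ring

lemma isProperDivisor_prod_iff {U : Finset ℕ} (hU : ∀ q ∈ U, q.Prime) (n : ℕ) :
    IsProperDivisor (∏ q ∈ U, q) n ↔ ∀ q ∈ U, IsProperDivisor q n := by
  constructor
  · rintro ⟨h1, h2⟩ q hq
    exact ⟨(Finset.dvd_prod_of_mem _ hq).trans h1,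
      h2.coprime_dvd_left (Finset.dvd_prod_of_mem _ hq)⟩
  · intro h
    refine ⟨Finset.prod_primes_dvd _ (fun q hq => (hU q hq).prime) fun q hq => (h q hq).1,
      Nat.Coprime.prod_left fun q hq => (h q hq).2⟩

lemma sum_choose_newCount {T : Finset ℕ} (hT : ∀ q ∈ T, q.Prime) (N M P k : ℕ) :
    ∑ x ∈ properPairs N M P, (newCount T (x.1 * x.2)).choose k =
      ∑ U ∈ T.powersetCard k, divPairCount N M P (∏ q ∈ U, q) := by
  simp only [divPairCount, Finset.card_filter]
  rw [Finset.sum_comm]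
  refine Finset.sum_congr rfl fun x _ => ?_
  rw [newCount, ← Finset.card_powersetCard, ← Finset.card_filter]
  congr 1
  ext U
  simp only [Finset.mem_powersetCard, Finset.mem_filter]
  constructor
  · rintro ⟨h1, h2⟩
    refine ⟨⟨fun q hq => (Finset.mem_filter.1 (h1 hq)).1, h2⟩, ?_⟩
    exact (isProperDivisor_prod_iff (fun q hq => hT q (Finset.mem_filter.1 (h1 hq)).1) _).2
      fun q hq => (Finset.mem_filter.1 (h1 hq)).2
  · rintro ⟨⟨h1, h2⟩, h3⟩
    refine ⟨fun q hq => Finset.mem_filter.2 ⟨h1 hq, ?_⟩, h2⟩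
    exact (isProperDivisor_prod_iff (fun q hq => hT q (h1 hq)) _).1 h3 q hq

lemma primeFactors_prod_id {U : Finset ℕ} (hU : ∀ q ∈ U, q.Prime) :
    (∏ q ∈ U, q).primeFactors = U :=
  Nat.primeFactors_prod hU

lemma sum_powerset_filter_le {z y D K : ℕ} (hy : 0 < y) (hyD : y ^ K ≤ D) {g : ℕ → ℝ}
    (hg : ∀ d, 0 ≤ g d) :
    ∑ U ∈ (primesIoc z y).powerset.filter (fun U => U.card ≤ K), g (∏ q ∈ U, q) ≤
      ∑ d ∈ roughSet z D, g d := by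
  have hpr : ∀ U ∈ (primesIoc z y).powerset.filter (fun U => U.card ≤ K), ∀ q ∈ U,
      (z < q ∧ q ≤ y) ∧ q.Prime := fun U hU q hq =>
    mem_primesIoc.1 (Finset.mem_powerset.1 (Finset.mem_filter.1 hU).1 hq)
  rw [← Finset.sum_image (f := g) (g := fun U : Finset ℕ => ∏ q ∈ U, q)]
  · refine Finset.sum_le_sum_of_subset_of_nonneg (fun d hd => ?_) fun _ _ _ => hg _
    obtain ⟨U, hU, rfl⟩ := Finset.mem_image.1 hd
    refine mem_roughSet.2 ⟨⟨Finset.prod_pos fun q hq => (hpr U hU q hq).2.pos, ?_⟩, fun q hq => ?_⟩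
    · calc ∏ q ∈ U, q ≤ y ^ U.card := Finset.prod_le_pow_card _ _ _ fun q hq => (hpr U hU q hq).1.2
        _ ≤ y ^ K := Nat.pow_le_pow_right hy (Finset.mem_filter.1 hU).2
        _ ≤ D := hyD
    · rw [primeFactors_prod_id fun q hq => (hpr U hU q hq).2] at hq
      exact (hpr U hU q hq).1.1
  · intro U hU U' hU' (h : ∏ q ∈ U, q = ∏ q ∈ U', q)
    rw [← primeFactors_prod_id fun q hq => (hpr U hU q hq).2, h,
      primeFactors_prod_id fun q hq => (hpr U' hU' q hq).2]

lemma sum_range_powersetCard {E : Type*} [AddCommMonoid E] (T : Finset ℕ) (K : ℕ)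
    (g : Finset ℕ → E) :
    ∑ k ∈ Finset.range K, ∑ U ∈ T.powersetCard k, g U =
      ∑ U ∈ T.powerset.filter (fun U => U.card < K), g U := by
  rw [← Finset.sum_fiberwise_of_maps_to (s := T.powerset.filter fun U => U.card < K)
    (t := Finset.range K) (g := Finset.card) (fun U hU => by
      simpa using (Finset.mem_filter.1 hU).2)]
  refine Finset.sum_congr rfl fun k hk => Finset.sum_congr ?_ fun _ _ => rfl
  ext U
  have := Finset.mem_range.1 hk
  simp only [Finset.mem_powersetCard, Finset.mem_filter, Finset.mem_powerset]
  constructor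
  · rintro ⟨h1, h2⟩
    exact ⟨⟨h1, by omega⟩, h2⟩
  · rintro ⟨⟨h1, h2⟩, h3⟩
    exact ⟨h1, h3⟩

lemma sum_tail_le (z y K : ℕ) :
    ∑ U ∈ (primesIoc z y).powerset.filter (fun U => ¬ U.card < K), ∏ q ∈ U, (1 : ℝ) / q ≤
      (1 / 2) ^ K * Real.exp (2 * recipSum z y) := by
  calc _ ≤ ∑ U ∈ (primesIoc z y).powerset.filter (fun U => ¬ U.card < K),
        (1 / 2) ^ K * ∏ q ∈ U, (2 : ℝ) / q := by
        refine Finset.sum_le_sum fun U hU => ?_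
        have h1 := not_lt.1 (Finset.mem_filter.1 hU).2
        have h2 : ∏ q ∈ U, (2 : ℝ) / q = 2 ^ U.card * ∏ q ∈ U, (1 : ℝ) / q := by
          rw [← Finset.prod_const, ← Finset.prod_mul_distrib]
          exact Finset.prod_congr rfl fun q _ => by ring
        rw [h2, ← mul_assoc]
        have h3 : (0 : ℝ) ≤ ∏ q ∈ U, (1 : ℝ) / q := Finset.prod_nonneg fun _ _ => by positivity
        refine le_mul_of_one_le_left h3 ?_
        rw [one_div, inv_pow, inv_mul_eq_div, one_le_div (by positivity)]
        exact pow_le_pow_right₀ one_le_two h1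
    _ ≤ ∑ U ∈ (primesIoc z y).powerset, (1 / 2) ^ K * ∏ q ∈ U, (2 : ℝ) / q :=
        Finset.sum_le_sum_of_subset_of_nonneg (Finset.filter_subset _ _) fun U _ _ => by positivity
    _ = (1 / 2) ^ K * ∏ q ∈ primesIoc z y, (1 + (2 : ℝ) / q) := by
        rw [Finset.prod_one_add, Finset.mul_sum]
    _ ≤ (1 / 2) ^ K * ∏ q ∈ primesIoc z y, Real.exp (2 / q) := by
        gcongr with q
        rw [add_comm]
        exact Real.add_one_le_exp _
    _ = _ := by
        rw [← Real.exp_sum, recipSum, Finset.mul_sum]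
        simp only [mul_one_div]

/-- The generating function of `newCount` over pairs is close to that of a sum of independent
Bernoulli variables. -/
lemma norm_sum_properPairs_sub_le {N M P D z y K : ℕ} (hM : 0 < M) (hz : 0 < z) (hD : 0 < D)
    (hDP : D ≤ P) (hDM : D ≤ M) (hy : 0 < y) (hyD : y ^ K ≤ D) {w : ℂ} (hw : ‖1 + w‖ ≤ 1)
    (hw1 : ‖w‖ ≤ 1) :
    ‖∑ x ∈ properPairs N M P, (1 + w) ^ newCount (primesIoc z y) (x.1 * x.2) -
        (primePairs N M P).card * ∏ q ∈ primesIoc z y, (1 + w / q)‖ ≤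
      N * (dispErr M P D z + badErr N M P D z + D / M) +
        (primePairs N M P).card * (2 * ((1 / 2) ^ K * Real.exp (2 * recipSum z y))) := by
  set T := primesIoc z y with hTdef
  set V : ℝ := ((primePairs N M P).card : ℝ) with hV
  have hT : ∀ q ∈ T, q.Prime := fun q hq => (mem_primesIoc.1 hq).2
  set c : Finset ℕ → ℝ := fun U => divPairCount N M P (∏ q ∈ U, q) with hc
  set e : Finset ℕ → ℝ := fun U => ∏ q ∈ U, (1 : ℝ) / q with he
  have he0 : ∀ U, 0 ≤ e U := fun U => Finset.prod_nonneg fun _ _ => by positivity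
  set A := T.powerset.filter (fun U => U.card < K) with hA
  set B := T.powerset.filter (fun U => ¬ U.card < K) with hB
  have hBC : T.powersetCard K ⊆ B := fun U hU => by
    rw [Finset.mem_powersetCard] at hU
    exact Finset.mem_filter.2 ⟨Finset.mem_powerset.2 hU.1, hU.2.not_lt⟩
  have htail : ∑ U ∈ B, e U ≤ (1 / 2) ^ K * Real.exp (2 * recipSum z y) := sum_tail_le z y K
  have hprod : ∏ q ∈ T, (1 + w / q) = ∑ U ∈ A, w ^ U.card * (e U : ℂ) +
      ∑ U ∈ B, w ^ U.card * (e U : ℂ) := by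
    rw [Finset.sum_filter_add_sum_filter_not, Finset.prod_one_add]
    refine Finset.sum_congr rfl fun U _ => ?_
    rw [he, ← Finset.prod_const, Complex.ofReal_prod, ← Finset.prod_mul_distrib]
    refine Finset.prod_congr rfl fun q _ => ?_
    push_cast
    ring
  have herr : ∑ U ∈ A, |c U - V * e U| + ∑ U ∈ T.powersetCard K, |c U - V * e U| ≤
      N * (dispErr M P D z + badErr N M P D z + D / M) := by
    refine le_trans ?_ (sum_abs_divPairCount_sub_le (N := N) hM hz hD hDP hDM)
    refine le_trans ?_ (sum_powerset_filter_le (z := z) (y := y) (K := K) hy hyD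
      (g := fun d => |(divPairCount N M P d : ℝ) - (primePairs N M P).card / d|)
      fun _ => abs_nonneg _)
    have hdisj : Disjoint A (T.powersetCard K) :=
      Finset.disjoint_of_subset_right hBC (Finset.disjoint_filter_filter_not _ _ _)
    rw [← Finset.sum_union hdisj]
    refine le_of_eq_of_le (Finset.sum_congr rfl fun U _ => ?_)
      (Finset.sum_le_sum_of_subset_of_nonneg ?_ fun _ _ _ => abs_nonneg _)
    · rw [he, hc]
      simp only [Finset.prod_div_distrib, Finset.prod_const_one, Nat.cast_prod, mul_one_div, hV]
    · intro U hU
      rcases Finset.mem_union.1 hU with h | h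
      · exact Finset.mem_filter.2 ⟨(Finset.mem_filter.1 h).1, (Finset.mem_filter.1 h).2.le⟩
      · exact Finset.mem_filter.2 ⟨(Finset.mem_filter.1 (hBC h)).1,
          (Finset.mem_powersetCard.1 h).2.le⟩
  have hw' : ∀ (U : Finset ℕ) (t : ℝ), ‖w ^ U.card * (t : ℂ)‖ ≤ |t| := fun U t => by
    rw [norm_mul, norm_pow, Complex.norm_real, Real.norm_eq_abs]
    exact mul_le_of_le_one_left (abs_nonneg _) (pow_le_one₀ (norm_nonneg _) hw1)
  have h1 : ‖∑ x ∈ properPairs N M P, (1 + w) ^ newCount T (x.1 * x.2) -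
      ∑ U ∈ A, w ^ U.card * (c U : ℂ)‖ ≤ ∑ U ∈ T.powersetCard K, c U := by
    have hs : ∑ U ∈ A, w ^ U.card * (c U : ℂ) = ∑ x ∈ properPairs N M P,
        ∑ k ∈ Finset.range K, ((newCount T (x.1 * x.2)).choose k : ℂ) * w ^ k := by
      rw [hA, ← sum_range_powersetCard, Finset.sum_comm]
      refine Finset.sum_congr rfl fun k _ => ?_
      rw [← Finset.sum_mul, ← Nat.cast_sum, sum_choose_newCount hT, Nat.cast_sum, Finset.sum_mul]
      refine Finset.sum_congr rfl fun U hU => ?_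
      rw [(Finset.mem_powersetCard.1 hU).2, hc]
      push_cast
      ring
    rw [hs, ← Finset.sum_sub_distrib]
    refine (norm_sum_le_of_le _ fun x _ => norm_one_add_pow_sub_sum_le hw _ K).trans ?_
    have := sum_choose_newCount hT N M P K
    rw [hc, ← Nat.cast_sum, ← this, Nat.cast_sum]
    refine Finset.sum_le_sum fun x _ => ?_
    exact mul_le_of_le_one_right (Nat.cast_nonneg _) (pow_le_one₀ (norm_nonneg _) hw1)
  have h2 : ‖∑ U ∈ A, w ^ U.card * (c U : ℂ) - V * ∑ U ∈ A, w ^ U.card * (e U : ℂ)‖ ≤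
      ∑ U ∈ A, |c U - V * e U| := by
    rw [Finset.mul_sum, ← Finset.sum_sub_distrib]
    refine norm_sum_le_of_le _ fun U _ => ?_
    have : w ^ U.card * (c U : ℂ) - V * (w ^ U.card * (e U : ℂ)) =
        w ^ U.card * ((c U - V * e U : ℝ) : ℂ) := by
      push_cast
      ring
    rw [this]
    exact hw' _ _
  have hV0 : 0 ≤ V := Nat.cast_nonneg _
  have h3 : ‖(V : ℂ) * ∑ U ∈ B, w ^ U.card * (e U : ℂ)‖ ≤ V * ∑ U ∈ B, e U := by
    rw [norm_mul, Complex.norm_real, Real.norm_eq_abs, abs_of_nonneg hV0]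
    refine mul_le_mul_of_nonneg_left (norm_sum_le_of_le _ fun U _ => ?_) hV0
    exact (hw' _ _).trans (le_of_eq (abs_of_nonneg (he0 U)))
  have h4 : ∑ U ∈ T.powersetCard K, c U ≤
      ∑ U ∈ T.powersetCard K, |c U - V * e U| + V * ∑ U ∈ B, e U := by
    calc _ ≤ ∑ U ∈ T.powersetCard K, (|c U - V * e U| + V * e U) :=
          Finset.sum_le_sum fun U _ => by linarith [le_abs_self (c U - V * e U)]
      _ = ∑ U ∈ T.powersetCard K, |c U - V * e U| + V * ∑ U ∈ T.powersetCard K, e U := by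
          rw [Finset.sum_add_distrib, Finset.mul_sum]
      _ ≤ _ := by
          gcongr
  have hcast : ((primePairs N M P).card : ℂ) = (V : ℂ) := by simp [hV]
  have hsplit : ∑ x ∈ properPairs N M P, (1 + w) ^ newCount T (x.1 * x.2) -
      (primePairs N M P).card * ∏ q ∈ T, (1 + w / q) =
      (∑ x ∈ properPairs N M P, (1 + w) ^ newCount T (x.1 * x.2) -
        ∑ U ∈ A, w ^ U.card * (c U : ℂ)) +
      (∑ U ∈ A, w ^ U.card * (c U : ℂ) - V * ∑ U ∈ A, w ^ U.card * (e U : ℂ)) -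
      V * ∑ U ∈ B, w ^ U.card * (e U : ℂ) := by
    rw [hprod, hcast]
    ring
  rw [hsplit]
  refine (norm_sub_le _ _).trans ?_
  have h5 := mul_le_mul_of_nonneg_left htail hV0
  have h6 := norm_add_le (∑ x ∈ properPairs N M P, (1 + w) ^ newCount T (x.1 * x.2) -
    ∑ U ∈ A, w ^ U.card * (c U : ℂ))
    (∑ U ∈ A, w ^ U.card * (c U : ℂ) - V * ∑ U ∈ A, w ^ U.card * (e U : ℂ))
  linarith

lemma norm_prod_one_add_div_le {T : Finset ℕ} (hT : ∀ q ∈ T, q.Prime) {w : ℂ}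
    (hw : ‖1 + w‖ ≤ 1) : ‖∏ q ∈ T, (1 + w / q)‖ ≤ 1 := by
  rw [norm_prod]
  refine Finset.prod_le_one (fun _ _ => norm_nonneg _) fun q hq => ?_
  have hq1 : (1 : ℝ) ≤ q := by exact_mod_cast (hT q hq).one_le
  have hq0 : (0 : ℝ) < q := by linarith
  have h : 1 + w / q = ((1 - 1 / q : ℝ) : ℂ) + ((1 / q : ℝ) : ℂ) * (1 + w) := by
    push_cast
    ring
  have h1 : (1 : ℝ) / q ≤ 1 := (div_le_one hq0).2 hq1
  rw [h]
  refine (norm_add_le _ _).trans ?_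
  rw [norm_mul, Complex.norm_real, Complex.norm_real, Real.norm_eq_abs, Real.norm_eq_abs,
    abs_of_nonneg (by linarith), abs_of_nonneg (by positivity)]
  have := mul_le_mul_of_nonneg_left hw (by positivity : (0 : ℝ) ≤ 1 / q)
  linarith

/-- The generating function of `newCount` over integers up to `N`. -/
lemma norm_sum_newCount_sub_le {N M P D z y K : ℕ} (hM : 0 < M) (hz : 0 < z) (hD : 0 < D)
    (hDP : D ≤ P) (hDM : D ≤ M) (hy : 0 < y) (hyD : y ^ K ≤ D) (hP : 2 * P ≤ N)
    {w : ℂ} (hw : ‖1 + w‖ ≤ 1) (hw1 : ‖w‖ ≤ 1) :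
    recipSum M P * ‖∑ n ∈ Finset.Ioc 0 N, (1 + w) ^ newCount (primesIoc z y) n -
        N * ∏ q ∈ primesIoc z y, (1 + w / q)‖ ≤
      N * (2 * pairErr M P + 1 / M + dispErr M P D z + badErr N M P D z + D / M) +
        N * recipSum M P * (2 * ((1 / 2) ^ K * Real.exp (2 * recipSum z y))) := by
  set T := primesIoc z y with hTdef
  have hT : ∀ q ∈ T, q.Prime := fun q hq => (mem_primesIoc.1 hq).2
  set lam := recipSum M P with hlam
  have hlam0 : 0 ≤ lam := recipSum_nonneg _ _
  set g : ℕ → ℂ := fun n => (1 + w) ^ newCount T n with hgdef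
  have hg : ∀ n, ‖g n‖ ≤ 1 := fun n => by
    rw [hgdef, norm_pow]
    exact pow_le_one₀ (norm_nonneg _) hw
  set Q := ∏ q ∈ T, (1 + w / q) with hQ
  have hQ1 : ‖Q‖ ≤ 1 := norm_prod_one_add_div_le hT hw
  have h1 := norm_recipSum_smul_sum_sub_le hM hP hg
  have h2 := norm_recipSum_smul_sum_sub_le (g := fun _ => (1 : ℂ)) hM hP fun _ => by simp
  have h3 := norm_sum_properPairs_sub_le (N := N) hM hz hD hDP hDM hy hyD hw hw1
  rw [← hTdef] at h3
  change _ ≤ N * pairErr M P at h1 h2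
  have h4 : ‖∑ x ∈ primePairs N M P, g (x.1 * x.2) -
      ∑ x ∈ properPairs N M P, g (x.1 * x.2)‖ ≤ N / M := by
    rw [properPairs, ← Finset.sum_filter_add_sum_filter_not (primePairs N M P)
      (fun x => x.1 ∣ x.2), add_sub_cancel_right]
    refine (norm_sum_le_of_le _ fun x _ => hg _).trans ?_
    refine le_trans (le_of_eq ?_) (card_primePairs_dvd_le (N := N) (P := P) hM)
    simp
  have h5 : ‖(((primePairs N M P).card : ℂ) - lam * N) * Q‖ ≤ N * pairErr M P := by
    rw [norm_mul]
    refine (mul_le_of_le_one_right (norm_nonneg _) hQ1).trans ?_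
    rw [norm_sub_rev]
    refine le_of_eq_of_le ?_ h2
    simp [hlam]
  have hsplit : (lam : ℂ) * (∑ n ∈ Finset.Ioc 0 N, g n - N * Q) =
      (lam • ∑ n ∈ Finset.Ioc 0 N, g n - ∑ x ∈ primePairs N M P, g (x.1 * x.2)) +
      (∑ x ∈ primePairs N M P, g (x.1 * x.2) - ∑ x ∈ properPairs N M P, g (x.1 * x.2)) +
      (∑ x ∈ properPairs N M P, g (x.1 * x.2) - (primePairs N M P).card * Q) +
      (((primePairs N M P).card : ℂ) - lam * N) * Q := by
    rw [Complex.real_smul]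
    ring
  have h6 : lam * ‖∑ n ∈ Finset.Ioc 0 N, g n - N * Q‖ =
      ‖(lam : ℂ) * (∑ n ∈ Finset.Ioc 0 N, g n - N * Q)‖ := by
    rw [norm_mul, Complex.norm_real, Real.norm_eq_abs, abs_of_nonneg hlam0]
  rw [h6, hsplit]
  have h7 := mul_le_mul_of_nonneg_right (card_primePairs_le N M P)
    (by positivity : 0 ≤ 2 * ((1 / 2 : ℝ) ^ K * Real.exp (2 * recipSum z y)))
  refine (norm_add₄_le).trans ?_
  have e : (N : ℝ) * (2 * pairErr M P + 1 / M + dispErr M P D z + badErr N M P D z + D / M) =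
      N * pairErr M P + N / M + N * (dispErr M P D z + badErr N M P D z + D / M) +
      N * pairErr M P := by ring
  rw [e]
  linarith

lemma norm_prod_sub_prod_le {ι : Type*} (s : Finset ι) (f g : ι → ℂ) (hf : ∀ i ∈ s, ‖f i‖ ≤ 1)
    (hg : ∀ i ∈ s, ‖g i‖ ≤ 1) : ‖∏ i ∈ s, f i - ∏ i ∈ s, g i‖ ≤ ∑ i ∈ s, ‖f i - g i‖ := by
  classical
  induction s using Finset.induction_on with
  | empty => simp
  | insert a s ha ih =>
    rw [Finset.prod_insert ha, Finset.prod_insert ha, Finset.sum_insert ha]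
    have h1 : f a * ∏ i ∈ s, f i - g a * ∏ i ∈ s, g i =
        (f a - g a) * ∏ i ∈ s, f i + g a * (∏ i ∈ s, f i - ∏ i ∈ s, g i) := by ring
    rw [h1]
    refine (norm_add_le _ _).trans (add_le_add ?_ ?_)
    · rw [norm_mul, norm_prod]
      exact mul_le_of_le_one_right (norm_nonneg _) (Finset.prod_le_one
        (fun _ _ => norm_nonneg _) fun i hi => hf i (Finset.mem_insert_of_mem hi))
    · rw [norm_mul]
      refine (mul_le_of_le_one_left (norm_nonneg _) (hg a (Finset.mem_insert_self _ _))).trans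
        (ih (fun i hi => hf i (Finset.mem_insert_of_mem hi))
          fun i hi => hg i (Finset.mem_insert_of_mem hi))

lemma norm_exp_mul_I_sub_one_le (t : ℝ) : ‖Complex.exp (t * Complex.I) - 1‖ ≤ |t| := by
  have := Real.norm_exp_I_mul_ofReal_sub_one_le (x := t)
  rwa [mul_comm, Real.norm_eq_abs] at this

lemma norm_prod_one_add_sub_exp_le {z y : ℕ} (hz : 0 < z) {t : ℝ} (ht : |t| ≤ 1) :
    ‖∏ q ∈ primesIoc z y, (1 + (Complex.exp (t * Complex.I) - 1) / q) -
      Complex.exp ((Complex.exp (t * Complex.I) - 1) * recipSum z y)‖ ≤ t ^ 2 := by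
  set w := Complex.exp (t * Complex.I) - 1 with hw
  have hw1 : ‖w‖ ≤ |t| := norm_exp_mul_I_sub_one_le t
  have hw2 : ‖1 + w‖ ≤ 1 := by
    rw [hw, add_sub_cancel, Complex.norm_exp_ofReal_mul_I]
  have hpr : ∀ q ∈ primesIoc z y, 1 ≤ (q : ℝ) := fun q hq => by
    exact_mod_cast (mem_primesIoc.1 hq).2.one_le
  have hre : w.re ≤ 0 := by
    rw [hw, Complex.sub_re, Complex.exp_ofReal_mul_I_re, Complex.one_re]
    linarith [Real.cos_le_one t]
  have h1 : Complex.exp (w * recipSum z y) = ∏ q ∈ primesIoc z y, Complex.exp (w / q) := by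
    rw [← Complex.exp_sum, recipSum]
    push_cast
    rw [Finset.mul_sum]
    simp only [mul_one_div]
  rw [h1]
  refine (norm_prod_sub_prod_le _ _ _ (fun q hq => ?_) fun q hq => ?_).trans ?_
  · have := norm_prod_one_add_div_le (T := {q}) (fun p hp => by
      rw [Finset.mem_singleton.1 hp]
      exact (mem_primesIoc.1 hq).2) hw2
    simpa using this
  · rw [Complex.norm_exp, Complex.div_natCast_re]
    exact Real.exp_le_one_iff.2 (div_nonpos_of_nonpos_of_nonneg hre (Nat.cast_nonneg _))
  · have h2 : ∀ q ∈ primesIoc z y, ‖(1 + w / q) - Complex.exp (w / q)‖ ≤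
        t ^ 2 * (1 / (q : ℝ) ^ 2) := fun q hq => by
      have hq1 := hpr q hq
      have h3 : ‖w / q‖ ≤ |t| / q := by
        rw [norm_div, Complex.norm_natCast]
        gcongr
      have h4 : |t| / q ≤ 1 := (div_le_one (by linarith)).2 (by linarith)
      have h5 := Complex.norm_exp_sub_one_sub_id_le (h3.trans h4)
      rw [norm_sub_rev, show Complex.exp (w / q) - (1 + w / q) =
        Complex.exp (w / q) - 1 - w / q by ring]
      refine h5.trans ((pow_le_pow_left₀ (norm_nonneg _) h3 2).trans (le_of_eq ?_))
      rw [div_pow, sq_abs, mul_one_div]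
    refine (Finset.sum_le_sum h2).trans ?_
    rw [← Finset.mul_sum]
    refine mul_le_of_le_one_right (sq_nonneg _) ?_
    have h6 : ∑ q ∈ primesIoc z y, 1 / (q : ℝ) ^ 2 ≤ ∑ q ∈ Finset.Ioc z y, 1 / (q : ℝ) ^ 2 :=
      Finset.sum_le_sum_of_subset_of_nonneg (Finset.filter_subset _ _) fun _ _ _ => by positivity
    refine h6.trans ((sum_inv_sq_Ioc_le hz).trans ?_)
    rw [div_le_one (by exact_mod_cast hz)]
    exact_mod_cast hz

lemma tendsto_exp_mul_sub {ι : Type*} {l : Filter ι} {L Λ : ι → ℝ} (θ : ℝ)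
    (hL : Tendsto L l atTop) (hΛ : Tendsto (fun i => (Λ i - L i) / √(L i)) l (nhds 0)) :
    Tendsto (fun i => Complex.exp ((Complex.exp ((θ / √(L i) : ℝ) * Complex.I) - 1) * Λ i -
      (θ * √(L i) : ℝ) * Complex.I)) l (nhds (Complex.exp (-θ ^ 2 / 2))) := by
  refine (Complex.continuous_exp.tendsto _).comp ?_
  have hs : Tendsto (fun i => √(L i)) l atTop := Real.tendsto_sqrt_atTop.comp hL
  have ht : Tendsto (fun i => θ / √(L i)) l (nhds 0) := tendsto_const_nhds.div_atTop hs
  have hLL : Tendsto (fun i => Λ i / L i) l (nhds 1) := by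
    have h := (hΛ.div_atTop hs).add_const 1
    rw [zero_add] at h
    refine h.congr' ?_
    filter_upwards [hL.eventually_gt_atTop 0] with i hi
    rw [div_div, Real.mul_self_sqrt hi.le]
    field_simp
    ring
  rw [tendsto_iff_norm_sub_tendsto_zero]
  have hbound : Tendsto (fun i => |θ| * |(Λ i - L i) / √(L i)| +
      |θ / √(L i)| * (θ ^ 2 * |Λ i / L i|) + θ ^ 2 / 2 * |1 - Λ i / L i|) l (nhds 0) := by
    have h1 := (hΛ.abs.const_mul |θ|)
    have h2 := ht.abs.mul (hLL.abs.const_mul (θ ^ 2))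
    have h3 := ((hLL.const_sub 1).abs).const_mul (θ ^ 2 / 2)
    simpa using (h1.add h2).add h3
  refine squeeze_zero' (Eventually.of_forall fun i => norm_nonneg _) ?_ hbound
  filter_upwards [hL.eventually_gt_atTop 0, ht.abs.eventually_le_const (u := 1) (by simp)]
    with i hi hti
  have hs0 : 0 < √(L i) := Real.sqrt_pos.2 hi
  have hss : √(L i) * √(L i) = L i := Real.mul_self_sqrt hi.le
  set s := √(L i)
  set t := θ / s with htdef
  set x : ℂ := (t : ℂ) * Complex.I with hx
  have hxn : ‖x‖ = |t| := by simp [hx]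
  have h3 := Complex.exp_bound (x := x) (by rw [hxn]; exact hti) (n := 3) (by norm_num)
  have h4 : ‖Complex.exp x - 1 - x - x ^ 2 / 2‖ ≤ |t| ^ 3 := by
    have e : Complex.exp x - 1 - x - x ^ 2 / 2 =
        Complex.exp x - ∑ m ∈ Finset.range 3, x ^ m / (m.factorial : ℂ) := by
      simp [Finset.sum_range_succ, Nat.factorial]
      ring
    rw [e, ← hxn]
    refine h3.trans (mul_le_of_le_one_right (by positivity) ?_)
    norm_num [Nat.factorial]
  have hx2 : x ^ 2 = -(t ^ 2 : ℝ) := by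
    rw [hx, mul_pow, Complex.I_sq]
    push_cast
    ring
  have hts : t * s = θ := div_mul_cancel₀ _ hs0.ne'
  have hL2 : t ^ 2 * L i = θ ^ 2 := by
    rw [← hss, ← hts]
    ring
  have key : (Complex.exp x - 1) * Λ i - (θ * s : ℝ) * Complex.I - (-θ ^ 2 / 2) =
      (Complex.exp x - 1 - x - x ^ 2 / 2) * Λ i + ((t * (Λ i - L i) : ℝ) : ℂ) * Complex.I +
        ((θ ^ 2 / 2 * (1 - Λ i / L i) : ℝ) : ℂ) := by
    have e1 : θ ^ 2 / 2 * (1 - Λ i / L i) = θ ^ 2 / 2 - t ^ 2 * Λ i / 2 := by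
      rw [← hL2]
      field_simp
    have e2 : θ * s = t * L i := by
      rw [← hts, ← hss]
      ring
    rw [e1, e2, hx2, hx]
    push_cast
    ring
  rw [key]
  refine (norm_add₃_le).trans ?_
  rw [norm_mul, norm_mul, Complex.norm_real, Complex.norm_real, Complex.norm_real,
    Complex.norm_I, mul_one, Real.norm_eq_abs, Real.norm_eq_abs, Real.norm_eq_abs]
  have h5 : |t * (Λ i - L i)| = |θ| * |(Λ i - L i) / s| := by
    rw [← abs_mul, htdef]
    congr 1
    ring
  have h6 : |t| ^ 3 * |Λ i| = |t| * (θ ^ 2 * |Λ i / L i|) := by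
    rw [abs_div (Λ i), abs_of_pos hi, ← hL2, pow_succ' _ 2, sq_abs]
    field_simp
  have h7 : |θ ^ 2 / 2 * (1 - Λ i / L i)| = θ ^ 2 / 2 * |1 - Λ i / L i| := by
    rw [abs_mul, abs_of_nonneg (by positivity)]
  rw [h5, h7]
  have h8 := mul_le_mul_of_nonneg_right h4 (abs_nonneg (Λ i))
  linarith

/-- The characteristic functions of normalised sums of independent Bernoulli variables converge
to that of the standard Gaussian. -/
lemma tendsto_prod_one_add_mul_exp {ι : Type*} {l : Filter ι} {L : ι → ℝ} {z y : ι → ℕ} (θ : ℝ)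
    (hz : ∀ᶠ i in l, 0 < z i) (hL : Tendsto L l atTop)
    (hΛ : Tendsto (fun i => (recipSum (z i) (y i) - L i) / √(L i)) l (nhds 0)) :
    Tendsto (fun i => Complex.exp (-(θ * √(L i) : ℝ) * Complex.I) *
      ∏ q ∈ primesIoc (z i) (y i), (1 + (Complex.exp ((θ / √(L i) : ℝ) * Complex.I) - 1) / q))
      l (nhds (Complex.exp (-θ ^ 2 / 2))) := by
  have h1 := tendsto_exp_mul_sub θ hL hΛ
  have hs : Tendsto (fun i => √(L i)) l atTop := Real.tendsto_sqrt_atTop.comp hL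
  have ht : Tendsto (fun i => θ / √(L i)) l (nhds 0) := tendsto_const_nhds.div_atTop hs
  refine (tendsto_iff_of_dist ?_).1 h1
  refine squeeze_zero' (Eventually.of_forall fun i => dist_nonneg) ?_
    (show Tendsto (fun i => (θ / √(L i)) ^ 2) l (nhds 0) by simpa using ht.pow 2)
  filter_upwards [hz, ht.abs.eventually_le_const (u := 1) (by simp)] with i hi hti
  have h2 := norm_prod_one_add_sub_exp_le (y := y i) hi hti
  rw [dist_comm, dist_eq_norm]
  have e : ∀ a b : ℂ, Complex.exp (a - b * Complex.I) =
      Complex.exp (-b * Complex.I) * Complex.exp a := fun a b => by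
    rw [← Complex.exp_add]
    congr 1
    ring
  rw [e, ← mul_sub, norm_mul, ← Complex.ofReal_neg, Complex.norm_exp_ofReal_mul_I, one_mul]
  exact h2

section Scale

/-- The integer part of `exp α`. -/
noncomputable def expFloor (α : ℝ) : ℕ := ⌊Real.exp α⌋₊

lemma expFloor_le (α : ℝ) : (expFloor α : ℝ) ≤ Real.exp α := Nat.floor_le (Real.exp_pos _).le

lemma exp_lt_expFloor_add_one (α : ℝ) : Real.exp α < expFloor α + 1 := Nat.lt_floor_add_one _

lemma expFloor_pos {α : ℝ} (h : 0 ≤ α) : 0 < expFloor α :=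
  Nat.floor_pos.2 (Real.one_le_exp h)

lemma expFloor_mono {α β : ℝ} (h : α ≤ β) : expFloor α ≤ expFloor β :=
  Nat.floor_le_floor (Real.exp_le_exp.2 h)

lemma exp_half_le_expFloor {α : ℝ} (h : 0 ≤ α) : Real.exp α / 2 ≤ expFloor α := by
  have h1 : (1 : ℝ) ≤ expFloor α := by exact_mod_cast expFloor_pos h
  linarith [exp_lt_expFloor_add_one α]

lemma log_expFloor_le {α : ℝ} (h : 0 ≤ α) : Real.log (expFloor α) ≤ α := by
  rw [Real.log_le_iff_le_exp (by exact_mod_cast expFloor_pos h)]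
  exact expFloor_le α

lemma sub_log_two_le_log_expFloor {α : ℝ} (h : 0 ≤ α) :
    α - Real.log 2 ≤ Real.log (expFloor α) := by
  rw [Real.le_log_iff_exp_le (by exact_mod_cast expFloor_pos h), Real.exp_sub,
    Real.exp_log two_pos]
  exact exp_half_le_expFloor h

lemma abs_log_log_expFloor_sub_le {α : ℝ} (h : 1 ≤ α) :
    |Real.log (Real.log (expFloor α)) - Real.log α| ≤ Real.log 4 := by
  have h0 : 0 < α := by linarith
  have h1 := log_expFloor_le h0.le
  have h2 := sub_log_two_le_log_expFloor h0.le
  have h3 : α / 4 ≤ Real.log (expFloor α) := by linarith [Real.log_two_lt_d9]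
  have h4 : 0 < α / 4 := by positivity
  have h5 := Real.log_le_log h4 h3
  have h6 := Real.log_le_log (h4.trans_le h3) h1
  rw [Real.log_div h0.ne' (by norm_num)] at h5
  have h7 : 0 ≤ Real.log 4 := Real.log_nonneg (by norm_num)
  rw [abs_le]
  constructor <;> linarith

lemma recipSum_eq_sub {M P : ℕ} (h : M ≤ P) :
    recipSum M P = recipSum 0 P - recipSum 0 M := by
  have : primesIoc 0 P = primesIoc 0 M ∪ primesIoc M P := by
    ext q
    simp only [Finset.mem_union, mem_primesIoc]
    constructor
    · rintro ⟨h1, h2⟩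
      rcases le_or_gt q M with h3 | h3
      · exact Or.inl ⟨⟨h1.1, h3⟩, h2⟩
      · exact Or.inr ⟨⟨h3, h1.2⟩, h2⟩
    · rintro (⟨h1, h2⟩ | ⟨h1, h2⟩)
      · exact ⟨⟨h1.1, h1.2.trans h⟩, h2⟩
      · exact ⟨⟨h2.pos, h1.2⟩, h2⟩
  have hd : Disjoint (primesIoc 0 M) (primesIoc M P) := by
    rw [Finset.disjoint_left]
    intro q h1 h2
    rw [mem_primesIoc] at h1 h2
    omega
  rw [recipSum, recipSum, recipSum, this, Finset.sum_union hd]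
  ring

/-- Mertens' second theorem for the primes in `(e^α, e^β]`. -/
lemma exists_abs_recipSum_expFloor_sub_le : ∃ C : ℝ, 0 ≤ C ∧ ∀ α β : ℝ, 1 ≤ α → α ≤ β →
    |recipSum (expFloor α) (expFloor β) - Real.log (β / α)| ≤ C := by
  obtain ⟨C, hC, h⟩ := exists_abs_sum_inv_sub_log_log_le
  refine ⟨2 * (C + Real.log 4), by
    have : 0 ≤ Real.log 4 := Real.log_nonneg (by norm_num)
    positivity, fun α β hα hαβ => ?_⟩
  have h2 : ∀ γ : ℝ, 1 ≤ γ → |recipSum 0 (expFloor γ) - Real.log γ| ≤ C + Real.log 4 := by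
    intro γ hγ
    have h3 : 2 ≤ expFloor γ := by
      refine Nat.le_floor ?_
      push_cast
      linarith [Real.add_one_le_exp γ]
    have h4 := h _ h3
    have h5 := abs_log_log_expFloor_sub_le hγ
    have := abs_add_le (recipSum 0 (expFloor γ) - Real.log (Real.log (expFloor γ)))
      (Real.log (Real.log (expFloor γ)) - Real.log γ)
    rw [sub_add_sub_cancel] at this
    exact this.trans (add_le_add h4 h5)
  rw [recipSum_eq_sub (expFloor_mono hαβ),
    Real.log_div (by linarith : β ≠ 0) (by linarith : α ≠ 0)]
  have h3 := abs_sub (recipSum 0 (expFloor β) - Real.log β)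
    (recipSum 0 (expFloor α) - Real.log α)
  have h4 : recipSum 0 (expFloor β) - recipSum 0 (expFloor α) - (Real.log β - Real.log α) =
      recipSum 0 (expFloor β) - Real.log β - (recipSum 0 (expFloor α) - Real.log α) := by ring
  rw [h4]
  linarith [h2 α hα, h2 β (hα.trans hαβ)]

variable {ι : Type*} {l : Filter ι} {a b c : ι → ℝ}

lemma tendsto_expFloor (ha : Tendsto a l atTop) :
    Tendsto (fun i => (expFloor (a i) : ℝ)) l atTop := by
  refine tendsto_atTop_mono' l ?_ ((Real.tendsto_exp_atTop.comp ha).atTop_div_const two_pos)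
  filter_upwards [ha.eventually_ge_atTop 0] with i hi
  exact exp_half_le_expFloor hi

lemma tendsto_dispErr (ha : Tendsto a l atTop) (hb0 : ∀ᶠ i in l, 0 ≤ b i)
    (hb : ∀ᶠ i in l, b i ≤ a i ^ 2) (hc : ∀ᶠ i in l, 16 * Real.log (a i) ≤ c i) :
    Tendsto (fun i => dispErr (expFloor (a i)) (expFloor (b i)) (expFloor (a i / 4))
      (expFloor (c i))) l (nhds 0) := by
  have h48 : Tendsto (fun i => 48 / a i) l (nhds 0) := tendsto_const_nhds.div_atTop ha
  have hexp : ∀ᶠ t : ℝ in atTop, t ^ 16 ≤ Real.exp (t / 2) := by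
    have h := (tendsto_id.atTop_div_const (two_pos : (0 : ℝ) < 2)).eventually
      ((Real.tendsto_exp_div_pow_atTop 16).eventually_ge_atTop ((2 : ℝ) ^ 16))
    filter_upwards [h, eventually_gt_atTop 0] with t ht ht0
    simp only [id] at ht
    rw [le_div_iff₀ (by positivity), ← mul_pow] at ht
    rwa [mul_div_cancel₀ _ two_ne_zero] at ht
  refine squeeze_zero' (Eventually.of_forall fun i => ?_) ?_ h48
  · rw [dispErr]
    have : 0 ≤ Real.log (expFloor (b i)) := Real.log_natCast_nonneg _
    positivity
  filter_upwards [hb0, hb, hc, ha.eventually_ge_atTop 1, ha.eventually hexp]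
    with i h1 h2 h3 h4 h5
  have h0 : 0 < a i := by linarith
  have hlog := log_expFloor_le h1
  have hlog0 : 0 ≤ Real.log (expFloor (b i)) := Real.log_natCast_nonneg _
  have hB : 1 + Real.log (expFloor (b i)) ≤ 2 * a i ^ 2 := by nlinarith
  have hM := exp_half_le_expFloor h0.le
  have hMpos : (0 : ℝ) < expFloor (a i) := by exact_mod_cast expFloor_pos h0.le
  have hD := expFloor_le (a i / 4)
  have hDM : (expFloor (a i / 4) : ℝ) ^ 2 / expFloor (a i) ≤ 2 / a i ^ 16 := by
    rw [div_le_div_iff₀ hMpos (by positivity)]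
    have e1 : Real.exp (a i / 4) ^ 2 = Real.exp (a i / 2) := by
      rw [← Real.exp_nat_mul]
      congr 1
      push_cast
      ring
    have e2 : Real.exp (a i) = Real.exp (a i / 2) * Real.exp (a i / 2) := by
      rw [← Real.exp_add, add_halves]
    have e3 : (expFloor (a i / 4) : ℝ) ^ 2 ≤ Real.exp (a i / 2) :=
      e1 ▸ pow_le_pow_left₀ (Nat.cast_nonneg _) hD 2
    have e4 := mul_le_mul e3 h5 (by positivity) (Real.exp_pos _).le
    linarith
  have hc16 : Real.exp (16 * Real.log (a i)) = a i ^ 16 := by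
    rw [mul_comm, Real.exp_mul, Real.exp_log h0]
    exact_mod_cast Real.rpow_natCast (a i) 16
  have hz : 1 / (expFloor (c i) : ℝ) ≤ 2 / a i ^ 16 := by
    have hc0 : 0 ≤ c i := le_trans (by have := Real.log_nonneg h4; positivity) h3
    have e1 := exp_half_le_expFloor hc0
    have e2 := Real.exp_le_exp.2 h3
    rw [hc16] at e2
    rw [div_le_div_iff₀ (by exact_mod_cast expFloor_pos hc0) (by positivity)]
    linarith
  have hsq : √(4 * (1 + Real.log (expFloor (b i))) ^ 3 *
      ((expFloor (a i / 4) : ℝ) ^ 2 / expFloor (a i) + 1 / expFloor (c i))) ≤ 12 / a i ^ 5 := by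
    rw [Real.sqrt_le_left (by positivity)]
    calc 4 * (1 + Real.log (expFloor (b i))) ^ 3 *
        ((expFloor (a i / 4) : ℝ) ^ 2 / expFloor (a i) + 1 / expFloor (c i))
        ≤ 4 * (2 * a i ^ 2) ^ 3 * (2 / a i ^ 16 + 2 / a i ^ 16) := by gcongr
      _ = 128 / a i ^ 10 := by
        field_simp
        norm_num
      _ ≤ 144 / a i ^ 10 := by gcongr; norm_num
      _ = (12 / a i ^ 5) ^ 2 := by
        field_simp
        norm_num
  rw [dispErr]
  calc _ ≤ 2 * (2 * a i ^ 2) * (12 / a i ^ 5) := by gcongr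
    _ = 48 / a i ^ 3 := by
      field_simp
      norm_num
    _ ≤ 48 / a i := by
      gcongr
      exact le_self_pow₀ h4 (by norm_num)

lemma tendsto_recipSum_expFloor (ha : Tendsto a l atTop)
    (hba : Tendsto (fun i => b i / a i) l atTop) :
    Tendsto (fun i => recipSum (expFloor (a i)) (expFloor (b i))) l atTop := by
  obtain ⟨C, -, h⟩ := exists_abs_recipSum_expFloor_sub_le
  refine tendsto_atTop_mono' l ?_ (tendsto_atTop_add_const_right l (-C)
    (Real.tendsto_log_atTop.comp hba))
  filter_upwards [ha.eventually_ge_atTop 1, hba.eventually_ge_atTop 1] with i h1 h2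
  rw [le_div_iff₀ (by linarith), one_mul] at h2
  have := (abs_le.1 (h _ _ h1 h2)).1
  simp only [Function.comp_apply]
  linarith

lemma tendsto_pairErr_div (ha : Tendsto a l atTop)
    (hba : Tendsto (fun i => b i / a i) l atTop) :
    Tendsto (fun i => pairErr (expFloor (a i)) (expFloor (b i)) /
      recipSum (expFloor (a i)) (expFloor (b i))) l (nhds 0) := by
  have hr := tendsto_recipSum_expFloor ha hba
  have h1 : Tendsto (fun i => 2 * √2 / √(recipSum (expFloor (a i)) (expFloor (b i))) +
      1 / recipSum (expFloor (a i)) (expFloor (b i)) + 1 / (expFloor (a i) : ℝ)) l (nhds 0) := by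
    have e1 := (tendsto_const_nhds (x := 2 * √2)).div_atTop (Real.tendsto_sqrt_atTop.comp hr)
    have e2 := (tendsto_const_nhds (x := (1 : ℝ))).div_atTop hr
    have e3 := (tendsto_const_nhds (x := (1 : ℝ))).div_atTop (tendsto_expFloor ha)
    simpa using (e1.add e2).add e3
  refine h1.congr' ?_
  filter_upwards [hr.eventually_gt_atTop 0] with i hi
  rw [pairErr, Real.sqrt_mul two_pos.le]
  have hs := Real.sqrt_pos.2 hi
  have hss := Real.mul_self_sqrt hi.le
  set s := √(recipSum (expFloor (a i)) (expFloor (b i)))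
  rw [← hss]
  field_simp

/-- If `h` grows faster than `log (a / c)` then almost all `n` are such that `s(n)` has fewer than
`h` prime factors in `(e^c, e^{a/4}]` not dividing `n`. -/
lemma tendsto_card_le_newCount_div {N : ι → ℕ} {h : ι → ℝ} (ha : Tendsto a l atTop)
    (hb : ∀ᶠ i in l, b i ≤ a i ^ 2) (hba : Tendsto (fun i => b i / a i) l atTop)
    (hc : ∀ᶠ i in l, 16 * Real.log (a i) ≤ c i) (hca : ∀ᶠ i in l, c i ≤ a i / 4)
    (hN : ∀ᶠ i in l, 2 * expFloor (b i) ≤ N i) (hh : Tendsto h l atTop)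
    (hlog : Tendsto (fun i => Real.log (a i / 4 / c i) / h i) l (nhds 0)) :
    Tendsto (fun i => (((Finset.Ioc 0 (N i)).filter fun n =>
      h i ≤ newCount (primesIoc (expFloor (c i)) (expFloor (a i / 4))) n).card : ℝ) / N i)
      l (nhds 0) := by
  obtain ⟨C, hC, hmert⟩ := exists_abs_recipSum_expFloor_sub_le
  have hr := tendsto_recipSum_expFloor ha hba
  have hba1 : ∀ᶠ i in l, a i ≤ b i := by
    filter_upwards [ha.eventually_ge_atTop 1, hba.eventually_ge_atTop 1] with i h1 h2
    rwa [le_div_iff₀ (by linarith), one_mul] at h2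
  have hb0 : ∀ᶠ i in l, 0 ≤ b i := by
    filter_upwards [ha.eventually_ge_atTop 1, hba1] with i h1 h2
    linarith
  have hdisp := tendsto_dispErr ha hb0 hb hc
  have hbound : Tendsto (fun i => pairErr (expFloor (a i)) (expFloor (b i)) /
      recipSum (expFloor (a i)) (expFloor (b i)) +
      1 / (expFloor (a i) : ℝ) / recipSum (expFloor (a i)) (expFloor (b i)) +
      (Real.log (a i / 4 / c i) / h i + C / h i) +
      dispErr (expFloor (a i)) (expFloor (b i)) (expFloor (a i / 4)) (expFloor (c i)) / h i /
        recipSum (expFloor (a i)) (expFloor (b i))) l (nhds 0) := by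
    have h1 := tendsto_pairErr_div ha hba
    have h2 := ((tendsto_const_nhds (x := (1 : ℝ))).div_atTop (tendsto_expFloor ha)).div_atTop hr
    have h3 := hlog.add ((tendsto_const_nhds (x := C)).div_atTop hh)
    have h4 := (hdisp.div_atTop hh).div_atTop hr
    simpa using ((h1.add h2).add h3).add h4
  refine squeeze_zero' (Eventually.of_forall fun i => by positivity) ?_ hbound
  have hlog1 : ∀ᶠ i in l, 1 ≤ 16 * Real.log (a i) :=
    ((Real.tendsto_log_atTop.comp ha).const_mul_atTop (by norm_num : (0 : ℝ) < 16)
      ).eventually_ge_atTop 1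
  filter_upwards [ha.eventually_ge_atTop 1, hb, hba1, hb0, hc, hca, hN, hh.eventually_gt_atTop 0,
    hr.eventually_gt_atTop 0, hlog1] with i h1 h2 h3 h4 h5 h6 h7 h8 h9 h10
  have hc1 : 1 ≤ c i := h10.trans h5
  have hNpos : (0 : ℝ) < N i := by
    have := expFloor_pos h4
    exact_mod_cast (by omega : 0 < N i)
  have key := card_le_newCount_le (N := N i) (M := expFloor (a i)) (P := expFloor (b i))
    (D := expFloor (a i / 4)) (z := expFloor (c i)) (expFloor_pos (by linarith))
    (expFloor_pos (by linarith)) (expFloor_pos (by linarith)) (expFloor_mono (by linarith))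
    (expFloor_mono (by linarith)) h7 h8
  have hme := (abs_le.1 (hmert _ _ hc1 h6)).2
  set lam := recipSum (expFloor (a i)) (expFloor (b i))
  set rz := recipSum (expFloor (c i)) (expFloor (a i / 4))
  rw [div_le_iff₀ hNpos]
  have key2 := (le_div_iff₀' h9).2 key
  refine key2.trans ?_
  have h11 : rz / h i ≤ Real.log (a i / 4 / c i) / h i + C / h i := by
    rw [← add_div]
    gcongr
    linarith
  have e : N i * (pairErr (expFloor (a i)) (expFloor (b i)) + 1 / (expFloor (a i) : ℝ) +
      (lam * rz + dispErr (expFloor (a i)) (expFloor (b i)) (expFloor (a i / 4))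
        (expFloor (c i))) / h i) / lam =
      (pairErr (expFloor (a i)) (expFloor (b i)) / lam + 1 / (expFloor (a i) : ℝ) / lam +
        rz / h i + dispErr (expFloor (a i)) (expFloor (b i)) (expFloor (a i / 4))
        (expFloor (c i)) / h i / lam) * N i := by
    field_simp
    ring
  rw [e]
  gcongr

end Scale

lemma tendsto_log_mul_pow_div_sqrt {k : ℝ} (hk : 0 < k) (m : ℕ) :
    Tendsto (fun L : ℝ => Real.log (k * L) ^ m / √L) atTop (nhds 0) := by
  have h1 : Tendsto (fun L : ℝ => 4 ^ m * (Real.log √L ^ m / √L)) atTop (nhds 0) := by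
    have h := (Real.isLittleO_pow_log_id_atTop (n := m)).tendsto_div_nhds_zero
    simpa using (h.comp Real.tendsto_sqrt_atTop).const_mul (4 ^ m : ℝ)
  refine squeeze_zero' ?_ ?_ h1
  · filter_upwards [eventually_ge_atTop (1 / k), eventually_gt_atTop 0] with L h2 h3
    have : 0 ≤ Real.log (k * L) := Real.log_nonneg (by
      rw [div_le_iff₀ hk] at h2
      linarith)
    positivity
  · filter_upwards [eventually_ge_atTop (1 / k), eventually_ge_atTop k, eventually_gt_atTop 0]
      with L h2 h3 h4
    have h5 : 0 ≤ Real.log (k * L) := Real.log_nonneg (by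
      rw [div_le_iff₀ hk] at h2
      linarith)
    have h6 : Real.log (k * L) ≤ 4 * Real.log √L := by
      rw [Real.log_mul hk.ne' h4.ne', Real.log_sqrt h4.le]
      linarith [Real.log_le_log hk h3]
    rw [← mul_div_assoc, ← mul_pow]
    gcongr

/-- The logarithm of the largest-scale prime factor that is varied. -/
noncomputable def mainScale (L : ℝ) : ℝ := Real.exp L / √(√L)

/-- The logarithm of the smallest prime counted in the main term. -/
noncomputable def mainLow (L : ℝ) : ℝ := 16 * Real.log (mainScale L)

/-- The degree at which binomial expansions are truncated. -/
noncomputable def truncDeg (L : ℝ) : ℕ := ⌈4 * L⌉₊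

/-- The logarithm of the largest prime counted in the main term. -/
noncomputable def mainHigh (L : ℝ) : ℝ := mainScale L / 4 / truncDeg L

/-- The primes counted in the main term. -/
noncomputable def mainPrimes (L : ℝ) : Finset ℕ :=
  primesIoc (expFloor (mainLow L)) (expFloor (mainHigh L))

lemma sqrt_sqrt_pos {L : ℝ} (h : 0 < L) : 0 < √(√L) := Real.sqrt_pos.2 (Real.sqrt_pos.2 h)

lemma one_le_sqrt_sqrt {L : ℝ} (h : 1 ≤ L) : 1 ≤ √(√L) :=
  Real.one_le_sqrt.2 (Real.one_le_sqrt.2 h)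

lemma sqrt_sqrt_le {L : ℝ} (h : 1 ≤ L) : √(√L) ≤ L := by
  have h1 : √L ≤ L := (Real.sqrt_le_left (by linarith)).2 (by nlinarith)
  exact (Real.sqrt_le_sqrt h1).trans h1

lemma le_exp_half (L : ℝ) : L ≤ Real.exp (L / 2) := by
  have h1 : Real.exp (L / 2) = Real.exp (L / 4) ^ 2 := by
    rw [← Real.exp_nat_mul]
    congr 1
    push_cast
    ring
  rcases le_or_gt L 0 with h | h
  · exact h.trans (Real.exp_pos _).le
  · have h2 := Real.add_one_le_exp (L / 4)
    rw [h1]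
    nlinarith [sq_nonneg (1 - L / 4)]

lemma mainScale_le {L : ℝ} (h : 1 ≤ L) : mainScale L ≤ Real.exp L :=
  div_le_self (Real.exp_pos _).le (one_le_sqrt_sqrt h)

lemma exp_half_le_mainScale {L : ℝ} (h : 1 ≤ L) : Real.exp (L / 2) ≤ mainScale L := by
  rw [mainScale, le_div_iff₀ (sqrt_sqrt_pos (by linarith))]
  have h1 : Real.exp L = Real.exp (L / 2) * Real.exp (L / 2) := by rw [← Real.exp_add, add_halves]
  rw [h1]
  gcongr
  exact (sqrt_sqrt_le h).trans (le_exp_half L)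

lemma mainScale_pos {L : ℝ} (h : 1 ≤ L) : 0 < mainScale L :=
  (Real.exp_pos _).trans_le (exp_half_le_mainScale h)

lemma mainLow_le {L : ℝ} (h : 1 ≤ L) : mainLow L ≤ 16 * L := by
  have := Real.log_le_log (mainScale_pos h) (mainScale_le h)
  rw [Real.log_exp] at this
  rw [mainLow]
  linarith

lemma le_mainLow {L : ℝ} (h : 1 ≤ L) : 8 * L ≤ mainLow L := by
  have := Real.log_le_log (Real.exp_pos _) (exp_half_le_mainScale h)
  rw [Real.log_exp] at this
  rw [mainLow]
  linarith

lemma le_truncDeg (L : ℝ) : 4 * L ≤ truncDeg L := Nat.le_ceil _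

lemma truncDeg_le {L : ℝ} (h : 1 ≤ L) : (truncDeg L : ℝ) ≤ 5 * L := by
  have := Nat.ceil_lt_add_one (show 0 ≤ 4 * L by linarith)
  rw [truncDeg]
  linarith

lemma mainHigh_le_mainScale {L : ℝ} (h : 1 ≤ L) : mainHigh L ≤ mainScale L / 4 := by
  have h1 := mainScale_pos h
  refine div_le_self (by positivity) ?_
  linarith [le_truncDeg L]

lemma mainHigh_le {L : ℝ} (h : 1 ≤ L) : mainHigh L ≤ Real.exp L := by
  have h1 := mainScale_pos h
  linarith [mainHigh_le_mainScale h, mainScale_le h]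

lemma tendsto_mainScale : Tendsto mainScale atTop atTop :=
  tendsto_atTop_mono' _ ((eventually_ge_atTop 1).mono fun _ h => exp_half_le_mainScale h)
    (Real.tendsto_exp_atTop.comp (tendsto_id.atTop_div_const two_pos))

lemma eventually_le_mainHigh : ∀ᶠ L : ℝ in atTop, 16 * L ≤ mainHigh L := by
  have h1 := (tendsto_id.atTop_div_const (two_pos : (0 : ℝ) < 2)).eventually
    ((Real.tendsto_exp_div_pow_atTop 2).eventually_ge_atTop (1280 : ℝ))
  filter_upwards [h1, eventually_ge_atTop 1] with L h2 h3
  simp only [id] at h2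
  rw [le_div_iff₀ (by positivity)] at h2
  have h4 := truncDeg_le h3
  have h5 : (0 : ℝ) < truncDeg L := by linarith [le_truncDeg L]
  rw [mainHigh, le_div_iff₀ h5]
  have h6 := exp_half_le_mainScale h3
  nlinarith

lemma tendsto_sqrt_sqrt_div : Tendsto (fun L => Real.exp L / 3 / mainScale L) atTop atTop := by
  have h : Tendsto (fun L : ℝ => √(√L) / 3) atTop atTop :=
    (Real.tendsto_sqrt_atTop.comp Real.tendsto_sqrt_atTop).atTop_div_const (by norm_num)
  refine h.congr' ?_
  filter_upwards [eventually_ge_atTop 1] with L hL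
  have := sqrt_sqrt_pos (show 0 < L by linarith)
  rw [mainScale]
  field_simp

lemma two_mul_expFloor_le {b X : ℝ} (hX : 2 ≤ X) (hb : b ≤ X / 3) :
    2 * expFloor b ≤ expFloor X := by
  refine Nat.le_floor ?_
  push_cast
  have h1 := (expFloor_le b).trans (Real.exp_le_exp.2 hb)
  have h2 : Real.exp X = Real.exp (X / 3) * Real.exp (2 * X / 3) := by
    rw [← Real.exp_add]
    congr 1
    ring
  have h3 : 2 ≤ Real.exp (2 * X / 3) := by linarith [Real.add_one_le_exp (2 * X / 3)]
  rw [h2]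
  nlinarith [Real.exp_pos (X / 3)]

lemma eventually_div_three_le_sq : ∀ᶠ L : ℝ in atTop, Real.exp L / 3 ≤ mainScale L ^ 2 := by
  filter_upwards [eventually_ge_atTop 1] with L hL
  have h1 := pow_le_pow_left₀ (Real.exp_pos _).le (exp_half_le_mainScale hL) 2
  rw [← Real.exp_nat_mul] at h1
  push_cast at h1
  rw [mul_div_cancel₀ _ two_ne_zero] at h1
  linarith [Real.exp_pos L]

lemma pow_expFloor_le (α : ℝ) {K : ℕ} (hK : 0 < K) :
    expFloor (α / K) ^ K ≤ expFloor α := by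
  refine Nat.le_floor ?_
  push_cast
  calc (expFloor (α / K) : ℝ) ^ K ≤ Real.exp (α / K) ^ K := by
        gcongr
        exact expFloor_le _
    _ = Real.exp α := by
        rw [← Real.exp_nat_mul, mul_div_cancel₀]
        exact_mod_cast hK.ne'

/-- The mean of the main term is `L + o(√L)`. -/
lemma tendsto_recipSum_main :
    Tendsto (fun L => (recipSum (expFloor (mainLow L)) (expFloor (mainHigh L)) - L) / √L)
      atTop (nhds 0) := by
  obtain ⟨C, hC, hmert⟩ := exists_abs_recipSum_expFloor_sub_le
  have hb : Tendsto (fun L : ℝ => C / √L + 4 * (Real.log (16 * L) ^ 1 / √L)) atTop (nhds 0) := by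
    have h1 := (tendsto_const_nhds (x := C)).div_atTop Real.tendsto_sqrt_atTop
    simpa using h1.add ((tendsto_log_mul_pow_div_sqrt (k := 16) (by norm_num) 1).const_mul 4)
  rw [tendsto_zero_iff_abs_tendsto_zero]
  refine squeeze_zero' (Eventually.of_forall fun L => abs_nonneg _) ?_ hb
  filter_upwards [eventually_ge_atTop 1, eventually_le_mainHigh] with L hL hH
  have hL0 : 0 < L := by linarith
  have hs := Real.sqrt_pos.2 hL0
  have h1 := le_mainLow hL
  have h2 := mainLow_le hL
  have h3 := hmert (mainLow L) (mainHigh L) (by linarith) (by linarith)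
  have hK0 : (0 : ℝ) < truncDeg L := by linarith [le_truncDeg L]
  have hK1 := truncDeg_le hL
  have hss := sqrt_sqrt_pos hL0
  have h4 : Real.log (mainHigh L / mainLow L) =
      L - Real.log √(√L) - Real.log 4 - Real.log (truncDeg L) - Real.log (mainLow L) := by
    have hms := mainScale_pos hL
    rw [Real.log_div (by linarith) (by linarith), mainHigh, Real.log_div (by positivity) hK0.ne',
      Real.log_div hms.ne' (by norm_num), mainScale, Real.log_div (Real.exp_pos _).ne' hss.ne',
      Real.log_exp]
  have h5 : 0 ≤ Real.log √(√L) := Real.log_nonneg (one_le_sqrt_sqrt hL)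
  have h6 : Real.log √(√L) ≤ Real.log (16 * L) :=
    Real.log_le_log hss (by linarith [sqrt_sqrt_le hL])
  have h7 : 0 ≤ Real.log 4 := Real.log_nonneg (by norm_num)
  have h8 : Real.log 4 ≤ Real.log (16 * L) := Real.log_le_log (by norm_num) (by linarith)
  have h9 : 0 ≤ Real.log (truncDeg L) := Real.log_natCast_nonneg _
  have h10 : Real.log (truncDeg L) ≤ Real.log (16 * L) := Real.log_le_log hK0 (by linarith)
  have h11 : 0 ≤ Real.log (mainLow L) := Real.log_nonneg (by linarith)
  have h12 : Real.log (mainLow L) ≤ Real.log (16 * L) := Real.log_le_log (by linarith) h2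
  change |_ / √L| ≤ _
  rw [abs_div, abs_of_pos hs, pow_one, ← mul_div_assoc, ← add_div]
  gcongr
  rw [h4, abs_le] at h3
  rw [abs_le]
  constructor <;> linarith [h3.1, h3.2]

lemma tendsto_truncation_error :
    Tendsto (fun L => 2 * ((1 / 2 : ℝ) ^ truncDeg L *
      Real.exp (2 * recipSum (expFloor (mainLow L)) (expFloor (mainHigh L))))) atTop (nhds 0) := by
  obtain ⟨C, hC, hmert⟩ := exists_abs_recipSum_expFloor_sub_le
  have hb : Tendsto (fun L : ℝ => 2 * (Real.exp (2 * C) * Real.exp (-(L / 2)))) atTop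
      (nhds 0) := by
    have h := Real.tendsto_exp_neg_atTop_nhds_zero.comp
      (tendsto_id.atTop_div_const (two_pos : (0 : ℝ) < 2))
    simpa using (h.const_mul (Real.exp (2 * C))).const_mul 2
  refine squeeze_zero' (Eventually.of_forall fun L => by positivity) ?_ hb
  filter_upwards [eventually_ge_atTop 1, eventually_le_mainHigh] with L hL hH
  have h1 := le_mainLow hL
  have h2 := mainLow_le hL
  have h3 := (abs_le.1 (hmert (mainLow L) (mainHigh L) (by linarith) (by linarith))).2
  have h4 : Real.log (mainHigh L / mainLow L) ≤ L := by
    rw [Real.log_le_iff_le_exp (by have := mainScale_pos hL; apply div_pos <;> linarith)]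
    exact (div_le_self (by linarith) (by linarith)).trans (mainHigh_le hL)
  have h5 : (1 / 2 : ℝ) ^ truncDeg L ≤ Real.exp (-(4 * L * Real.log 2)) := by
    have : (1 / 2 : ℝ) ^ truncDeg L = Real.exp (-(truncDeg L * Real.log 2)) := by
      rw [← mul_neg, Real.exp_nat_mul, ← Real.log_inv, Real.exp_log (by norm_num), one_div]
    rw [this]
    gcongr
    exact le_truncDeg L
  calc _ ≤ 2 * (Real.exp (-(4 * L * Real.log 2)) * Real.exp (2 * (L + C))) := by
        gcongr
        linarith
    _ ≤ 2 * (Real.exp (2 * C) * Real.exp (-(L / 2))) := by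
        rw [← Real.exp_add, ← Real.exp_add, mul_le_mul_iff_right₀ two_pos, Real.exp_le_exp]
        nlinarith [Real.log_two_gt_d9]

lemma tendsto_badErr_div :
    Tendsto (fun L => badErr (expFloor (Real.exp L)) (expFloor (mainScale L))
      (expFloor (Real.exp L / 3)) (expFloor (mainScale L / 4)) (expFloor (mainLow L)) /
      recipSum (expFloor (mainScale L)) (expFloor (Real.exp L / 3))) atTop (nhds 0) := by
  have hb : Tendsto (fun L : ℝ => 116 / Real.exp L) atTop (nhds 0) :=
    tendsto_const_nhds.div_atTop Real.tendsto_exp_atTop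
  have hr := tendsto_recipSum_expFloor tendsto_mainScale tendsto_sqrt_sqrt_div
  refine squeeze_zero' ?_ ?_ hb
  · filter_upwards with L
    rw [badErr]
    have h1 : 0 ≤ Real.log (expFloor (mainScale L / 4)) := Real.log_natCast_nonneg _
    have h2 : 0 ≤ Real.log (expFloor (Real.exp L / 3)) := Real.log_natCast_nonneg _
    have h3 := recipSum_nonneg (expFloor (mainScale L)) (expFloor (Real.exp L / 3))
    positivity
  filter_upwards [eventually_ge_atTop 1, hr.eventually_gt_atTop 0, eventually_le_mainHigh]
    with L hL hr0 hH
  set X := Real.exp L with hX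
  have hX1 : 1 ≤ X := Real.one_le_exp (by linarith)
  have hms := mainScale_pos hL
  have hD : Real.log (expFloor (mainScale L / 4)) ≤ X :=
    (log_expFloor_le (by positivity)).trans (by linarith [mainScale_le hL])
  have hD0 : 0 ≤ Real.log (expFloor (mainScale L / 4)) := Real.log_natCast_nonneg _
  have hP : Real.log (expFloor (X / 3)) ≤ X :=
    (log_expFloor_le (by positivity)).trans (by linarith)
  have hP0 : 0 ≤ Real.log (expFloor (X / 3)) := Real.log_natCast_nonneg _
  have hN : Real.log (expFloor X) ≤ X := log_expFloor_le (by linarith)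
  have hN0 : 0 ≤ Real.log (expFloor X) := Real.log_natCast_nonneg _
  have h8 : ∀ α, 8 * L ≤ α → X ^ 8 / 2 ≤ expFloor α := fun α hα => by
    have h1 := exp_half_le_expFloor (show 0 ≤ α by linarith)
    have h2 := Real.exp_le_exp.2 hα
    have h3 : Real.exp (8 * L) = X ^ 8 := by
      rw [hX, ← Real.exp_nat_mul]
      push_cast
      rfl
    linarith
  have hz := h8 _ (le_mainLow hL)
  have hM := h8 (mainScale L) (by linarith [mainHigh_le_mainScale hL])
  rw [badErr, mul_assoc, mul_div_cancel_left₀ _ hr0.ne']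
  calc (1 + Real.log (expFloor (mainScale L / 4))) *
      ((2 + 6 * (1 + Real.log (expFloor X)) ^ 2 + Real.log (expFloor (X / 3))) /
        (expFloor (mainLow L)) +
        (1 + Real.log (expFloor (mainScale L / 4))) / (expFloor (mainScale L)))
      ≤ (X + X) * ((2 * X ^ 2 + 6 * (X + X) ^ 2 + X ^ 2) / (X ^ 8 / 2) +
        (X + X ^ 2) / (X ^ 8 / 2)) := by
        have hX2 : 1 ≤ X ^ 2 := one_le_pow₀ hX1
        have hX3 : X ≤ X ^ 2 := le_self_pow₀ hX1 two_ne_zero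
        gcongr <;> linarith
    _ ≤ (X + X) * ((2 * X ^ 2 + 6 * (X + X) ^ 2 + X ^ 2) / (X ^ 8 / 2) +
        (X ^ 2 + X ^ 2) / (X ^ 8 / 2)) := by
        have hX3 : X ≤ X ^ 2 := le_self_pow₀ hX1 two_ne_zero
        gcongr
    _ = 116 / X ^ 5 := by
        field_simp
        ring
    _ ≤ 116 / X := by
        gcongr
        exact le_self_pow₀ hX1 (by norm_num)

lemma tendsto_expFloor_quarter_div :
    Tendsto (fun L => (expFloor (mainScale L / 4) : ℝ) / expFloor (mainScale L)) atTop
      (nhds 0) := by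
  have hb : Tendsto (fun L => 2 * Real.exp (-(mainScale L / 2))) atTop (nhds 0) := by
    simpa using (Real.tendsto_exp_neg_atTop_nhds_zero.comp
      (tendsto_mainScale.atTop_div_const two_pos)).const_mul 2
  refine squeeze_zero' (Eventually.of_forall fun L => by positivity) ?_ hb
  filter_upwards [eventually_ge_atTop 1] with L hL
  have hms := mainScale_pos hL
  rw [div_le_iff₀ (by exact_mod_cast expFloor_pos hms.le)]
  have h1 := exp_half_le_expFloor hms.le
  calc (expFloor (mainScale L / 4) : ℝ) ≤ Real.exp (mainScale L / 4) := expFloor_le _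
    _ ≤ Real.exp (-(mainScale L / 2)) * Real.exp (mainScale L) := by
        rw [← Real.exp_add]
        gcongr
        linarith
    _ ≤ _ := by
        have := mul_le_mul_of_nonneg_left h1 (Real.exp_pos (-(mainScale L / 2))).le
        linarith

/-- The characteristic functions of the normalised main term converge to that of the standard
Gaussian. -/
lemma tendsto_charFun_main (θ : ℝ) :
    Tendsto (fun L : ℝ => (1 / (expFloor (Real.exp L) : ℂ)) *
      ∑ n ∈ Finset.Ioc 0 (expFloor (Real.exp L)),
        Complex.exp (θ * ((newCount (mainPrimes L) n - L) / √L : ℝ) * Complex.I)) atTop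
      (nhds (Complex.exp (-θ ^ 2 / 2))) := by
  have hlow : ∀ᶠ L in atTop, 0 < expFloor (mainLow L) := by
    filter_upwards [eventually_ge_atTop 1] with L hL
    exact expFloor_pos (by linarith [le_mainLow hL])
  have h1 := tendsto_prod_one_add_mul_exp (L := id) θ hlow tendsto_id tendsto_recipSum_main
  refine (tendsto_iff_of_dist ?_).1 h1
  have hr := tendsto_recipSum_expFloor tendsto_mainScale tendsto_sqrt_sqrt_div
  have hdisp := tendsto_dispErr (b := fun L => Real.exp L / 3) (c := mainLow) tendsto_mainScale
    (Eventually.of_forall fun L => by positivity)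
    eventually_div_three_le_sq (Eventually.of_forall fun L => le_rfl)
  have hpair := tendsto_pairErr_div tendsto_mainScale tendsto_sqrt_sqrt_div
  have hM := (tendsto_const_nhds (x := (1 : ℝ))).div_atTop (tendsto_expFloor tendsto_mainScale)
  have hbound := (((((hpair.const_mul 2).add (hM.div_atTop hr)).add (hdisp.div_atTop hr)).add
    tendsto_badErr_div).add (tendsto_expFloor_quarter_div.div_atTop hr)).add
      tendsto_truncation_error
  simp only [mul_zero, add_zero] at hbound
  refine squeeze_zero' (Eventually.of_forall fun L => dist_nonneg) ?_ hbound
  have ht : Tendsto (fun L : ℝ => θ / √L) atTop (nhds 0) :=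
    tendsto_const_nhds.div_atTop Real.tendsto_sqrt_atTop
  filter_upwards [eventually_ge_atTop 1, hr.eventually_gt_atTop 0, eventually_le_mainHigh,
    ht.abs.eventually_le_const (u := 1) (by simp), Real.tendsto_exp_atTop.eventually_ge_atTop 2]
    with L hL hr0 hH ht1 hX2
  have hms := mainScale_pos hL
  have hs := Real.sqrt_pos.2 (show 0 < L by linarith)
  have hss := Real.mul_self_sqrt (show 0 ≤ L by linarith)
  have hK0 : 0 < truncDeg L := by
    have := le_truncDeg L
    exact_mod_cast (by linarith : (0 : ℝ) < truncDeg L)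
  set w := Complex.exp ((θ / √L : ℝ) * Complex.I) - 1 with hw
  have hw1 : ‖w‖ ≤ 1 := (norm_exp_mul_I_sub_one_le _).trans ht1
  have hw2 : ‖1 + w‖ ≤ 1 := by
    rw [hw, add_sub_cancel, Complex.norm_exp_ofReal_mul_I]
  have hba : mainScale L / 4 ≤ Real.exp L / 3 := by linarith [mainScale_le hL, Real.exp_pos L]
  have key := norm_sum_newCount_sub_le (N := expFloor (Real.exp L)) (M := expFloor (mainScale L))
    (P := expFloor (Real.exp L / 3)) (D := expFloor (mainScale L / 4))
    (z := expFloor (mainLow L)) (y := expFloor (mainHigh L)) (K := truncDeg L)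
    (expFloor_pos hms.le) (expFloor_pos (by linarith [le_mainLow hL]))
    (expFloor_pos (by linarith)) (expFloor_mono hba) (expFloor_mono (by linarith))
    (expFloor_pos (by linarith)) (pow_expFloor_le _ hK0)
    (two_mul_expFloor_le hX2 le_rfl) hw2 hw1
  have hN : (0 : ℝ) < expFloor (Real.exp L) := by exact_mod_cast expFloor_pos (by linarith)
  have hNC : (expFloor (Real.exp L) : ℂ) ≠ 0 := by exact_mod_cast hN.ne'
  set N := expFloor (Real.exp L)
  set lam := recipSum (expFloor (mainScale L)) (expFloor (Real.exp L / 3))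
  set Q := ∏ q ∈ primesIoc (expFloor (mainLow L)) (expFloor (mainHigh L)), (1 + w / q)
  have e1 : ∀ n, Complex.exp (θ * ((newCount (mainPrimes L) n - L) / √L : ℝ) * Complex.I) =
      Complex.exp (-(θ * √L : ℝ) * Complex.I) * (1 + w) ^ newCount (mainPrimes L) n := fun n => by
    rw [hw, add_sub_cancel, ← Complex.exp_nat_mul, ← Complex.exp_add]
    congr 1
    have : (θ : ℂ) * (((newCount (mainPrimes L) n - L) / √L : ℝ) : ℂ) =
        ((-(θ * √L) + newCount (mainPrimes L) n * (θ / √L) : ℝ) : ℂ) := by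
      rw [← Complex.ofReal_mul]
      congr 1
      field_simp
      linear_combination θ * hss
    rw [this]
    push_cast
    ring
  simp only [e1, id]
  rw [← Finset.mul_sum, dist_comm, dist_eq_norm, mul_left_comm, ← mul_sub, norm_mul,
    ← Complex.ofReal_neg, Complex.norm_exp_ofReal_mul_I, one_mul]
  have e2 : 1 / (N : ℂ) * ∑ n ∈ Finset.Ioc 0 N, (1 + w) ^ newCount (mainPrimes L) n - Q =
      1 / (N : ℂ) * (∑ n ∈ Finset.Ioc 0 N, (1 + w) ^ newCount (mainPrimes L) n - N * Q) := by
    field_simp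
  change ‖1 / (N : ℂ) * ∑ n ∈ Finset.Ioc 0 N, (1 + w) ^ newCount (mainPrimes L) n - Q‖ ≤ _
  rw [e2, norm_mul, norm_div, norm_one, Complex.norm_natCast, one_div_mul_eq_div, div_le_iff₀ hN]
  have key2 := (le_div_iff₀' hr0).2 key
  refine key2.trans (le_of_eq ?_)
  field_simp

lemma sumProper_pos {n : ℕ} (hn : 2 ≤ n) : 0 < sumProper n :=
  Finset.sum_pos' (fun _ _ => Nat.zero_le _)
    ⟨1, Nat.one_mem_properDivisors_iff_one_lt.2 hn, Nat.one_pos⟩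

lemma sumProper_le_sq (n : ℕ) : sumProper n ≤ n ^ 2 := by
  have h1 : n.properDivisors.card ≤ n := by
    refine (Finset.card_filter_le _ _).trans ?_
    simp
  calc sumProper n ≤ n.properDivisors.card • n :=
        Finset.sum_le_card_nsmul _ _ _ fun d hd => (Nat.mem_properDivisors.1 hd).2.le
    _ ≤ n ^ 2 := by
        rw [smul_eq_mul, sq]
        exact Nat.mul_le_mul_right _ h1

/-- The number of primes `q ≤ N` dividing both `n` and `s(n)`. -/
def commonCount (N n : ℕ) : ℕ :=
  ((primesIoc 0 N).filter fun q => q ∣ n ∧ q ∣ sumProper n).card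

lemma card_large_primeFactors_mul_log_le {m D : ℕ} (hm : 0 < m) :
    (m.primeFactors.filter fun q => D < q).card * Real.log (D + 1) ≤ Real.log m := by
  have h1 : (D + 1) ^ (m.primeFactors.filter fun q => D < q).card ≤ m :=
    calc _ ≤ ∏ q ∈ m.primeFactors.filter (fun q => D < q), q :=
          Finset.pow_card_le_prod _ _ _ fun q hq => (Finset.mem_filter.1 hq).2
      _ ≤ ∏ q ∈ m.primeFactors, q := by
          refine Finset.prod_le_prod_of_subset_of_one_le' (Finset.filter_subset _ _)
            fun q hq _ => (Nat.prime_of_mem_primeFactors hq).one_le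
      _ ≤ m := Nat.le_of_dvd hm (Nat.prod_primeFactors_dvd m)
  have h2 : ((D : ℝ) + 1) ^ (m.primeFactors.filter fun q => D < q).card ≤ m := by
    exact_mod_cast h1
  have h3 := Real.log_le_log (by positivity) h2
  rwa [Real.log_pow] at h3

lemma newCount_le_card_primeFactors {T : Finset ℕ} (hT : ∀ q ∈ T, q.Prime) {n : ℕ} (hn : 2 ≤ n) :
    newCount T n ≤ (sumProper n).primeFactors.card := by
  refine Finset.card_le_card fun q hq => ?_
  rw [Finset.mem_filter] at hq
  exact Nat.mem_primeFactors.2 ⟨hT q hq.1, hq.2.1, (sumProper_pos hn).ne'⟩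

lemma card_primeFactors_sumProper_le {n N A₁ A₂ A₃ z y D : ℕ} (hn : 2 ≤ n) (hN : n ≤ N)
    (hz : z ≤ A₃) :
    (sumProper n).primeFactors.card ≤ A₁ + newCount (primesIoc A₁ A₂) n +
      newCount (primesIoc A₂ A₃) n + newCount (primesIoc z y) n + newCount (primesIoc y D) n +
      ((sumProper n).primeFactors.filter fun q => D < q).card + commonCount N n := by
  have hsub : (sumProper n).primeFactors ⊆ (((((Finset.Ioc 0 A₁ ∪
      (primesIoc A₁ A₂).filter fun q => IsProperDivisor q n) ∪
      (primesIoc A₂ A₃).filter fun q => IsProperDivisor q n) ∪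
      (primesIoc z y).filter fun q => IsProperDivisor q n) ∪
      (primesIoc y D).filter fun q => IsProperDivisor q n) ∪
      ((sumProper n).primeFactors.filter fun q => D < q)) ∪
      ((primesIoc 0 N).filter fun q => q ∣ n ∧ q ∣ sumProper n) := by
    intro q hq
    have hp := Nat.prime_of_mem_primeFactors hq
    have hd := Nat.dvd_of_mem_primeFactors hq
    have hpos := hp.pos
    by_cases hqn : q ∣ n
    · refine Finset.mem_union_right _ (Finset.mem_filter.2 ⟨mem_primesIoc.2 ⟨⟨hpos, ?_⟩, hp⟩,
        hqn, hd⟩)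
      exact (Nat.le_of_dvd (by omega) hqn).trans hN
    · have hprop : IsProperDivisor q n := ⟨hd, (hp.coprime_iff_not_dvd).2 hqn⟩
      simp only [Finset.mem_union, Finset.mem_filter, mem_primesIoc, Finset.mem_Ioc, hp, hprop,
        hq, and_true, true_and]
      omega
  refine (Finset.card_le_card hsub).trans ?_
  refine (Finset.card_union_le _ _).trans (Nat.add_le_add_right ?_ _)
  refine (Finset.card_union_le _ _).trans (Nat.add_le_add_right ?_ _)
  refine (Finset.card_union_le _ _).trans (Nat.add_le_add_right ?_ _)
  refine (Finset.card_union_le _ _).trans (Nat.add_le_add_right ?_ _)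
  refine (Finset.card_union_le _ _).trans (Nat.add_le_add_right ?_ _)
  refine (Finset.card_union_le _ _).trans (Nat.add_le_add_right ?_ _)
  simp

lemma sum_commonCount_le {N Z : ℕ} (hZ : 0 < Z) :
    ∑ n ∈ Finset.Ioc 0 N, (commonCount N n : ℝ) ≤
      N * (recipSum 0 Z + 6 * (1 + Real.log N) ^ 2 / Z) := by
  have h1 : ∑ n ∈ Finset.Ioc 0 N, (commonCount N n : ℝ) = ∑ q ∈ primesIoc 0 N,
      (((Finset.Ioc 0 N).filter fun n => q ∣ n ∧ q ∣ sumProper n).card : ℝ) := by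
    simp only [commonCount, Finset.card_filter, Nat.cast_sum]
    rw [Finset.sum_comm]
  have hdvd : ∀ q n, q ∣ n ∧ q ∣ sumProper n → q ∣ n ∧ q ∣ sumDiv n := fun q n h =>
    ⟨h.1, by
      rw [sumDiv_eq]
      exact (Nat.dvd_add_right h.2).2 h.1⟩
  have hA : ∀ q ∈ primesIoc 0 Z,
      (((Finset.Ioc 0 N).filter fun n => q ∣ n ∧ q ∣ sumProper n).card : ℝ) ≤ N * (1 / q) := by
    intro q hq
    rw [mul_one_div]
    refine le_trans ?_ (card_dvd_le N q)
    exact_mod_cast Finset.card_le_card fun n hn => by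
      rw [Finset.mem_filter] at hn ⊢
      exact ⟨hn.1, hn.2.1⟩
  have hB : ∀ q ∈ primesIoc Z N,
      (((Finset.Ioc 0 N).filter fun n => q ∣ n ∧ q ∣ sumProper n).card : ℝ) ≤
        N * (6 * (1 + Real.log N) ^ 2) * (1 / (q : ℝ) ^ 2) := by
    intro q hq
    refine le_trans ?_ ((card_dvd_and_dvd_sumDiv_le (N := N) (mem_primesIoc.1 hq).2).trans
      (le_of_eq (by ring)))
    exact_mod_cast Finset.card_le_card fun n hn => by
      rw [Finset.mem_filter] at hn ⊢
      exact ⟨hn.1, hdvd q n hn.2⟩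
  have hsub : primesIoc 0 N ⊆ primesIoc 0 Z ∪ primesIoc Z N := fun q hq => by
    rw [Finset.mem_union, mem_primesIoc, mem_primesIoc]
    rw [mem_primesIoc] at hq
    rcases le_or_gt q Z with h | h
    · exact Or.inl ⟨⟨hq.1.1, h⟩, hq.2⟩
    · exact Or.inr ⟨⟨h, hq.1.2⟩, hq.2⟩
  have hdisj : Disjoint (primesIoc 0 Z) (primesIoc Z N) := by
    rw [Finset.disjoint_left]
    intro q h1 h2
    rw [mem_primesIoc] at h1 h2
    omega
  rw [h1]
  refine (Finset.sum_le_sum_of_subset_of_nonneg hsub fun _ _ _ => Nat.cast_nonneg _).trans ?_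
  rw [Finset.sum_union hdisj]
  refine (add_le_add (Finset.sum_le_sum hA) (Finset.sum_le_sum hB)).trans ?_
  rw [← Finset.mul_sum, ← Finset.mul_sum]
  have h2 : ∑ q ∈ primesIoc Z N, (1 : ℝ) / (q : ℝ) ^ 2 ≤ (1 : ℝ) / Z :=
    (Finset.sum_le_sum_of_subset_of_nonneg (Finset.filter_subset _ _)
      fun _ _ _ => by positivity).trans (sum_inv_sq_Ioc_le hZ)
  have h3 := mul_le_mul_of_nonneg_left h2
    (by positivity : 0 ≤ (N : ℝ) * (6 * (1 + Real.log N) ^ 2))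
  have h4 : (N : ℝ) * ∑ q ∈ primesIoc 0 Z, (1 : ℝ) / q = N * recipSum 0 Z := rfl
  rw [h4]
  refine (add_le_add_right h3 _).trans (le_of_eq ?_)
  ring

lemma card_le_commonCount_le {N Z : ℕ} (hZ : 0 < Z) {h : ℝ} (hh : 0 < h) :
    (((Finset.Ioc 0 N).filter fun n => h ≤ commonCount N n).card : ℝ) ≤
      N * ((recipSum 0 Z + 6 * (1 + Real.log N) ^ 2 / Z) / h) := by
  rw [← mul_div_assoc, le_div_iff₀ hh]
  refine le_trans ?_ (sum_commonCount_le hZ)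
  calc _ = ∑ n ∈ (Finset.Ioc 0 N).filter (fun n => h ≤ commonCount N n), h := by simp
    _ ≤ ∑ n ∈ (Finset.Ioc 0 N).filter (fun n => h ≤ commonCount N n), (commonCount N n : ℝ) :=
        Finset.sum_le_sum fun n hn => (Finset.mem_filter.1 hn).2
    _ ≤ _ := Finset.sum_le_sum_of_subset_of_nonneg (Finset.filter_subset _ _)
        fun _ _ _ => Nat.cast_nonneg _

lemma tendsto_card_le_newCount_small {a : ℝ → ℝ} (ha : Tendsto a atTop atTop)
    (hal : ∀ᶠ L in atTop, a L ≤ 64 * L) {ε : ℝ} (hε : 0 < ε) :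
    Tendsto (fun L : ℝ => (((Finset.Ioc 0 (expFloor (Real.exp L))).filter fun n => ε * √L ≤
      newCount (primesIoc (expFloor (16 * Real.log (a L))) (expFloor (a L / 4))) n).card : ℝ) /
      expFloor (Real.exp L)) atTop (nhds 0) := by
  have hlog : Tendsto (fun L => Real.log (a L) / a L) atTop (nhds 0) := by
    have h := (Real.isLittleO_log_id_atTop).tendsto_div_nhds_zero
    exact h.comp ha
  have hca : ∀ᶠ L in atTop, 16 * Real.log (a L) ≤ a L / 4 := by
    filter_upwards [hlog.eventually_le_const (u := 1 / 64) (by norm_num), ha.eventually_gt_atTop 0]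
      with L h1 h2
    rw [div_le_iff₀ h2] at h1
    linarith
  have hexp : ∀ᶠ L : ℝ in atTop, (64 * L) ^ 2 ≤ Real.exp L / 3 := by
    filter_upwards [(Real.tendsto_exp_div_pow_atTop 2).eventually_ge_atTop (3 * 64 ^ 2),
      eventually_gt_atTop 0] with L h1 h2
    rw [le_div_iff₀ (by positivity)] at h1
    linarith
  refine tendsto_card_le_newCount_div (b := fun L => a L ^ 2) ha
    (Eventually.of_forall fun L => le_rfl) ?_ (Eventually.of_forall fun L => le_rfl) hca ?_
    (Real.tendsto_sqrt_atTop.const_mul_atTop hε) ?_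
  · refine ha.congr' ?_
    filter_upwards [ha.eventually_gt_atTop 0] with L h
    field_simp
  · filter_upwards [hal, hexp, ha.eventually_ge_atTop 0,
      Real.tendsto_exp_atTop.eventually_ge_atTop 2] with L h1 h2 h3 h4
    exact two_mul_expFloor_le h4 ((pow_le_pow_left₀ h3 h1 2).trans h2)
  · have hb := (tendsto_log_mul_pow_div_sqrt (k := 64) (by norm_num) 1).div_const ε
    rw [zero_div] at hb
    refine squeeze_zero' ?_ ?_ hb
    · filter_upwards [hca, ha.eventually_ge_atTop 4] with L h1 h2
      have h3 : 0 < Real.log (a L) := Real.log_pos (by linarith)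
      have : 0 ≤ Real.log (a L / 4 / (16 * Real.log (a L))) :=
        Real.log_nonneg ((one_le_div (by positivity)).2 h1)
      positivity
    · filter_upwards [hal, ha.eventually_ge_atTop 4, eventually_gt_atTop 0] with L h1 h2 h0
      have h4 : 1 ≤ Real.log (a L) := by
        rw [Real.le_log_iff_exp_le (by linarith)]
        linarith [Real.exp_one_lt_d9]
      have h5 : a L / 4 / (16 * Real.log (a L)) ≤ 64 * L := by
        rw [div_le_iff₀ (by linarith)]
        nlinarith
      have h6 := Real.log_le_log (by positivity) h5
      rw [pow_one, div_div _ (√L), mul_comm (√L)]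
      gcongr

lemma tendsto_card_le_newCount_large {ε : ℝ} (hε : 0 < ε) :
    Tendsto (fun L : ℝ => (((Finset.Ioc 0 (expFloor (Real.exp L))).filter fun n => ε * √L ≤
      newCount (primesIoc (expFloor (mainHigh L)) (expFloor (mainScale L / 4))) n).card : ℝ) /
      expFloor (Real.exp L)) atTop (nhds 0) := by
  refine tendsto_card_le_newCount_div (b := fun L => Real.exp L / 3) tendsto_mainScale
    eventually_div_three_le_sq tendsto_sqrt_sqrt_div ?_ ?_ ?_
    (Real.tendsto_sqrt_atTop.const_mul_atTop hε) ?_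
  · filter_upwards [eventually_le_mainHigh, eventually_ge_atTop 1] with L h1 h2
    exact (mainLow_le h2).trans h1
  · filter_upwards [eventually_ge_atTop 1] with L h using mainHigh_le_mainScale h
  · filter_upwards [Real.tendsto_exp_atTop.eventually_ge_atTop 2] with L h
    exact two_mul_expFloor_le h le_rfl
  · have hb := (tendsto_log_mul_pow_div_sqrt (k := 5) (by norm_num) 1).div_const ε
    rw [zero_div] at hb
    refine squeeze_zero' ?_ ?_ hb
    all_goals
      filter_upwards [eventually_ge_atTop 1] with L h
      have h1 := mainScale_pos h
      have h2 : (0 : ℝ) < truncDeg L := by linarith [le_truncDeg L]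
      have h3 : mainScale L / 4 / mainHigh L = truncDeg L := by
        rw [mainHigh]
        field_simp
      rw [h3]
    · have := Real.log_natCast_nonneg (truncDeg L)
      positivity
    · have h6 := Real.log_le_log h2 (truncDeg_le h)
      rw [pow_one, div_div _ (√L), mul_comm (√L)]
      gcongr

lemma tendsto_card_le_commonCount {ε : ℝ} (hε : 0 < ε) :
    Tendsto (fun L : ℝ => (((Finset.Ioc 0 (expFloor (Real.exp L))).filter fun n => ε * √L ≤
      commonCount (expFloor (Real.exp L)) n).card : ℝ) / expFloor (Real.exp L)) atTop
      (nhds 0) := by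
  obtain ⟨C, hC, hmert⟩ := exists_abs_recipSum_expFloor_sub_le
  have hb : Tendsto (fun L : ℝ => ((recipSum 0 (expFloor 1) + C + 48) / √L +
      Real.log (16 * L) ^ 1 / √L) / ε) atTop (nhds 0) := by
    have h1 := (tendsto_const_nhds (x := recipSum 0 (expFloor 1) + C + 48)).div_atTop
      Real.tendsto_sqrt_atTop
    simpa using (h1.add (tendsto_log_mul_pow_div_sqrt (k := 16) (by norm_num) 1)).div_const ε
  refine squeeze_zero' (Eventually.of_forall fun L => by positivity) ?_ hb
  filter_upwards [eventually_ge_atTop 1] with L hL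
  have hs := Real.sqrt_pos.2 (show 0 < L by linarith)
  have hX : 1 ≤ Real.exp L := Real.one_le_exp (by linarith)
  have hN : (0 : ℝ) < expFloor (Real.exp L) := by exact_mod_cast expFloor_pos (by linarith)
  have hZ := expFloor_pos (show 0 ≤ 16 * L by linarith)
  rw [div_le_iff₀' hN]
  refine (card_le_commonCount_le hZ (mul_pos hε hs)).trans (mul_le_mul_of_nonneg_left ?_ hN.le)
  have h1 := (abs_le.1 (hmert 1 (16 * L) le_rfl (by linarith))).2
  rw [recipSum_eq_sub (expFloor_mono (by linarith : (1 : ℝ) ≤ 16 * L)), div_one] at h1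
  have h2 : 6 * (1 + Real.log (expFloor (Real.exp L))) ^ 2 / expFloor (16 * L) ≤ 48 := by
    have h3 : Real.log (expFloor (Real.exp L)) ≤ Real.exp L := log_expFloor_le (by linarith)
    have h4 : 0 ≤ Real.log (expFloor (Real.exp L)) := Real.log_natCast_nonneg _
    have h5 := exp_half_le_expFloor (show 0 ≤ 16 * L by linarith)
    have h6 : Real.exp L ^ 2 ≤ Real.exp (16 * L) := by
      rw [← Real.exp_nat_mul, Real.exp_le_exp]
      push_cast
      linarith
    rw [div_le_iff₀ (by exact_mod_cast hZ)]
    nlinarith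
  rw [← div_div, div_right_comm, ← add_div, pow_one]
  gcongr ?_ / √L / ε
  linarith

lemma eventually_expFloor_le_sqrt {ε : ℝ} (hε : 0 < ε) :
    ∀ᶠ L : ℝ in atTop,
      (expFloor (16 * Real.log (64 * Real.log (64 * L))) : ℝ) < ε * √L := by
  have h := (tendsto_log_mul_pow_div_sqrt (k := 64) (by norm_num) 16).const_mul (64 ^ 16)
  rw [mul_zero] at h
  filter_upwards [h.eventually_lt_const hε, eventually_ge_atTop 1] with L h1 h2
  have hs := Real.sqrt_pos.2 (show 0 < L by linarith)
  have h3 : 0 < Real.log (64 * L) := Real.log_pos (by linarith)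
  rw [← mul_div_assoc, div_lt_iff₀ hs] at h1
  refine (expFloor_le _).trans_lt ?_
  have : Real.exp (16 * Real.log (64 * Real.log (64 * L))) = (64 * Real.log (64 * L)) ^ 16 := by
    have := Real.exp_nat_mul (Real.log (64 * Real.log (64 * L))) 16
    push_cast at this
    rw [this, Real.exp_log (by positivity)]
  rw [this, mul_pow]
  exact h1

lemma eventually_card_large_primeFactors_lt {ε : ℝ} (hε : 0 < ε) :
    ∀ᶠ L : ℝ in atTop, ∀ n, 2 ≤ n → n ≤ expFloor (Real.exp L) →
      (((sumProper n).primeFactors.filter fun q => expFloor (mainScale L / 4) < q).card : ℝ) <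
        ε * √L := by
  have h := (Real.tendsto_sqrt_atTop.comp Real.tendsto_sqrt_atTop).eventually_gt_atTop (8 / ε)
  filter_upwards [h, eventually_ge_atTop 1] with L h1 h2 n hn hnN
  have hss := sqrt_sqrt_pos (show 0 < L by linarith)
  have hs : √L = √(√L) * √(√L) := (Real.mul_self_sqrt (Real.sqrt_nonneg _)).symm
  simp only [Function.comp_apply] at h1
  rw [div_lt_iff₀' hε] at h1
  have hm := mainScale_pos h2
  have h3 := card_large_primeFactors_mul_log_le (D := expFloor (mainScale L / 4))
    (sumProper_pos hn)
  have h4 : mainScale L / 4 ≤ Real.log ((expFloor (mainScale L / 4) : ℝ) + 1) := by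
    rw [Real.le_log_iff_exp_le (by positivity)]
    exact (exp_lt_expFloor_add_one _).le
  have h5 : Real.log (sumProper n) ≤ 2 * Real.exp L := by
    have h6 : (sumProper n : ℝ) ≤ (n : ℝ) ^ 2 := by exact_mod_cast sumProper_le_sq n
    have h7 := Real.log_le_log (by exact_mod_cast sumProper_pos hn) h6
    rw [Real.log_pow] at h7
    have h8 : (n : ℝ) ≤ Real.exp (Real.exp L) :=
      (by exact_mod_cast hnN : (n : ℝ) ≤ expFloor (Real.exp L)).trans (expFloor_le _)
    have h9 := Real.log_le_log (by positivity) h8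
    rw [Real.log_exp] at h9
    push_cast at h7
    linarith
  set k := (((sumProper n).primeFactors.filter fun q => expFloor (mainScale L / 4) < q).card : ℝ)
  have hk : k * (mainScale L / 4) ≤ 2 * Real.exp L :=
    (mul_le_mul_of_nonneg_left h4 (Nat.cast_nonneg _)).trans (h3.trans h5)
  have h6 : Real.exp L = mainScale L * √(√L) := by
    rw [mainScale]
    field_simp
  have h7 : k ≤ 8 * √(√L) := by
    rw [h6] at hk
    refine le_of_mul_le_mul_right ?_ hm
    linarith
  rw [hs]
  nlinarith

/-- For almost all `n`, few primes dividing `s(n)` are missed by the main term. -/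
lemma tendsto_card_le_sub_newCount {δ : ℝ} (hδ : 0 < δ) :
    Tendsto (fun L : ℝ => (((Finset.Ioc 0 (expFloor (Real.exp L))).filter fun n => 2 ≤ n ∧
      δ * √L ≤ (sumProper n).primeFactors.card - newCount (mainPrimes L) n).card : ℝ) /
      expFloor (Real.exp L)) atTop (nhds 0) := by
  obtain ⟨ε, hε, rfl⟩ : ∃ ε : ℝ, 0 < ε ∧ δ = 6 * ε := ⟨δ / 6, by positivity, by ring⟩
  have hlin : Tendsto (fun L : ℝ => 64 * L) atTop atTop :=
    tendsto_id.const_mul_atTop (by norm_num)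
  have hlog : Tendsto (fun L : ℝ => 64 * Real.log (64 * L)) atTop atTop :=
    (Real.tendsto_log_atTop.comp hlin).const_mul_atTop (by norm_num)
  have hlog_le : ∀ᶠ L : ℝ in atTop, 64 * Real.log (64 * L) ≤ 64 * L := by
    filter_upwards [(Real.tendsto_exp_div_pow_atTop 1).eventually_ge_atTop 64,
      eventually_gt_atTop 0] with L h1 h2
    rw [pow_one, le_div_iff₀ h2] at h1
    have := Real.log_le_log (by positivity) h1
    rw [Real.log_exp] at this
    linarith
  have hb := (((tendsto_card_le_newCount_small hlog hlog_le hε).add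
    (tendsto_card_le_newCount_small hlin (Eventually.of_forall fun L => le_rfl) hε)).add
    (tendsto_card_le_newCount_large hε)).add (tendsto_card_le_commonCount hε)
  simp only [add_zero] at hb
  refine squeeze_zero' (Eventually.of_forall fun L => by positivity) ?_ hb
  filter_upwards [eventually_ge_atTop 1, eventually_expFloor_le_sqrt hε,
    eventually_card_large_primeFactors_lt hε] with L hL h1 h2
  rw [← add_div, ← add_div, ← add_div]
  gcongr
  simp only [← Nat.cast_add]
  refine Nat.cast_le.2 (le_trans (Finset.card_le_card fun n hn => ?_) ((Finset.card_union_le _ _).trans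
    (Nat.add_le_add_right ((Finset.card_union_le _ _).trans
      (Nat.add_le_add_right (Finset.card_union_le _ _) _)) _)))
  rw [Finset.mem_filter] at hn
  obtain ⟨hnN, hn2, hn3⟩ := hn
  simp only [Finset.mem_union, Finset.mem_filter, hnN, true_and]
  by_contra! hcon
  obtain ⟨⟨⟨g1, g2⟩, g3⟩, g4⟩ := hcon
  have hz : expFloor (mainLow L) ≤ expFloor (64 * L / 4) :=
    expFloor_mono (by linarith [mainLow_le hL])
  have key := card_primeFactors_sumProper_le
    (A₁ := expFloor (16 * Real.log (64 * Real.log (64 * L))))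
    (A₂ := expFloor (16 * Real.log (64 * L))) (y := expFloor (mainHigh L))
    (D := expFloor (mainScale L / 4)) hn2 (Finset.mem_Ioc.1 hnN).2 hz
  have key2 : ((sumProper n).primeFactors.card : ℝ) ≤ _ := Nat.cast_le.2 key
  push_cast at key2
  have e1 : 64 * Real.log (64 * L) / 4 = 16 * Real.log (64 * L) := by ring
  rw [e1] at g1
  have h3 := h2 n hn2 (Finset.mem_Ioc.1 hnN).2
  rw [mainPrimes] at hn3
  linarith

open MeasureTheory ProbabilityTheory

/-- The uniform distribution on the values of `f` over a finite set `s`. -/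
noncomputable def empirical (s : Finset ℕ) (f : ℕ → ℝ) : Measure ℝ :=
  (s.card : ENNReal)⁻¹ • ∑ n ∈ s, Measure.dirac (f n)

lemma isProbabilityMeasure_empirical {s : Finset ℕ} (hs : s.Nonempty) (f : ℕ → ℝ) :
    IsProbabilityMeasure (empirical s f) := by
  refine ⟨?_⟩
  have : (s.card : ENNReal) ≠ 0 := by exact_mod_cast hs.card_pos.ne'
  simp [empirical, ENNReal.inv_mul_cancel this]

lemma charFun_empirical (s : Finset ℕ) (f : ℕ → ℝ) (t : ℝ) :
    charFun (empirical s f) t =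
      1 / (s.card : ℂ) * ∑ n ∈ s, Complex.exp (t * (f n : ℝ) * Complex.I) := by
  rw [charFun_apply_real, empirical, integral_smul_measure, integral_finsetSum_measure]
  · simp [ENNReal.toReal_inv]
  · intro n _
    exact integrable_dirac (by simp)

lemma empirical_real_Iic (s : Finset ℕ) (f : ℕ → ℝ) (v : ℝ) :
    (empirical s f).real (Set.Iic v) = ((s.filter fun n => f n ≤ v).card : ℝ) / s.card := by
  have h : (∑ n ∈ s, Measure.dirac (f n)) (Set.Iic v) =
      ((s.filter fun n => f n ≤ v).card : ENNReal) := by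
    rw [Measure.finsetSum_apply, Finset.card_filter]
    push_cast
    refine Finset.sum_congr rfl fun n _ => ?_
    rw [Measure.dirac_apply' _ measurableSet_Iic]
    simp [Set.indicator_apply]
  rw [measureReal_def, empirical, Measure.smul_apply, h, smul_eq_mul, ENNReal.toReal_mul,
    ENNReal.toReal_inv, ENNReal.toReal_natCast, ENNReal.toReal_natCast]
  ring

/-- The standard normal cumulative distribution function. -/
noncomputable def stdNormalCDF (u : ℝ) : ℝ := (gaussianReal 0 1).real (Set.Iic u)

lemma stdNormalCDF_eq (u : ℝ) :
    stdNormalCDF u = (√(2 * Real.pi))⁻¹ * ∫ t in Set.Iic u, Real.exp (-t ^ 2 / 2) := by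
  rw [stdNormalCDF, measureReal_def, gaussianReal_apply_eq_integral _ one_ne_zero,
    ENNReal.toReal_ofReal (setIntegral_nonneg measurableSet_Iic
      fun _ _ => gaussianPDFReal_nonneg _ _ _), ← integral_const_mul]
  simp [gaussianPDFReal]

lemma continuous_stdNormalCDF : Continuous stdNormalCDF := by
  have hint : Integrable (gaussianPDFReal 0 1) := integrable_gaussianPDFReal 0 1
  have h : stdNormalCDF = fun u => ∫ t in Set.Iic u, gaussianPDFReal 0 1 t := by
    funext u
    rw [stdNormalCDF, measureReal_def, gaussianReal_apply_eq_integral _ one_ne_zero,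
      ENNReal.toReal_ofReal (setIntegral_nonneg measurableSet_Iic
        fun _ _ => gaussianPDFReal_nonneg _ _ _)]
  have h2 : stdNormalCDF = fun u => (∫ t in (0 : ℝ)..u, gaussianPDFReal 0 1 t) +
      ∫ t in Set.Iic 0, gaussianPDFReal 0 1 t := by
    rw [h]
    funext u
    rw [← intervalIntegral.integral_Iic_sub_Iic hint.integrableOn hint.integrableOn]
    ring
  rw [h2]
  exact (intervalIntegral.continuous_primitive (fun _ _ => hint.intervalIntegrable) 0).add
    continuous_const

lemma tendsto_card_filter_le {N : ℕ → ℕ} (hN : ∀ k, 0 < N k) {f : ℕ → ℕ → ℝ}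
    (hf : ∀ θ : ℝ, Tendsto (fun k => 1 / (N k : ℂ) * ∑ n ∈ Finset.Ioc 0 (N k),
      Complex.exp (θ * (f k n : ℝ) * Complex.I)) atTop (nhds (Complex.exp (-θ ^ 2 / 2))))
    (v : ℝ) :
    Tendsto (fun k => (((Finset.Ioc 0 (N k)).filter fun n => f k n ≤ v).card : ℝ) / N k) atTop
      (nhds (stdNormalCDF v)) := by
  have hne : ∀ k, (Finset.Ioc 0 (N k)).Nonempty := fun k => Finset.nonempty_Ioc.2 (hN k)
  let μ : ℕ → ProbabilityMeasure ℝ := fun k =>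
    ⟨empirical (Finset.Ioc 0 (N k)) (f k), isProbabilityMeasure_empirical (hne k) _⟩
  let μ₀ : ProbabilityMeasure ℝ := ⟨gaussianReal 0 1, inferInstance⟩
  have hμ : Tendsto μ atTop (nhds μ₀) := by
    refine ProbabilityMeasure.tendsto_iff_tendsto_charFun.2 fun t => ?_
    have h0 : charFun (μ₀ : Measure ℝ) t = Complex.exp (-t ^ 2 / 2) := by
      change charFun (gaussianReal 0 1) t = _
      rw [charFun_gaussianReal]
      congr 1
      simp
      ring
    have h1 : ∀ k, charFun (μ k : Measure ℝ) t = _ := fun k =>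
      charFun_empirical (Finset.Ioc 0 (N k)) (f k) t
    rw [h0]
    simp only [h1, Nat.card_Ioc, tsub_zero]
    exact hf t
  have hnull : (μ₀ : Measure ℝ) (frontier (Set.Iic v)) = 0 := by
    have := nullSingletonClass_gaussianReal (μ := 0) (v := 1) one_ne_zero
    rw [frontier_Iic]
    exact measure_singleton (μ := gaussianReal 0 1) v
  have h2 := ProbabilityMeasure.tendsto_measure_of_null_frontier_of_tendsto' hμ hnull
  have h3 := (ENNReal.tendsto_toReal (measure_ne_top (μ₀ : Measure ℝ) (Set.Iic v))).comp h2
  refine h3.congr fun k => ?_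
  have h4 := empirical_real_Iic (Finset.Ioc 0 (N k)) (f k) v
  rw [Nat.card_Ioc, tsub_zero] at h4
  exact h4

lemma tendsto_card_newCount_le (v : ℝ) :
    Tendsto (fun L : ℝ => (((Finset.Ioc 0 (expFloor (Real.exp L))).filter fun n =>
      (newCount (mainPrimes L) n - L) / √L ≤ v).card : ℝ) / expFloor (Real.exp L)) atTop
      (nhds (stdNormalCDF v)) := by
  refine tendsto_of_seq_tendsto fun x hx => ?_
  exact tendsto_card_filter_le (fun k => expFloor_pos (Real.exp_pos _).le)
    (f := fun k n => (newCount (mainPrimes (x k)) n - x k) / √(x k))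
    (fun θ => (tendsto_charFun_main θ).comp hx) v

lemma tendsto_card_primeFactors_le (u : ℝ) :
    Tendsto (fun L : ℝ => (((Finset.Icc 2 (expFloor (Real.exp L))).filter fun n =>
      ((sumProper n).primeFactors.card : ℝ) - L ≤ u * √L).card : ℝ) / expFloor (Real.exp L))
      atTop (nhds (stdNormalCDF u)) := by
  have hone : Tendsto (fun L : ℝ => 1 / (expFloor (Real.exp L) : ℝ)) atTop (nhds 0) :=
    tendsto_const_nhds.div_atTop (tendsto_expFloor Real.tendsto_exp_atTop)
  rw [tendsto_order]
  constructor
  · intro c hc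
    obtain ⟨δ, hδ, hcδ⟩ : ∃ δ > 0, c < stdNormalCDF (u - δ) := by
      have h := continuous_stdNormalCDF.continuousAt.eventually_const_lt hc
      obtain ⟨δ, hδ, h⟩ := Metric.eventually_nhds_iff.1 h
      exact ⟨δ / 2, by positivity, h (by
        rw [Real.dist_eq, sub_sub_cancel_left, abs_neg, abs_of_pos] <;> linarith)⟩
    have hlim := ((tendsto_card_newCount_le (u - δ)).sub (tendsto_card_le_sub_newCount hδ)).sub
      hone
    rw [sub_zero, sub_zero] at hlim
    filter_upwards [hlim.eventually_const_lt hcδ, eventually_ge_atTop 1] with L h1 h2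
    refine h1.trans_le ?_
    have hs := Real.sqrt_pos.2 (show 0 < L by linarith)
    rw [← sub_div, ← sub_div]
    gcongr
    rw [sub_sub, sub_le_iff_le_add, ← add_assoc]
    simp only [← Nat.cast_add, ← Nat.cast_add_one]
    refine Nat.cast_le.2 (le_trans (Finset.card_le_card (t := (_ ∪ _) ∪ {1}) fun n hn => ?_)
      ((Finset.card_union_le _ _).trans (Nat.add_le_add (Finset.card_union_le _ _)
        (Finset.card_singleton 1).le)))
    rw [Finset.mem_filter, div_le_iff₀ hs, Finset.mem_Ioc] at hn
    simp only [Finset.mem_union, Finset.mem_filter, Finset.mem_Icc, Finset.mem_Ioc,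
      Finset.mem_singleton]
    by_cases hn1 : n = 1
    · exact Or.inr hn1
    have hn2 : 2 ≤ n := by omega
    refine Or.inl ?_
    by_cases h3 : ((sumProper n).primeFactors.card : ℝ) - L ≤ u * √L
    · exact Or.inl ⟨⟨hn2, hn.1.2⟩, h3⟩
    · refine Or.inr ⟨hn.1, hn2, ?_⟩
      linarith
  · intro c hc
    filter_upwards [(tendsto_card_newCount_le u).eventually_lt_const hc, eventually_ge_atTop 1]
      with L h1 h2
    refine lt_of_le_of_lt ?_ h1
    have hs := Real.sqrt_pos.2 (show 0 < L by linarith)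
    gcongr ?_ / _
    refine Nat.cast_le.2 (Finset.card_le_card fun n hn => ?_)
    rw [Finset.mem_filter, Finset.mem_Icc] at hn
    rw [Finset.mem_filter, Finset.mem_Ioc, div_le_iff₀ hs]
    refine ⟨⟨by omega, hn.1.2⟩, le_trans ?_ hn.2⟩
    have : (newCount (mainPrimes L) n : ℝ) ≤ (sumProper n).primeFactors.card := by
      exact_mod_cast newCount_le_card_primeFactors (fun q hq => (mem_primesIoc.1 hq).2) hn.1.1
    linarith

end ErdosKac

/-- **Sums of proper divisors follow the Erdős–Kac law.**
For fixed real `u`, as `x → ∞`, the proportion of `n` with `1 < n ≤ x` such that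
`ω(s(n)) − log log x ≤ u √(log log x)` tends to the standard normal CDF at `u`,
where `s(n) = σ(n) − n` is the sum of proper divisors of `n`. -/
theorem erdosKac_sum_proper_divisors (u : ℝ) :
    Tendsto (fun x : ℝ =>
      (((Finset.Icc 2 ⌊x⌋₊).filter (fun n : ℕ =>
        (((∑ d ∈ n.properDivisors, d).primeFactors.card : ℝ)) - Real.log (Real.log x)
          ≤ u * Real.sqrt (Real.log (Real.log x)))).card : ℝ) / x)
      atTop
      (nhds ((Real.sqrt (2 * Real.pi))⁻¹ * ∫ t in Set.Iic u, Real.exp (-t ^ 2 / 2))) := by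
  rw [← ErdosKac.stdNormalCDF_eq]
  have h1 := (ErdosKac.tendsto_card_primeFactors_le u).comp
    (Real.tendsto_log_atTop.comp Real.tendsto_log_atTop)
  have h2 := h1.mul (tendsto_nat_floor_div_atTop (R := ℝ))
  rw [mul_one] at h2
  refine h2.congr' ?_
  filter_upwards [eventually_gt_atTop 1] with x hx
  have h3 : ErdosKac.expFloor (Real.exp (Real.log (Real.log x))) = ⌊x⌋₊ := by
    rw [ErdosKac.expFloor, Real.exp_log (Real.log_pos hx), Real.exp_log (by linarith)]
  have h4 : (⌊x⌋₊ : ℝ) ≠ 0 := by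
    exact_mod_cast (Nat.floor_pos.2 hx.le).ne'
  simp only [Function.comp_apply, h3]
  rw [div_mul_div_cancel₀ h4]
  rfl
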